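/- There is a universal constant c > 0 with the following property. Let n ≥ 3, let K ⊆ ℝⁿ be a convex body with 0 in its interior, and let δ > 0. If for every pair of 2-dimensional linear subspaces E, F ⊆ ℝⁿ one has d_BM(K ∩ E, K ∩ F) < 1 + δ, then d_BM(K, Bⁿ) < 1 + c·n^{2n²}·δ^{1/6}, where Bⁿ is the closed Euclidean unit ball of ℝⁿ. -/

import Mathlib

open Set Metric Pointwise

/-- `dBMlt K L lam` expresses that the (affine) Banach–Mazur distance between the
convex bodies `K ⊆ V` and `L ⊆ W` is `< lam`: there exist an invertible affine map
`T : W → V` and a vector `z ∈ V` with `K ⊆ T(L) ⊆ lam • K + z`. -/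
def dBMlt {V W : Type*} [AddCommGroup V] [Module ℝ V] [AddCommGroup W] [Module ℝ W]
    (K : Set V) (L : Set W) (lam : ℝ) : Prop :=
  ∃ (T : W ≃ᵃ[ℝ] V) (z : V), K ⊆ T '' L ∧ T '' L ⊆ lam • K + {z}

theorem eq_of_exp_eq_one {f : ℝ → ℂ} (hf : Continuous f) (h : ∀ x, Complex.exp (f x) = 1)
    (x y : ℝ) : f x = f y := by
  have key := Complex.isCoveringMap_exp.eq_of_comp_eq (A := ℝ) hf
    (continuous_const (y := f x)) (by
      funext t
      simp [Function.comp, h]) x rfl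
  exact (congrFun key y).symm

/-- A planar winding number obstruction: a homotopy of nonvanishing loops from a constant loop
cannot end at a loop of nonzero degree. -/
theorem exists_zero_of_winding (F : ℝ × ℝ → ℂ) (hF : Continuous F)
    (hper : ∀ s, F (s, 2 * Real.pi) = F (s, 0)) (h0 : ∀ t, F (0, t) = F (0, 0))
    (k : ℤ) (hk : k ≠ 0)
    (h1 : ∀ t : ℝ, F (1, t) = Complex.exp (k * t * Complex.I) * F (1, 0)) :
    ∃ p, F p = 0 := by
  by_contra! hne
  obtain ⟨l, ⟨-, hl⟩, -⟩ := Complex.isCoveringMap_exp.existsUnique_continuousMap_lifts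
    (A := ℝ × ℝ) ⟨fun p => ⟨F p, hne p⟩, by fun_prop⟩ (0, 0) (Complex.log (F (0, 0)))
    (by simp [Complex.exp_log (hne _)])
  have hexp : ∀ p, Complex.exp (l p) = F p := fun p => by
    have := congrFun hl p
    simpa using congrArg Subtype.val this
  have hlc : Continuous l := l.continuous
  have e1 := eq_of_exp_eq_one (f := fun s => l (s, 2 * Real.pi) - l (s, 0)) (by fun_prop)
    (fun s => by rw [Complex.exp_sub, hexp, hexp, hper, div_self (hne _)]) 0 1
  have e2 := eq_of_exp_eq_one (f := fun t => l (0, t) - l (0, 0)) (by fun_prop)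
    (fun s => by rw [Complex.exp_sub, hexp, hexp, h0, div_self (hne _)]) 0 (2 * Real.pi)
  have e3 := eq_of_exp_eq_one (f := fun t => l (1, t) - l (1, 0) - k * t * Complex.I) (by fun_prop)
    (fun s => by
      rw [Complex.exp_sub, Complex.exp_sub, hexp, hexp, h1, mul_div_assoc, div_self (hne _), mul_one,
        div_self (Complex.exp_ne_zero _)]) 0 (2 * Real.pi)
  simp only [sub_self] at e2
  simp only [← e2] at e1
  simp only [← e1] at e3
  simp [hk, Real.pi_ne_zero] at e3

lemma cos_half_pow_expand (N : ℕ) (t : ℝ) :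
    ((Real.cos (t / 2) ^ (2 * N) : ℝ) : ℂ) =
      ∑ j ∈ Finset.range (2 * N + 1), ((((2 * N).choose j : ℝ) / 4 ^ N : ℝ) : ℂ) *
        Complex.exp (((j : ℤ) - (N : ℤ) : ℤ) * t * Complex.I) := by
  push_cast
  have h : Complex.cos (t / 2) = (1 + Complex.exp (t * Complex.I)) *
      Complex.exp (-(t / 2) * Complex.I) / 2 := by
    rw [Complex.cos, add_mul, ← Complex.exp_add]
    ring_nf
  have hh : Complex.exp (-(t / 2) * Complex.I) ^ (2 * N) = Complex.exp (-N * t * Complex.I) := by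
    rw [← Complex.exp_nat_mul]; congr 1; push_cast; ring
  rw [h, div_pow, mul_pow, hh, add_comm (1 : ℂ), add_pow, Finset.sum_mul, Finset.sum_div]
  refine Finset.sum_congr rfl fun j _ => ?_
  rw [← Complex.exp_nat_mul, one_pow, mul_one, pow_mul]
  rw [show ((j : ℂ) - N) * t * Complex.I = j * (t * Complex.I) + (-N * t * Complex.I) by ring,
    Complex.exp_add]
  norm_num
  ring

lemma cos_half_pow_integral_lower (N : ℕ) (hN : 1 ≤ N) :
    3 / (2 * Real.sqrt N) ≤ ∫ t in (-Real.pi)..Real.pi, Real.cos (t / 2) ^ (2 * N) := by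
  have hN' : (1 : ℝ) ≤ N := by exact_mod_cast hN
  have hs : 1 ≤ Real.sqrt N := by rw [Real.one_le_sqrt]; exact hN'
  have hsq : Real.sqrt N ^ 2 = N := Real.sq_sqrt (by linarith)
  set a := 1 / Real.sqrt N with ha
  have ha0 : 0 < a := by positivity
  have ha1 : a ≤ 1 := by rw [ha, div_le_one (by positivity)]; exact hs
  have hpi : 3 < Real.pi := Real.pi_gt_three
  have hpt : ∀ t ∈ Icc (-a) a, (3 / 4 : ℝ) ≤ Real.cos (t / 2) ^ (2 * N) := by
    intro t ht
    have htt : t ^ 2 ≤ 1 / N := by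
      have : t ^ 2 ≤ a ^ 2 := by apply sq_le_sq'; exact ht.1; exact ht.2
      rw [ha, div_pow, hsq, one_pow] at this
      exact this
    have ht1 : t ^ 2 ≤ 1 := htt.trans (by rw [div_le_one (by positivity)]; exact hN')
    have hc := Real.one_sub_sq_div_two_le_cos (x := t / 2)
    have hb := one_add_mul_le_pow (a := -(t ^ 2 / 8)) (by linarith) (2 * N)
    calc (3 / 4 : ℝ) ≤ 1 + ((2 * N : ℕ) : ℝ) * -(t ^ 2 / 8) := by
          push_cast
          have : (N : ℝ) * t ^ 2 ≤ 1 := by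
            rw [le_div_iff₀ (by positivity)] at htt; linarith
          linarith
      _ ≤ _ := hb
      _ ≤ _ := by
        apply pow_le_pow_left₀ (by linarith)
        linarith [hc]
  have hcont : Continuous fun t : ℝ => Real.cos (t / 2) ^ (2 * N) := by fun_prop
  have h1 : ∫ t in (-a)..a, (3 / 4 : ℝ) ≤ ∫ t in (-a)..a, Real.cos (t / 2) ^ (2 * N) := by
    apply intervalIntegral.integral_mono_on (by linarith) (by simp) (hcont.intervalIntegrable _ _)
    exact hpt
  have h2 : ∫ t in (-a)..a, Real.cos (t / 2) ^ (2 * N) ≤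
      ∫ t in (-Real.pi)..Real.pi, Real.cos (t / 2) ^ (2 * N) := by
    apply intervalIntegral.integral_mono_interval (by linarith) (by linarith) (by linarith)
    · exact Filter.Eventually.of_forall fun t => by
        show (0 : ℝ) ≤ Real.cos (t / 2) ^ (2 * N)
        rw [pow_mul]; positivity
    · exact hcont.intervalIntegrable _ _
  have h3 : ∫ t in (-a)..a, (3 / 4 : ℝ) = 3 / (2 * Real.sqrt N) := by
    rw [intervalIntegral.integral_const, smul_eq_mul, ha]
    field_simp; norm_num
  linarith

lemma abs_mul_cos_half_pow_integral_upper (N : ℕ) :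
    ∫ t in (-Real.pi)..Real.pi, |t| * Real.cos (t / 2) ^ (2 * N) ≤ 4 * Real.pi / (2 * N + 1) := by
  have hpi := Real.pi_pos
  have hcont : Continuous fun t : ℝ => |t| * Real.cos (t / 2) ^ (2 * N) := by fun_prop
  have hev : ∫ t in (-Real.pi)..0, |t| * Real.cos (t / 2) ^ (2 * N) =
      ∫ t in (0)..Real.pi, |t| * Real.cos (t / 2) ^ (2 * N) := by
    have := intervalIntegral.integral_comp_neg (a := 0) (b := Real.pi)
      (fun t : ℝ => |t| * Real.cos (t / 2) ^ (2 * N))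
    simp only [neg_zero] at this
    rw [← this]
    congr 1; ext t
    rw [abs_neg, neg_div, Real.cos_neg]
  rw [← intervalIntegral.integral_add_adjacent_intervals (hcont.intervalIntegrable _ 0)
    (hcont.intervalIntegrable _ _), hev]
  have hle : ∫ t in (0)..Real.pi, |t| * Real.cos (t / 2) ^ (2 * N) ≤
      ∫ t in (0)..Real.pi, Real.pi * (Real.sin (t / 2) * Real.cos (t / 2) ^ (2 * N)) := by
    apply intervalIntegral.integral_mono_on hpi.le (hcont.intervalIntegrable _ _)
    · exact Continuous.intervalIntegrable (by fun_prop) _ _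
    · intro t ht
      rw [abs_of_nonneg ht.1, ← mul_assoc]
      apply mul_le_mul_of_nonneg_right
      · have := Real.mul_le_sin (x := t / 2) (by linarith [ht.1]) (by linarith [ht.2])
        have h2 : 2 / Real.pi * (t / 2) * Real.pi = t := by field_simp
        nlinarith
      · rw [pow_mul]; positivity
  have hF : ∫ t in (0)..Real.pi, Real.pi * (Real.sin (t / 2) * Real.cos (t / 2) ^ (2 * N)) =
      2 * Real.pi / (2 * N + 1) := by
    have hd : ∀ t ∈ uIcc 0 Real.pi, HasDerivAt
        (fun t : ℝ => -(2 * Real.pi / (2 * N + 1)) * Real.cos (t / 2) ^ (2 * N + 1))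
        (Real.pi * (Real.sin (t / 2) * Real.cos (t / 2) ^ (2 * N))) t := by
      intro t _
      have h1 : HasDerivAt (fun t : ℝ => t / 2) (1 / 2) t := (hasDerivAt_id t).div_const 2
      have h2 := ((h1.cos.pow (2 * N + 1)).const_mul (-(2 * Real.pi / (2 * N + 1))))
      refine HasDerivAt.congr_deriv h2 ?_
      have : (2 * (N : ℝ) + 1) ≠ 0 := by positivity
      push_cast
      field_simp
    rw [intervalIntegral.integral_eq_sub_of_hasDerivAt hd
      (Continuous.intervalIntegrable (by fun_prop) _ _)]
    simp
  have : 4 * Real.pi / (2 * N + 1) = 2 * (2 * Real.pi / (2 * N + 1)) := by ring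
  linarith

lemma exists_near_const_of_fourier_small {L κ : ℝ} (hκ : 0 < κ) (hκ1 : κ ≤ 1) (hL : 0 ≤ L)
    {h : ℝ → ℝ} (hc : Continuous h) (hper : ∀ t, h (t + 2 * Real.pi) = h t)
    (hlip : ∀ s t, |h s - h t| ≤ L * |s - t|)
    (hF : ∀ m : ℕ, 1 ≤ m →
      ‖∫ t in (-Real.pi)..Real.pi, (h t : ℂ) * Complex.exp (m * t * Complex.I)‖ ≤ κ) :
    ∃ h0 : ℝ, ∀ φ, |h φ - h0| ≤ (5 * L + 1) * Real.sqrt κ := by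
  have hpi := Real.pi_pos
  -- the estimate for negative frequencies follows by conjugation
  have hF' : ∀ m : ℤ, m ≠ 0 →
      ‖∫ t in (-Real.pi)..Real.pi, (h t : ℂ) * Complex.exp (m * t * Complex.I)‖ ≤ κ := by
    intro m hm
    rcases Int.eq_nat_or_neg m with ⟨k, rfl | rfl⟩
    · have hk : 1 ≤ k := by
        rcases Nat.eq_zero_or_pos k with rfl | h; · simp at hm
        exact h
      simpa using hF k hk
    · have hk : 1 ≤ k := by
        rcases Nat.eq_zero_or_pos k with rfl | h; · simp at hm
        exact h
      have h1 := hF k hk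
      have h2 : (∫ t in (-Real.pi)..Real.pi, (h t : ℂ) * Complex.exp (((-(k : ℤ) : ℤ) : ℂ) * t * Complex.I)) =
          (starRingEnd ℂ) (∫ t in (-Real.pi)..Real.pi, (h t : ℂ) * Complex.exp (k * t * Complex.I)) := by
        rw [intervalIntegral.integral_of_le (by linarith), intervalIntegral.integral_of_le (by linarith),
          ← integral_conj]
        congr 1; ext t
        rw [map_mul, ← Complex.exp_conj]
        simp
      rw [h2, RCLike.norm_conj]; exact h1
  obtain ⟨N, hN1, hN2⟩ : ∃ N : ℕ, 1 / κ ≤ N ∧ (N : ℝ) ≤ 2 / κ := by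
    refine ⟨⌈1 / κ⌉₊, Nat.le_ceil _, ?_⟩
    have := Nat.ceil_lt_add_one (a := 1 / κ) (by positivity)
    have h1 : 1 ≤ 1 / κ := by rw [le_div_iff₀ hκ]; linarith
    have h2 : 2 / κ = 1 / κ + 1 / κ := by ring
    linarith
  have hNr : (1 : ℝ) ≤ N := by
    have h1 : 1 ≤ 1 / κ := by rw [le_div_iff₀ hκ]; linarith
    linarith
  have hN : 1 ≤ N := by exact_mod_cast hNr
  set k : ℝ → ℝ := fun t => Real.cos (t / 2) ^ (2 * N) with hk
  have hkc : Continuous k := by fun_prop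
  have hk0 : ∀ t, 0 ≤ k t := fun t => by simp only [hk]; rw [pow_mul]; positivity
  set I := ∫ t in (-Real.pi)..Real.pi, k t with hI
  have hIlow : 3 / (2 * Real.sqrt N) ≤ I := cos_half_pow_integral_lower N hN
  have hsN : 1 ≤ Real.sqrt N := by rw [Real.one_le_sqrt]; exact hNr
  have hI0 : 0 < I := lt_of_lt_of_le (by positivity) hIlow
  have hkper : ∀ t, k (t + 2 * Real.pi) = k t := by
    intro t
    simp only [hk]
    rw [show (t + 2 * Real.pi) / 2 = t / 2 + Real.pi by ring, Real.cos_add_pi, pow_mul, pow_mul,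
      neg_sq]
  -- smoothing
  have hJ1 : ∀ φ, |(∫ t in (-Real.pi)..Real.pi, h (t + φ) * k t) - h φ * I| ≤
      L * (4 * Real.pi / (2 * N + 1)) := by
    intro φ
    have hInt : ∀ f : ℝ → ℝ, Continuous f →
      IntervalIntegrable f MeasureTheory.volume (-Real.pi) Real.pi :=
        fun f hf => hf.intervalIntegrable _ _
    rw [hI, ← intervalIntegral.integral_const_mul, ← intervalIntegral.integral_sub
      (hInt _ (by fun_prop)) (hInt _ (by fun_prop)), ← Real.norm_eq_abs]
    calc _ ≤ ∫ t in (-Real.pi)..Real.pi, L * (|t| * k t) := by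
          apply intervalIntegral.norm_integral_le_of_norm_le (by linarith)
          · refine Filter.Eventually.of_forall fun t _ => ?_
            rw [← sub_mul, norm_mul, Real.norm_eq_abs, Real.norm_eq_abs, abs_of_nonneg (hk0 t),
              ← mul_assoc]
            apply mul_le_mul_of_nonneg_right _ (hk0 t)
            simpa using hlip (t + φ) φ
          · exact hInt _ (by fun_prop)
      _ ≤ _ := by
        rw [intervalIntegral.integral_const_mul]
        exact mul_le_mul_of_nonneg_left (abs_mul_cos_half_pow_integral_upper N) hL
  have hJ2 : ∀ φ, (∫ t in (-Real.pi)..Real.pi, h (t + φ) * k t) =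
      ∫ t in (-Real.pi)..Real.pi, h t * k (t - φ) := by
    intro φ
    have hp : Function.Periodic (fun t => h t * k (t - φ)) (2 * Real.pi) := by
      intro t
      simp only
      rw [hper, show t + 2 * Real.pi - φ = (t - φ) + 2 * Real.pi by ring, hkper]
    have h1 := intervalIntegral.integral_comp_add_right (a := -Real.pi) (b := Real.pi)
      (fun t => h t * k (t - φ)) φ
    simp only [add_sub_cancel_right] at h1
    rw [h1]
    have h2 := hp.intervalIntegral_add_eq (-Real.pi + φ) (-Real.pi)
    rw [show -Real.pi + φ + 2 * Real.pi = Real.pi + φ by ring,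
      show -Real.pi + 2 * Real.pi = Real.pi by ring] at h2
    exact h2
  set c : ℕ → ℝ := fun j => ((2 * N).choose j : ℝ) / 4 ^ N with hcdef
  have hc0 : ∀ j, 0 ≤ c j := fun j => by positivity
  have hcsum : ∑ j ∈ Finset.range (2 * N + 1), c j = 1 := by
    simp only [hcdef]
    rw [← Finset.sum_div, ← Nat.cast_sum, Nat.sum_range_choose, pow_mul]
    norm_num
  set H : ℤ → ℂ := fun m => ∫ t in (-Real.pi)..Real.pi, (h t : ℂ) * Complex.exp (m * t * Complex.I)
    with hH
  have hJ3 : ∀ φ, ((∫ t in (-Real.pi)..Real.pi, h t * k (t - φ) : ℝ) : ℂ) =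
      ∑ j ∈ Finset.range (2 * N + 1), (c j : ℂ) *
        Complex.exp (((j : ℤ) - (N : ℤ) : ℤ) * (-φ) * Complex.I) * H ((j : ℤ) - (N : ℤ)) := by
    intro φ
    rw [← intervalIntegral.integral_ofReal]
    simp only [hH, ← intervalIntegral.integral_const_mul]
    rw [← intervalIntegral.integral_finsetSum]
    · congr 1; ext t
      rw [Complex.ofReal_mul, cos_half_pow_expand, Finset.mul_sum]
      refine Finset.sum_congr rfl fun j _ => ?_
      rw [show ((((j : ℤ) - (N : ℤ) : ℤ) : ℂ) * ((t - φ : ℝ) : ℂ) * Complex.I) =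
        (((j : ℤ) - (N : ℤ) : ℤ) : ℂ) * (-φ) * Complex.I +
        (((j : ℤ) - (N : ℤ) : ℤ) : ℂ) * t * Complex.I by push_cast; ring, Complex.exp_add]
      ring
    · intro j _
      exact Continuous.intervalIntegrable (by fun_prop) _ _
  set H0 := c N * (H 0).re with hH0
  have hJ4 : ∀ φ, |(∫ t in (-Real.pi)..Real.pi, h t * k (t - φ)) - H0| ≤ κ := by
    intro φ
    have hre := congrArg Complex.re (hJ3 φ)
    rw [Complex.ofReal_re] at hre
    have hmem : N ∈ Finset.range (2 * N + 1) := by simp; omega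
    rw [← Finset.add_sum_erase _ _ hmem] at hre
    simp only [sub_self, Int.cast_zero, zero_mul, Complex.exp_zero, mul_one, Complex.add_re,
      Complex.re_ofReal_mul] at hre
    rw [hre, hH0, add_sub_cancel_left]
    refine (Complex.abs_re_le_norm _).trans ((norm_sum_le _ _).trans ?_)
    calc _ ≤ ∑ j ∈ (Finset.range (2 * N + 1)).erase N, c j * κ := by
          refine Finset.sum_le_sum fun j hj => ?_
          have hjN : (j : ℤ) - (N : ℤ) ≠ 0 := by
            have := Finset.ne_of_mem_erase hj
            omega
          have he : ‖Complex.exp ((((j : ℤ) - (N : ℤ) : ℤ) : ℂ) * (-φ) * Complex.I)‖ = 1 := by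
            have := Complex.norm_exp_ofReal_mul_I (((((j : ℤ) - (N : ℤ) : ℤ) : ℝ) * (-φ)))
            rw [← this]; push_cast; ring_nf
          rw [norm_mul, norm_mul, he, mul_one, Complex.norm_real, Real.norm_eq_abs,
            abs_of_nonneg (hc0 j)]
          exact mul_le_mul_of_nonneg_left (hF' _ hjN) (hc0 j)
      _ ≤ ∑ j ∈ Finset.range (2 * N + 1), c j * κ :=
          Finset.sum_le_sum_of_subset_of_nonneg (Finset.erase_subset _ _)
            fun j _ _ => mul_nonneg (hc0 j) hκ.le
      _ = κ := by rw [← Finset.sum_mul, hcsum, one_mul]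
  refine ⟨H0 / I, fun φ => ?_⟩
  have h1 := hJ1 φ
  have h2 := hJ4 φ
  rw [hJ2] at h1
  have h3 : |h φ * I - H0| ≤ L * (4 * Real.pi / (2 * N + 1)) + κ := by
    rw [abs_le] at *; constructor <;> linarith [h1.1, h1.2, h2.1, h2.2]
  have h4 : |h φ - H0 / I| = |h φ * I - H0| / I := by
    rw [← abs_of_pos hI0, ← abs_div, abs_of_pos hI0]; congr 1; field_simp
  rw [h4, div_le_iff₀ hI0]
  have hsk : 0 < Real.sqrt κ := Real.sqrt_pos.2 hκ
  have hskk : Real.sqrt κ ^ 2 = κ := Real.sq_sqrt hκ.le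
  have hsNN : Real.sqrt N ^ 2 = N := Real.sq_sqrt (by linarith)
  set a := Real.sqrt κ
  set b := Real.sqrt N
  have hab1 : 1 ≤ a * b := by
    have : 1 ≤ (a * b) ^ 2 := by
      rw [mul_pow, hskk, hsNN]; rw [div_le_iff₀ hκ] at hN1; linarith
    nlinarith [mul_pos hsk (lt_of_lt_of_le one_pos hsN)]
  have hab2 : a * b ≤ 3 / 2 := by
    have : (a * b) ^ 2 ≤ 2 := by
      rw [mul_pow, hskk, hsNN]; rw [le_div_iff₀ hκ] at hN2; linarith
    nlinarith [mul_pos hsk (lt_of_lt_of_le one_pos hsN)]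
  have hb : 0 < b := by linarith
  have h5 : L * (4 * Real.pi / (2 * N + 1)) ≤ 5 * L * a * I := by
    have : 4 * Real.pi / (2 * N + 1) ≤ 5 * a * (3 / (2 * b)) := by
      rw [div_le_iff₀ (by positivity), ← hsNN]
      have : 5 * a * (3 / (2 * b)) * (2 * b ^ 2 + 1) = 15 * (a * b) + 15 * a / (2 * b) := by
        field_simp; norm_num
      rw [this]
      have : 0 < 15 * a / (2 * b) := by positivity
      linarith [Real.pi_lt_d2]
    calc _ ≤ L * (5 * a * (3 / (2 * b))) := mul_le_mul_of_nonneg_left this hL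
      _ = 5 * L * a * (3 / (2 * b)) := by ring
      _ ≤ _ := mul_le_mul_of_nonneg_left hIlow (by positivity)
  have h6 : κ ≤ a * I := by
    calc κ = a * a := by rw [← hskk]; ring
      _ ≤ a * (3 / (2 * b)) := by
        apply mul_le_mul_of_nonneg_left _ hsk.le
        rw [le_div_iff₀ (by positivity)]; linarith
      _ ≤ _ := mul_le_mul_of_nonneg_left hIlow hsk.le
  linarith

lemma integral_angular_eq {A : Set ℂ} (hA : IsCompact A) (hconv : Convex ℝ A) (h0 : A ∈ nhds 0)
    (m : ℕ) :
    ∫ z in A, (z / ‖z‖) ^ m = ∫ t in (-Real.pi)..Real.pi,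
      ((1 / (2 * gauge A (Complex.exp (t * Complex.I)) ^ 2) : ℝ) : ℂ) *
        Complex.exp (m * t * Complex.I) := by
  have habs : Absorbent ℝ A := absorbent_nhds_zero h0
  have hgc : Continuous (gauge A) := continuous_gauge hconv h0
  set g : ℝ → ℝ := fun t => gauge A (Complex.exp (t * Complex.I)) with hg
  have hgcont : Continuous g := by fun_prop
  have hgpos : ∀ t, 0 < g t := fun t =>
    (gauge_pos habs ((NormedSpace.isVonNBounded_iff ℝ).2 hA.isBounded)).2 (Complex.exp_ne_zero _)
  have hmem : ∀ z, z ∈ A ↔ gauge A z ≤ 1 := fun z => by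
    rw [gauge_le_one_iff_mem_closure hconv h0, hA.isClosed.closure_eq]
  obtain ⟨R, hR⟩ := hA.isBounded.subset_closedBall 0
  set W : Set (ℝ × ℝ) := {p | p.1 * g p.2 ≤ 1} with hW
  have hWm : IsClosed W := isClosed_le (by fun_prop) continuous_const
  set F : ℝ × ℝ → ℂ := fun p => (p.1 : ℂ) * Complex.exp (m * p.2 * Complex.I) with hF
  have hFc : Continuous F := by fun_prop
  have hsymm : ∀ p : ℝ × ℝ, Complex.polarCoord.symm p = p.1 * Complex.exp (p.2 * Complex.I) := by
    intro p
    rw [Complex.polarCoord_symm_apply, Complex.exp_mul_I]; simp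
  have hmemW : ∀ p ∈ polarCoord.target, (Complex.polarCoord.symm p ∈ A ↔ p ∈ W) := by
    intro p hp
    have hp1 : 0 < p.1 := hp.1
    rw [hsymm, hmem, hW, mem_ofPred_eq, hg]
    have := gauge_smul_of_nonneg (s := A) hp1.le (Complex.exp (p.2 * Complex.I))
    rw [Complex.real_smul] at this
    rw [this, smul_eq_mul]
  rw [← MeasureTheory.integral_indicator hA.measurableSet, ← Complex.integral_comp_polarCoord_symm]
  have hstep : ∫ p in polarCoord.target, p.1 • A.indicator (fun z : ℂ => (z / ‖z‖) ^ m)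
      (Complex.polarCoord.symm p) = ∫ p in Ioi (0 : ℝ) ×ˢ Ioo (-Real.pi) Real.pi, W.indicator F p := by
    apply MeasureTheory.setIntegral_congr_fun polarCoord.open_target.measurableSet
    intro p hp
    have hp1 : 0 < p.1 := hp.1
    simp only
    by_cases h : p ∈ W
    · rw [indicator_of_mem h, indicator_of_mem ((hmemW p hp).2 h), hsymm]
      have h1 : ‖(p.1 : ℂ) * Complex.exp (p.2 * Complex.I)‖ = p.1 := by
        rw [norm_mul, Complex.norm_exp_ofReal_mul_I, mul_one, Complex.norm_real, Real.norm_eq_abs,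
          abs_of_pos hp1]
      rw [h1, mul_div_cancel_left₀ _ (by exact_mod_cast hp1.ne'), ← Complex.exp_nat_mul,
        Complex.real_smul, hF]
      simp only [mul_assoc]
    · rw [indicator_of_notMem h, indicator_of_notMem (fun h' => h ((hmemW p hp).1 h')), smul_zero]
  have hInt : MeasureTheory.IntegrableOn (W.indicator F) (Ioi (0 : ℝ) ×ˢ Ioo (-Real.pi) Real.pi)
      (MeasureTheory.volume.prod MeasureTheory.volume) := by
    have hsub : W ∩ Ioi (0 : ℝ) ×ˢ Ioo (-Real.pi) Real.pi ⊆ Icc 0 R ×ˢ Icc (-Real.pi) Real.pi := by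
      rintro p ⟨hpW, hp⟩
      have hp1 : 0 < p.1 := hp.1
      refine ⟨⟨hp1.le, ?_⟩, hp.2.1.le, hp.2.2.le⟩
      have := hR ((hmemW p hp).2 hpW)
      rw [hsymm, mem_closedBall_zero_iff, norm_mul, Complex.norm_exp_ofReal_mul_I, mul_one,
        Complex.norm_real, Real.norm_eq_abs, abs_of_pos hp1] at this
      exact this
    rw [MeasureTheory.IntegrableOn, MeasureTheory.integrable_indicator_iff hWm.measurableSet,
      MeasureTheory.IntegrableOn, MeasureTheory.Measure.restrict_restrict hWm.measurableSet]
    exact (hFc.continuousOn.integrableOn_compact (isCompact_Icc.prod isCompact_Icc)).mono_set hsub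
  rw [hstep]
  have hsw := MeasureTheory.setIntegral_prod_swap (μ := MeasureTheory.volume)
    (ν := MeasureTheory.volume) (Ioi (0 : ℝ)) (Ioo (-Real.pi) Real.pi) (W.indicator F)
  rw [MeasureTheory.Measure.volume_eq_prod, ← hsw, MeasureTheory.setIntegral_prod,
    intervalIntegral.integral_of_le (by linarith [Real.pi_pos]),
    MeasureTheory.integral_Ioc_eq_integral_Ioo]
  · apply MeasureTheory.setIntegral_congr_fun measurableSet_Ioo
    intro t _
    simp only [Prod.swap_prod_mk]
    have h1 : ∀ ρ : ℝ, W.indicator F (ρ, t) =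
        (Iic (1 / g t)).indicator (fun ρ : ℝ => (ρ : ℂ) * Complex.exp (m * t * Complex.I)) ρ := by
      intro ρ
      by_cases h : (ρ, t) ∈ W
      · have : ρ ∈ Iic (1 / g t) := by
          rw [mem_Iic, le_div_iff₀ (hgpos t)]; exact h
        rw [indicator_of_mem h, indicator_of_mem this]
      · have : ρ ∉ Iic (1 / g t) := by
          rw [mem_Iic, le_div_iff₀ (hgpos t)]; exact h
        rw [indicator_of_notMem h, indicator_of_notMem this]
    simp only [h1]
    rw [MeasureTheory.setIntegral_indicator measurableSet_Iic, Ioi_inter_Iic,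
      ← intervalIntegral.integral_of_le (by have := hgpos t; positivity),
      intervalIntegral.integral_mul_const, intervalIntegral.integral_ofReal, integral_id]
    congr 2
    have := (hgpos t).ne'
    simp only [hg] at this ⊢
    field_simp
    ring
  · have := hInt.swap
    simpa [Function.comp_def] using this

theorem near_circle_of_angular_small {A : Set ℂ} {r R κ : ℝ} (hr : 0 < r) (hA : IsCompact A)
    (hconv : Convex ℝ A) (hrA : closedBall 0 r ⊆ A) (hR : A ⊆ closedBall 0 R)
    (hκ : 0 < κ) (hκ1 : κ ≤ 1)
    (hF : ∀ m : ℕ, 1 ≤ m → ‖∫ z in A, (z / ‖z‖) ^ m‖ ≤ κ) :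
    ∃ P : ℝ, r ^ 2 ≤ P ∧ (∀ z ∈ A, ‖z‖ ^ 2 ≤ P) ∧
      ∀ z : ℂ, ‖z‖ ^ 2 ≤ P - 4 * ((5 * (R ^ 3 / r) + 1) * Real.sqrt κ) → z ∈ A := by
  have h0 : A ∈ nhds 0 := Filter.mem_of_superset (closedBall_mem_nhds 0 hr) hrA
  have habs : Absorbent ℝ A := absorbent_nhds_zero h0
  have hgc : Continuous (gauge A) := continuous_gauge hconv h0
  have hmem : ∀ z, z ∈ A ↔ gauge A z ≤ 1 := fun z => by
    rw [gauge_le_one_iff_mem_closure hconv h0, hA.isClosed.closure_eq]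
  have hrR : r ≤ R := by
    have : (r : ℂ) ∈ closedBall (0 : ℂ) R := hR (hrA (by simp [abs_of_pos hr]))
    simpa [abs_of_pos hr] using this
  have hR0 : 0 < R := by linarith
  set g : ℝ → ℝ := fun t => gauge A (Complex.exp (t * Complex.I)) with hg
  have hgcont : Continuous g := by fun_prop
  have hg1 : ∀ t, 1 / R ≤ g t := fun t => by
    have := le_gauge_of_subset_closedBall habs hR0.le hR (x := Complex.exp (t * Complex.I))
    rwa [Complex.norm_exp_ofReal_mul_I] at this
  have hg2 : ∀ t, r * g t ≤ 1 := fun t => by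
    have := mul_gauge_le_norm (ball_subset_closedBall.trans hrA) (x := Complex.exp (t * Complex.I))
    rwa [Complex.norm_exp_ofReal_mul_I] at this
  have hgp : ∀ t, 0 < g t := fun t => lt_of_lt_of_le (by positivity) (hg1 t)
  have hglip : ∀ s t, r * |g s - g t| ≤ |s - t| := by
    intro s t
    have h1 : ∀ x y : ℂ, r * (gauge A x - gauge A y) ≤ ‖x - y‖ := by
      intro x y
      have h2 := gauge_add_le hconv habs y (x - y)
      have h3 := mul_gauge_le_norm (ball_subset_closedBall.trans hrA) (x := x - y)
      rw [add_sub_cancel] at h2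
      nlinarith
    have h4 : ‖Complex.exp (s * Complex.I) - Complex.exp (t * Complex.I)‖ ≤ |s - t| := by
      have := Real.norm_exp_I_mul_ofReal_sub_one_le (x := s - t)
      calc _ = ‖Complex.exp (t * Complex.I) * (Complex.exp (Complex.I * ((s - t : ℝ) : ℂ)) - 1)‖ := by
            rw [mul_sub, ← Complex.exp_add, mul_one]; congr 3; push_cast; ring
        _ ≤ _ := by rw [norm_mul, Complex.norm_exp_ofReal_mul_I, one_mul]; exact this
    have h5 := h1 (Complex.exp (s * Complex.I)) (Complex.exp (t * Complex.I))
    have h6 := h1 (Complex.exp (t * Complex.I)) (Complex.exp (s * Complex.I))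
    rw [norm_sub_rev] at h6
    rcases abs_cases (g s - g t) with h | h
    · rw [h.1]; exact h5.trans h4
    · rw [h.1, neg_sub]; exact h6.trans h4
  have hL : 0 ≤ R ^ 3 / r := by positivity
  obtain ⟨h0, hh0⟩ := exists_near_const_of_fourier_small (h := fun t => 1 / (2 * g t ^ 2))
    (L := R ^ 3 / r) hκ hκ1 hL
    (by
      apply continuous_const.div (by fun_prop)
      intro t; have := hgp t; positivity)
    (by
      intro t
      have : g (t + 2 * Real.pi) = g t := by
        simp only [hg]; congr 1
        rw [show ((t + 2 * Real.pi : ℝ) : ℂ) * Complex.I = t * Complex.I + 2 * Real.pi * Complex.I by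
          push_cast; ring]
        exact Complex.exp_periodic _
      simp only [this])
    (by
      intro s t
      have hs := hgp s
      have ht := hgp t
      have key : 1 / (2 * g s ^ 2) - 1 / (2 * g t ^ 2) =
          (g t - g s) * ((1 / g s) * (1 / g t) * (1 / g s + 1 / g t) / 2) := by
        field_simp; ring
      have hs' : 1 / g s ≤ R := by
        rw [div_le_iff₀ hs]; have := hg1 s; rw [div_le_iff₀ hR0] at this; linarith
      have ht' : 1 / g t ≤ R := by
        rw [div_le_iff₀ ht]; have := hg1 t; rw [div_le_iff₀ hR0] at this; linarith
      have hs0 : 0 < 1 / g s := by positivity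
      have ht0 : 0 < 1 / g t := by positivity
      have hb : (1 / g s) * (1 / g t) * (1 / g s + 1 / g t) / 2 ≤ R ^ 3 := by
        have h1 : (1 / g s) * (1 / g t) ≤ R * R := by gcongr
        have h2 : (1 / g s + 1 / g t) / 2 ≤ R := by linarith
        calc _ = ((1 / g s) * (1 / g t)) * ((1 / g s + 1 / g t) / 2) := by ring
          _ ≤ (R * R) * R := by gcongr
          _ = R ^ 3 := by ring
      rw [key, abs_mul, abs_of_pos (a := _ / 2) (by positivity), abs_sub_comm]
      have := hglip s t
      calc |g s - g t| * _ ≤ |g s - g t| * R ^ 3 := by gcongr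
        _ = (r * |g s - g t|) * (R ^ 3 / r) := by field_simp
        _ ≤ |s - t| * (R ^ 3 / r) := by gcongr
        _ = _ := by ring)
    (by
      intro m hm
      have := hF m hm
      rwa [integral_angular_eq hA hconv h0 m] at this)
  set η := (5 * (R ^ 3 / r) + 1) * Real.sqrt κ with hη
  have hpol : ∀ z : ℂ, gauge A z = ‖z‖ * g (Complex.arg z) := by
    intro z
    conv_lhs => rw [← Complex.norm_mul_exp_arg_mul_I z]
    have := gauge_smul_of_nonneg (s := A) (norm_nonneg z) (Complex.exp (z.arg * Complex.I))
    rw [Complex.real_smul] at this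
    rw [this, smul_eq_mul]
  have hb : ∀ t, |1 / g t ^ 2 - 2 * h0| ≤ 2 * η := by
    intro t
    have := hh0 t
    have h2 : 1 / g t ^ 2 - 2 * h0 = 2 * (1 / (2 * g t ^ 2) - h0) := by
      have := (hgp t).ne'; field_simp
    rw [h2, abs_mul, abs_two]; linarith
  refine ⟨2 * h0 + 2 * η, ?_, ?_, ?_⟩
  · have h1 := (abs_le.1 (hb 0)).2
    have h2 := hg2 0
    have h3 : r ^ 2 ≤ 1 / g 0 ^ 2 := by
      rw [le_div_iff₀ (pow_pos (hgp 0) 2), ← mul_pow]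
      exact pow_le_one₀ (by have := hgp 0; positivity) h2
    linarith
  · intro z hz
    rw [hmem, hpol] at hz
    have h1 := (abs_le.1 (hb z.arg)).2
    have h3 : ‖z‖ ^ 2 ≤ 1 / g z.arg ^ 2 := by
      rw [le_div_iff₀ (pow_pos (hgp _) 2), ← mul_pow]
      exact pow_le_one₀ (by have := hgp z.arg; positivity) hz
    linarith
  · intro z hz
    have h1 := (abs_le.1 (hb z.arg)).1
    have h3 : ‖z‖ ^ 2 ≤ 1 / g z.arg ^ 2 := by linarith
    rw [le_div_iff₀ (pow_pos (hgp _) 2), ← mul_pow] at h3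
    rw [hmem, hpol]
    have := hgp z.arg
    exact (pow_le_one_iff_of_nonneg (by positivity) two_ne_zero).1 h3

/-- The real affine map `w ↦ α w + β w̄ + γ` of the complex plane. -/
noncomputable def affC (α β γ : ℂ) : ℂ → ℂ := fun w => α * w + β * (starRingEnd ℂ) w + γ

lemma exists_affC (T : ℂ →ᵃ[ℝ] ℂ) : ∃ α β γ : ℂ, ∀ w, T w = affC α β γ w := by
  refine ⟨(T.linear 1 - Complex.I * T.linear Complex.I) / 2,
    (T.linear 1 + Complex.I * T.linear Complex.I) / 2, T 0, fun w => ?_⟩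
  have h1 : T w = T.linear w + T 0 := by
    have := T.map_vadd 0 w
    simpa using this
  have h2 : T.linear w = w.re * T.linear 1 + w.im * T.linear Complex.I := by
    conv_lhs => rw [← Complex.re_add_im w]
    rw [map_add, show ((w.re : ℂ)) = w.re • (1 : ℂ) by simp,
      show ((w.im : ℂ)) * Complex.I = w.im • Complex.I by simp, map_smul, map_smul]
    simp
  rw [h1, h2, affC]
  have h3 : (starRingEnd ℂ) w = w.re - w.im * Complex.I := by
    apply Complex.ext <;> simp
  rw [h3]
  conv_rhs => rw [← Complex.re_add_im w]
  simp only [Complex.add_re, Complex.add_im, Complex.mul_re, Complex.mul_im, Complex.ofReal_re,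
    Complex.ofReal_im, Complex.I_re, Complex.I_im, mul_zero, mul_one, add_zero, zero_add,
    sub_self]
  linear_combination ((w.im : ℂ) * T.linear Complex.I) * Complex.I_sq

/-- The linear part of `affC`. -/
noncomputable def linC (α β : ℂ) : ℂ →ₗ[ℝ] ℂ where
  toFun w := α * w + β * (starRingEnd ℂ) w
  map_add' x y := by simp only [map_add]; ring
  map_smul' r x := by
    simp only [Complex.real_smul, map_mul, Complex.conj_ofReal, RingHom.id_apply]; ring

lemma linC_apply (α β w : ℂ) : linC α β w = α * w + β * (starRingEnd ℂ) w := rfl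

lemma det_linC (α β : ℂ) : LinearMap.det (linC α β) = ‖α‖ ^ 2 - ‖β‖ ^ 2 := by
  rw [← LinearMap.det_toMatrix Complex.basisOneI, Matrix.det_fin_two]
  simp only [LinearMap.toMatrix_apply, Complex.coe_basisOneI, Complex.coe_basisOneI_repr,
    linC_apply, Matrix.cons_val_zero, Matrix.cons_val_one, Complex.sq_norm, Complex.normSq_apply]
  simp
  ring

lemma integral_image_affC {α β γ : ℂ} (h : ‖α‖ ≠ ‖β‖) {A : Set ℂ} (hA : MeasurableSet A)
    {E : Type*} [NormedAddCommGroup E] [NormedSpace ℝ E] (f : ℂ → E) :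
    ∫ z in affC α β γ '' A, f z = |‖α‖ ^ 2 - ‖β‖ ^ 2| • ∫ z in A, f (affC α β γ z) := by
  have hdet : LinearMap.det (linC α β) ≠ 0 := by
    rw [det_linC, sub_ne_zero]
    intro h'
    exact h ((sq_eq_sq₀ (norm_nonneg _) (norm_nonneg _)).1 h')
  have hinj : Function.Injective (affC α β γ) := by
    intro x y hxy
    have h1 : linC α β x = linC α β y := by
      simp only [affC] at hxy; rw [linC_apply, linC_apply]; exact add_right_cancel hxy
    exact (LinearMap.equivOfDetNeZero _ hdet).injective h1
  have hder : ∀ x ∈ A, HasFDerivWithinAt (affC α β γ) (LinearMap.toContinuousLinearMap (linC α β)) A x := by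
    intro x _
    have := (LinearMap.toContinuousLinearMap (linC α β)).hasFDerivWithinAt (s := A) (x := x)
    exact this.add_const γ
  rw [MeasureTheory.integral_image_eq_integral_abs_det_fderiv_smul _ hA hder hinj.injOn]
  have : (LinearMap.toContinuousLinearMap (linC α β)).det = ‖α‖ ^ 2 - ‖β‖ ^ 2 := by
    rw [← det_linC]; rfl
  rw [this, MeasureTheory.integral_smul]

/-- The average of `f` over `A`. -/
noncomputable def av {E : Type*} [NormedAddCommGroup E] [NormedSpace ℝ E] (A : Set ℂ) (f : ℂ → E) :
    E := (MeasureTheory.volume.real A)⁻¹ • ∫ z in A, f z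

lemma volume_image_affC {α β γ : ℂ} (h : ‖α‖ ≠ ‖β‖) {A : Set ℂ} (hA : MeasurableSet A) :
    MeasureTheory.volume.real (affC α β γ '' A) =
      |‖α‖ ^ 2 - ‖β‖ ^ 2| * MeasureTheory.volume.real A := by
  have := integral_image_affC (γ := γ) h hA (fun _ => (1 : ℝ))
  simpa using this

lemma av_image_affC {α β γ : ℂ} (h : ‖α‖ ≠ ‖β‖) {A : Set ℂ} (hA : MeasurableSet A)
    {E : Type*} [NormedAddCommGroup E] [NormedSpace ℝ E] (f : ℂ → E) :
    av (affC α β γ '' A) f = av A (fun z => f (affC α β γ z)) := by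
  have h0 : |‖α‖ ^ 2 - ‖β‖ ^ 2| ≠ 0 := by
    rw [abs_ne_zero, sub_ne_zero]
    intro h'
    exact h ((sq_eq_sq₀ (norm_nonneg _) (norm_nonneg _)).1 h')
  rw [av, av, integral_image_affC h hA, volume_image_affC h hA, smul_smul]
  congr 1
  field_simp

/-- Planar convex bodies: compact convex sets with nonempty interior. -/
structure Body (A : Set ℂ) : Prop where
  compact : IsCompact A
  convex : Convex ℝ A
  nonempty : (interior A).Nonempty

lemma Body.volume_pos {A : Set ℂ} (hA : Body A) : 0 < MeasureTheory.volume.real A := by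
  rw [MeasureTheory.measureReal_def, ENNReal.toReal_pos_iff]
  exact ⟨MeasureTheory.Measure.measure_pos_of_nonempty_interior _ hA.nonempty, hA.compact.measure_lt_top⟩

lemma Body.integrableOn {A : Set ℂ} (hA : Body A) {E : Type*} [NormedAddCommGroup E]
    {f : ℂ → E} (hf : Continuous f) : MeasureTheory.IntegrableOn f A :=
  hf.continuousOn.integrableOn_compact hA.compact

lemma Body.av_const {A : Set ℂ} (hA : Body A) {E : Type*} [NormedAddCommGroup E] [NormedSpace ℝ E] [CompleteSpace E] (c : E) :
    av A (fun _ => c) = c := by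
  rw [av, MeasureTheory.setIntegral_const, smul_smul, inv_mul_cancel₀ hA.volume_pos.ne', one_smul]

lemma Body.av_add {A : Set ℂ} (hA : Body A) {E : Type*} [NormedAddCommGroup E] [NormedSpace ℝ E]
    {f g : ℂ → E} (hf : Continuous f) (hg : Continuous g) :
    av A (fun z => f z + g z) = av A f + av A g := by
  rw [av, MeasureTheory.integral_add (hA.integrableOn hf) (hA.integrableOn hg), smul_add, av, av]

lemma Body.av_sub {A : Set ℂ} (hA : Body A) {E : Type*} [NormedAddCommGroup E] [NormedSpace ℝ E]
    {f g : ℂ → E} (hf : Continuous f) (hg : Continuous g) :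
    av A (fun z => f z - g z) = av A f - av A g := by
  rw [av, MeasureTheory.integral_sub (hA.integrableOn hf) (hA.integrableOn hg), smul_sub, av, av]

lemma Body.av_mono {A : Set ℂ} (hA : Body A) {f g : ℂ → ℝ} (hf : Continuous f) (hg : Continuous g)
    (h : ∀ z ∈ A, f z ≤ g z) : av A f ≤ av A g := by
  rw [av, av]
  apply smul_le_smul_of_nonneg_left _ (inv_nonneg.2 hA.volume_pos.le)
  exact MeasureTheory.setIntegral_mono_on (hA.integrableOn hf) (hA.integrableOn hg)
    hA.compact.measurableSet h

lemma av_mul_left {𝕜 : Type*} [RCLike 𝕜] (A : Set ℂ) (c : 𝕜) (f : ℂ → 𝕜) :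
    av A (fun z => c * f z) = c * av A f := by
  rw [av, av, MeasureTheory.integral_const_mul, mul_smul_comm]

lemma av_re {A : Set ℂ} (hA : Body A) {f : ℂ → ℂ} (hf : Continuous f) :
    av A (fun z => (f z).re) = (av A f).re := by
  rw [av, av, Complex.smul_re]
  congr 1
  exact integral_re (hA.integrableOn hf)

lemma av_ofReal (A : Set ℂ) (f : ℂ → ℝ) : av A (fun z => (f z : ℂ)) = ((av A f : ℝ) : ℂ) := by
  have h : ∫ z in A, (f z : ℂ) = ((∫ z in A, f z : ℝ) : ℂ) := integral_ofReal
  rw [av, av, h, Complex.real_smul]; simp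

lemma av_conj (A : Set ℂ) (f : ℂ → ℂ) :
    av A (fun z => (starRingEnd ℂ) (f z)) = (starRingEnd ℂ) (av A f) := by
  rw [av, av, integral_conj, Complex.real_smul, Complex.real_smul, map_mul, Complex.conj_ofReal]

/-- The centroid of a planar body. -/
noncomputable def centroid (A : Set ℂ) : ℂ := av A (fun z => z)

/-- The centred complex second moment. -/
noncomputable def pMoment (A : Set ℂ) : ℂ := av A (fun z => (z - centroid A) ^ 2)

/-- The centred absolute second moment. -/
noncomputable def mMoment (A : Set ℂ) : ℝ := av A (fun z => ‖z - centroid A‖ ^ 2)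

/-- The coefficient of the conjugate-linear part of the isotropic normalization. -/
noncomputable def isoCoef (A : Set ℂ) : ℂ :=
  ((1 / (mMoment A + Real.sqrt (mMoment A ^ 2 - ‖pMoment A‖ ^ 2)) : ℝ) : ℂ) * pMoment A

/-- The isotropic normalization map. -/
noncomputable def isoMap (A : Set ℂ) : ℂ → ℂ :=
  affC 1 (-isoCoef A) (-centroid A + isoCoef A * (starRingEnd ℂ) (centroid A))

/-- A set is isotropic if its centroid vanishes and its inertia form is a multiple of the
Euclidean one. -/
def Isotropic (A : Set ℂ) : Prop := av A (fun z => z) = 0 ∧ av A (fun z => z ^ 2) = 0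

lemma isoMap_apply (A : Set ℂ) (z : ℂ) :
    isoMap A z = (z - centroid A) - isoCoef A * (starRingEnd ℂ) (z - centroid A) := by
  rw [isoMap, affC, map_sub]; ring

lemma Body.av_centered {A : Set ℂ} (hA : Body A) : av A (fun z => z - centroid A) = 0 := by
  rw [hA.av_sub continuous_id' continuous_const, hA.av_const]
  simp [centroid]

lemma re_mul_sq {u x : ℂ} (hu : ‖u‖ = 1) : (u * x).re ^ 2 = (‖x‖ ^ 2 + (u ^ 2 * x ^ 2).re) / 2 := by
  have h : u.re ^ 2 + u.im ^ 2 = 1 := by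
    have := Complex.sq_norm u; rw [hu, Complex.normSq_apply] at this; nlinarith
  rw [Complex.sq_norm, Complex.normSq_apply]
  simp only [pow_two, Complex.mul_re, Complex.mul_im]
  linear_combination ((x.re ^ 2 + x.im ^ 2) / 2) * h

lemma Body.av_re_sq {A : Set ℂ} (hA : Body A) {u : ℂ} (hu : ‖u‖ = 1) :
    av A (fun z => (u * (z - centroid A)).re ^ 2) =
      (mMoment A + (u ^ 2 * pMoment A).re) / 2 := by
  have h1 : (fun z => (u * (z - centroid A)).re ^ 2) = fun z =>
      (1 / 2 : ℝ) * (‖z - centroid A‖ ^ 2 + (u ^ 2 * (z - centroid A) ^ 2).re) := by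
    ext z; rw [re_mul_sq hu]; ring
  rw [h1, av_mul_left, hA.av_add (by fun_prop) (by fun_prop), av_re hA (by fun_prop), av_mul_left,
    mMoment, pMoment]
  ring

lemma exists_unit_rotation (p : ℂ) : ∃ u : ℂ, ‖u‖ = 1 ∧ (u ^ 2 * p).re = -‖p‖ := by
  refine ⟨Complex.I * Complex.exp (((-(p.arg / 2) : ℝ) : ℂ) * Complex.I), ?_, ?_⟩
  · rw [norm_mul, Complex.norm_exp_ofReal_mul_I, Complex.norm_I, one_mul]
  · have : (Complex.I * Complex.exp (((-(p.arg / 2) : ℝ) : ℂ) * Complex.I)) ^ 2 * p =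
        ((-‖p‖ : ℝ) : ℂ) := by
      conv_lhs => rw [← Complex.norm_mul_exp_arg_mul_I p]
      rw [mul_pow, Complex.I_sq, ← Complex.exp_nat_mul]
      have : Complex.exp (((2 : ℕ) : ℂ) * (((-((↑‖p‖ * Complex.exp (↑p.arg * Complex.I)).arg / 2) : ℝ) : ℂ) * Complex.I)) *
        Complex.exp (p.arg * Complex.I) = 1 := by
        rw [Complex.norm_mul_exp_arg_mul_I, ← Complex.exp_add, ← Complex.exp_zero]
        congr 1; push_cast; ring
      push_cast
      push_cast at this
      linear_combination (-(‖p‖ : ℂ)) * this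
    rw [this, Complex.ofReal_re]

lemma Body.spread {A : Set ℂ} (hA : Body A) {c : ℂ} {ρ : ℝ} (hρ : 0 < ρ)
    (hc : closedBall c ρ ⊆ A) {u : ℂ} (hu : ‖u‖ = 1) :
    Real.pi * ρ ^ 4 / 256 / MeasureTheory.volume.real A ≤
      av A (fun z => (u * (z - centroid A)).re ^ 2) := by
  have hV := hA.volume_pos
  -- one of two points has large coordinate
  obtain ⟨d, hd1, hd2⟩ : ∃ d : ℂ, ‖d - c‖ ≤ ρ / 2 ∧ ρ / 2 ≤ |(u * (d - centroid A)).re| := by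
    set x := (u * (c - centroid A)).re with hx
    have huu : u * (starRingEnd ℂ) u = 1 := by
      rw [Complex.mul_conj, Complex.normSq_eq_norm_sq, hu]; simp
    have hn : ‖((ρ / 2 : ℝ) : ℂ) * (starRingEnd ℂ) u‖ = ρ / 2 := by
      rw [norm_mul, RCLike.norm_conj, hu, Complex.norm_real, Real.norm_eq_abs, mul_one,
        abs_of_pos (by positivity)]
    rcases le_total 0 x with h | h
    · refine ⟨c + ((ρ / 2 : ℝ) : ℂ) * (starRingEnd ℂ) u, by rw [add_sub_cancel_left, hn], ?_⟩
      have : u * (c + ((ρ / 2 : ℝ) : ℂ) * (starRingEnd ℂ) u - centroid A) =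
          u * (c - centroid A) + ((ρ / 2 : ℝ) : ℂ) := by linear_combination ((ρ / 2 : ℝ) : ℂ) * huu
      rw [this, Complex.add_re, Complex.ofReal_re, ← hx, abs_of_nonneg (by positivity)]
      linarith
    · refine ⟨c - ((ρ / 2 : ℝ) : ℂ) * (starRingEnd ℂ) u, by rw [sub_sub_cancel_left, norm_neg, hn], ?_⟩
      have : u * (c - ((ρ / 2 : ℝ) : ℂ) * (starRingEnd ℂ) u - centroid A) =
          u * (c - centroid A) - ((ρ / 2 : ℝ) : ℂ) := by linear_combination -((ρ / 2 : ℝ) : ℂ) * huu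
      rw [this, Complex.sub_re, Complex.ofReal_re, ← hx, abs_of_nonpos (by linarith)]
      linarith
  have hsub : ball d (ρ / 4) ⊆ A := by
    intro z hz
    apply hc
    rw [mem_closedBall, dist_eq_norm]
    rw [mem_ball, dist_eq_norm] at hz
    calc ‖z - c‖ = ‖(z - d) + (d - c)‖ := by congr 1; ring
      _ ≤ ‖z - d‖ + ‖d - c‖ := norm_add_le _ _
      _ ≤ ρ := by linarith
  have hlow : ∀ z ∈ ball d (ρ / 4), ρ ^ 2 / 16 ≤ (u * (z - centroid A)).re ^ 2 := by
    intro z hz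
    rw [mem_ball, dist_eq_norm] at hz
    have h1 : (u * (d - centroid A)).re = (u * (z - centroid A)).re - (u * (z - d)).re := by
      rw [← Complex.sub_re]; congr 1; ring
    have h2 : |(u * (z - d)).re| ≤ ρ / 4 := by
      refine (Complex.abs_re_le_norm _).trans ?_
      rw [norm_mul, hu, one_mul]; exact hz.le
    have h3 : ρ / 4 ≤ |(u * (z - centroid A)).re| := by
      rw [h1] at hd2
      have := abs_sub (u * (z - centroid A)).re (u * (z - d)).re
      linarith
    calc ρ ^ 2 / 16 = (ρ / 4) ^ 2 := by ring
      _ ≤ |(u * (z - centroid A)).re| ^ 2 := by gcongr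
      _ = _ := sq_abs _
  have hf : Continuous fun z : ℂ => (u * (z - centroid A)).re ^ 2 := by fun_prop
  rw [av, smul_eq_mul, div_eq_inv_mul]
  apply mul_le_mul_of_nonneg_left _ (inv_nonneg.2 hV.le)
  calc Real.pi * ρ ^ 4 / 256 = ∫ z in ball d (ρ / 4), ρ ^ 2 / 16 := by
        rw [MeasureTheory.setIntegral_const, MeasureTheory.measureReal_def, Complex.volume_ball]
        simp only [ENNReal.toReal_mul, ENNReal.toReal_pow, ENNReal.coe_toReal,
          ENNReal.toReal_ofReal (show 0 ≤ ρ / 4 by positivity), smul_eq_mul, NNReal.coe_real_pi]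
        ring
    _ ≤ ∫ z in ball d (ρ / 4), (u * (z - centroid A)).re ^ 2 := by
        apply MeasureTheory.setIntegral_mono_on _ ((hA.integrableOn hf).mono_set hsub)
          measurableSet_ball hlow
        exact MeasureTheory.integrableOn_const (by exact MeasureTheory.measure_ball_lt_top.ne)
    _ ≤ _ := by
        apply MeasureTheory.setIntegral_mono_set (hA.integrableOn hf)
        · exact Filter.Eventually.of_forall fun z => sq_nonneg _
        · exact Filter.Eventually.of_forall hsub

lemma Body.pMoment_le {A : Set ℂ} (hA : Body A) {s : ℝ}
    (h : ∀ u : ℂ, ‖u‖ = 1 → s ≤ av A (fun z => (u * (z - centroid A)).re ^ 2)) :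
    ‖pMoment A‖ ≤ mMoment A - 2 * s := by
  obtain ⟨u, hu, hup⟩ := exists_unit_rotation (pMoment A)
  have := h u hu
  rw [hA.av_re_sq hu, hup] at this
  linarith

lemma Body.pMoment_lt {A : Set ℂ} (hA : Body A) : ‖pMoment A‖ < mMoment A := by
  obtain ⟨c, hc⟩ := hA.nonempty
  obtain ⟨ρ, hρ, hsub⟩ := nhds_basis_closedBall.mem_iff.1 (mem_interior_iff_mem_nhds.1 hc)
  have := hA.pMoment_le fun u hu => hA.spread hρ hsub hu
  have hV := hA.volume_pos
  have : 0 < Real.pi * ρ ^ 4 / 256 / MeasureTheory.volume.real A := by positivity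
  linarith

lemma Body.mMoment_pos {A : Set ℂ} (hA : Body A) : 0 < mMoment A :=
  (norm_nonneg _).trans_lt hA.pMoment_lt

lemma Body.norm_isoCoef_le {A : Set ℂ} (hA : Body A) :
    ‖isoCoef A‖ ≤ ‖pMoment A‖ / mMoment A := by
  have h := hA.mMoment_pos
  have hs := Real.sqrt_nonneg (mMoment A ^ 2 - ‖pMoment A‖ ^ 2)
  rw [isoCoef, norm_mul, Complex.norm_real, Real.norm_eq_abs, abs_of_nonneg (by positivity),
    one_div_mul_eq_div]
  exact div_le_div_of_nonneg_left (norm_nonneg _) h (by linarith)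

lemma Body.norm_isoCoef_lt {A : Set ℂ} (hA : Body A) : ‖isoCoef A‖ < 1 := by
  refine hA.norm_isoCoef_le.trans_lt ?_
  rw [div_lt_one hA.mMoment_pos]
  exact hA.pMoment_lt

lemma Body.norm_ne {A : Set ℂ} (hA : Body A) : ‖(1 : ℂ)‖ ≠ ‖-isoCoef A‖ := by
  rw [norm_one, norm_neg]; exact hA.norm_isoCoef_lt.ne'

lemma continuous_affC (α β γ : ℂ) : Continuous (affC α β γ) := by
  unfold affC; fun_prop

lemma Body.isotropic_isoMap {A : Set ℂ} (hA : Body A) : Isotropic (isoMap A '' A) := by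
  have hm := hA.mMoment_pos
  have hp := hA.pMoment_lt
  constructor
  · rw [isoMap, av_image_affC hA.norm_ne hA.compact.measurableSet]
    change av A (fun z => isoMap A z) = 0
    simp only [isoMap_apply]
    rw [hA.av_sub (by fun_prop) (by fun_prop), av_mul_left, av_conj, hA.av_centered]
    simp
  · rw [isoMap, av_image_affC hA.norm_ne hA.compact.measurableSet]
    change av A (fun z => isoMap A z ^ 2) = 0
    have h1 : (fun z => isoMap A z ^ 2) = fun z => (z - centroid A) ^ 2 +
        ((-2 * isoCoef A) * ((‖z - centroid A‖ ^ 2 : ℝ) : ℂ) +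
          isoCoef A ^ 2 * (starRingEnd ℂ) ((z - centroid A) ^ 2)) := by
      ext z
      rw [isoMap_apply]
      have := Complex.mul_conj' (z - centroid A)
      rw [map_pow]
      push_cast
      linear_combination (-2 * isoCoef A) * this
    rw [h1, hA.av_add (by fun_prop) (by fun_prop), hA.av_add (by fun_prop) (by fun_prop),
      av_mul_left, av_mul_left, av_conj, av_ofReal]
    change pMoment A + (-2 * isoCoef A * (mMoment A : ℂ) + isoCoef A ^ 2 *
      (starRingEnd ℂ) (pMoment A)) = 0
    set s := Real.sqrt (mMoment A ^ 2 - ‖pMoment A‖ ^ 2) with hs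
    have hss : s ^ 2 = mMoment A ^ 2 - ‖pMoment A‖ ^ 2 := by
      apply Real.sq_sqrt
      have := norm_nonneg (pMoment A)
      nlinarith
    have hs0 : 0 ≤ s := Real.sqrt_nonneg _
    have hpc := Complex.mul_conj' (pMoment A)
    have hq : 1 - 2 * (1 / (mMoment A + s)) * mMoment A + (1 / (mMoment A + s)) ^ 2 *
        ‖pMoment A‖ ^ 2 = 0 := by
      have : mMoment A + s ≠ 0 := by positivity
      field_simp
      linear_combination hss
    have hq' : ((1 - 2 * (1 / (mMoment A + s)) * mMoment A + (1 / (mMoment A + s)) ^ 2 *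
        ‖pMoment A‖ ^ 2 : ℝ) : ℂ) = 0 := by rw [hq]; simp
    rw [isoCoef, ← hs]
    set τ := 1 / (mMoment A + s)
    push_cast at hq'
    linear_combination (pMoment A) * hq' + (τ : ℂ) ^ 2 * pMoment A * hpc

lemma Body.image_affC {A : Set ℂ} (hA : Body A) {α β γ : ℂ} (h : ‖α‖ ≠ ‖β‖) :
    Body (affC α β γ '' A) := by
  have hdet : LinearMap.det (linC α β) ≠ 0 := by
    rw [det_linC, sub_ne_zero]
    intro h'
    exact h ((sq_eq_sq₀ (norm_nonneg _) (norm_nonneg _)).1 h')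
  have himg : affC α β γ '' A = (fun w => w + γ) '' (linC α β '' A) := by
    rw [image_image]; rfl
  refine ⟨hA.compact.image (continuous_affC _ _ _), ?_, ?_⟩
  · rw [himg, image_add_right]
    exact (hA.convex.linear_image (linC α β)).translate_preimage_left _
  · obtain ⟨c, hc⟩ := hA.nonempty
    let e := (LinearMap.equivOfDetNeZero _ hdet).toContinuousLinearEquiv.toHomeomorph.trans
      (Homeomorph.addRight γ)
    have he : ∀ w, e w = affC α β γ w := fun w => rfl
    refine ⟨e c, ?_⟩
    have := e.image_interior A
    have h2 : affC α β γ '' A = e '' A := by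
      apply image_congr; intro w _; exact (he w).symm
    rw [h2, ← this]
    exact mem_image_of_mem _ hc

lemma norm_integral_sub_le {A U : Set ℂ} (hA : MeasurableSet A) (hU : IsCompact U) (hAU : A ⊆ U)
    {f : ℂ → ℂ} (hf : MeasureTheory.IntegrableOn f U) {M : ℝ} (hM : ∀ z ∈ U, ‖f z‖ ≤ M) :
    ‖(∫ z in U, f z) - ∫ z in A, f z‖ ≤
      M * (MeasureTheory.volume.real U - MeasureTheory.volume.real A) := by
  rw [← MeasureTheory.setIntegral_sdiff hA hf hAU, ← MeasureTheory.measureReal_sdiff hAU hA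
    hU.measure_lt_top.ne]
  apply MeasureTheory.norm_setIntegral_le_of_norm_le_const
  · exact (MeasureTheory.measure_mono sdiff_subset).trans_lt hU.measure_lt_top
  · exact fun z hz => hM z hz.1

lemma smul_add_singleton_eq (A : Set ℂ) (l : ℝ) (z : ℂ) : l • A + {z} = affC l 0 z '' A := by
  ext w
  simp only [add_singleton, image_add_right, mem_preimage, mem_smul_set, mem_image, affC]
  constructor
  · rintro ⟨a, ha, h⟩
    refine ⟨a, ha, ?_⟩
    rw [Complex.real_smul] at h
    rw [h]; ring
  · rintro ⟨a, ha, h⟩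
    refine ⟨a, ha, ?_⟩
    rw [Complex.real_smul, ← h]; ring

lemma norm_translation_le {A : Set ℂ} {R δ : ℝ} {z : ℂ} (hA : Body A) (hR : A ⊆ closedBall 0 R)
    (hδ : 0 ≤ δ) (h : A ⊆ (1 + δ) • A + {z}) : ‖z‖ ≤ δ * R := by
  obtain ⟨c, hc⟩ := hA.nonempty
  obtain ⟨a, ha, hmin⟩ := hA.compact.exists_isMinOn ⟨c, interior_subset hc⟩
    (f := fun w : ℂ => ((starRingEnd ℂ) z * w).re) (by fun_prop)
  have h1 := h ha
  rw [smul_add_singleton_eq] at h1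
  obtain ⟨b, hb, hab⟩ := h1
  have h2 : ((starRingEnd ℂ) z * a).re ≤ ((starRingEnd ℂ) z * b).re := hmin hb
  have h3 : ((starRingEnd ℂ) z * a).re = (1 + δ) * ((starRingEnd ℂ) z * b).re + ‖z‖ ^ 2 := by
    rw [← hab, affC, Complex.sq_norm, Complex.normSq_apply]
    simp; ring
  have h4 : |((starRingEnd ℂ) z * a).re| ≤ ‖z‖ * R := by
    refine (Complex.abs_re_le_norm _).trans ?_
    rw [norm_mul, RCLike.norm_conj]
    have := hR ha
    rw [mem_closedBall_zero_iff] at this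
    exact mul_le_mul_of_nonneg_left this (norm_nonneg _)
  have h5 : ‖z‖ ^ 2 ≤ δ * (‖z‖ * R) := by
    have := (abs_le.1 h4).1
    nlinarith
  rcases (norm_nonneg z).eq_or_lt with h0 | h0
  · have hR0 : 0 ≤ R := by
      have := hR ha
      rw [mem_closedBall_zero_iff] at this
      exact (norm_nonneg _).trans this
    rw [← h0]; positivity
  · nlinarith

lemma Body.av_affC {N : Set ℂ} (hN : Body N) (hi : Isotropic N) (α β γ : ℂ) :
    av N (affC α β γ) = γ := by
  have : affC α β γ = fun w => α * w + (β * (starRingEnd ℂ) w + γ) := by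
    ext w; rw [affC]; ring
  rw [this, hN.av_add (by fun_prop) (by fun_prop), hN.av_add (by fun_prop) (by fun_prop),
    av_mul_left, av_mul_left, av_conj, hN.av_const, hi.1]
  simp

lemma Body.av_affC_sq {N : Set ℂ} (hN : Body N) (hi : Isotropic N) (α β γ : ℂ) :
    av N (fun w => affC α β γ w ^ 2) =
      2 * α * β * ((av N fun w => ‖w‖ ^ 2 : ℝ) : ℂ) + γ ^ 2 := by
  have : (fun w => affC α β γ w ^ 2) = fun w => α ^ 2 * w ^ 2 + (β ^ 2 * (starRingEnd ℂ) (w ^ 2) +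
      (2 * α * β * ((‖w‖ ^ 2 : ℝ) : ℂ) + (2 * γ) * affC α β (-(γ / 2)) w + 2 * γ ^ 2)) := by
    ext w
    have := Complex.mul_conj' w
    rw [affC, affC, map_pow]; push_cast
    linear_combination (2 * α * β) * this
  have hc := continuous_affC α β (-(γ / 2))
  rw [this, hN.av_add (by fun_prop) (by fun_prop), hN.av_add (by fun_prop) (by fun_prop),
    hN.av_add (by fun_prop) (by fun_prop), hN.av_add (by fun_prop) (by fun_prop), av_mul_left,
    av_mul_left, av_mul_left, av_mul_left, av_conj, hN.av_const, hi.2, hN.av_affC hi, av_ofReal]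
  simp; ring

lemma Body.av_norm_affC_sq {N : Set ℂ} (hN : Body N) (hi : Isotropic N) (α β γ : ℂ) :
    av N (fun w => ‖affC α β γ w‖ ^ 2) =
      (‖α‖ ^ 2 + ‖β‖ ^ 2) * (av N fun w => ‖w‖ ^ 2) + ‖γ‖ ^ 2 := by
  apply Complex.ofReal_injective
  rw [← av_ofReal]
  have : (fun w => ((‖affC α β γ w‖ ^ 2 : ℝ) : ℂ)) = fun w =>
      (α * (starRingEnd ℂ) β) * w ^ 2 + ((β * (starRingEnd ℂ) α) * (starRingEnd ℂ) (w ^ 2) +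
      (((‖α‖ ^ 2 + ‖β‖ ^ 2 : ℝ) : ℂ) * ((‖w‖ ^ 2 : ℝ) : ℂ) +
      (starRingEnd ℂ γ) * affC α β 0 w +
      γ * (starRingEnd ℂ) (affC α β 0 w) + γ * (starRingEnd ℂ) γ)) := by
    ext w
    push_cast
    rw [← Complex.mul_conj', ← Complex.mul_conj', ← Complex.mul_conj', ← Complex.mul_conj', affC, affC]
    simp only [map_add, map_mul, Complex.conj_conj, map_pow, map_zero]
    ring
  have hc := continuous_affC α β 0
  rw [this, hN.av_add (by fun_prop) (by fun_prop), hN.av_add (by fun_prop) (by fun_prop),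
    hN.av_add (by fun_prop) (by fun_prop), hN.av_add (by fun_prop) (by fun_prop),
    hN.av_add (by fun_prop) (by fun_prop), av_mul_left,
    av_mul_left, av_mul_left, av_mul_left, av_mul_left, av_conj, av_conj, hN.av_const, hi.2,
    hN.av_affC hi, av_ofReal]
  rw [Complex.mul_conj']
  simp

/-- The directional function `(z / |z|) ^ m`. -/
noncomputable def dirPow (m : ℕ) (z : ℂ) : ℂ := (z / ‖z‖) ^ m

lemma norm_dirPow_le (m : ℕ) (z : ℂ) : ‖dirPow m z‖ ≤ 1 := by
  rw [dirPow, norm_pow]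
  apply pow_le_one₀ (norm_nonneg _)
  rw [norm_div, Complex.norm_real, norm_norm]
  exact div_self_le_one _

lemma measurable_dirPow (m : ℕ) : Measurable (dirPow m) := by
  unfold dirPow; fun_prop

lemma integrableOn_dirPow (m : ℕ) {A : Set ℂ} (hA : IsCompact A) :
    MeasureTheory.IntegrableOn (dirPow m) A :=
  MeasureTheory.Measure.integrableOn_of_bounded hA.measure_lt_top.ne
    (measurable_dirPow m).aestronglyMeasurable
    (Filter.Eventually.of_forall fun z => norm_dirPow_le m z)

lemma dirPow_mul (m : ℕ) (a z : ℂ) : dirPow m (a * z) = dirPow m a * dirPow m z := by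
  rw [dirPow, dirPow, dirPow, ← mul_pow, norm_mul, Complex.ofReal_mul, mul_div_mul_comm]

/-- Constants for the comparison of directional moments. -/
noncomputable def cmpE (R m0 : ℝ) : ℝ := 10 * R + 20736 * R ^ 3 / m0

lemma abs_norm_sq_ofReal (x : ℝ) : |‖(x : ℂ)‖ ^ 2 - ‖(0 : ℂ)‖ ^ 2| = x ^ 2 := by
  rw [norm_zero, Complex.norm_real, Real.norm_eq_abs, sq_abs, zero_pow two_ne_zero, sub_zero,
    abs_of_nonneg (sq_nonneg x)]

lemma compare_coeff_bounds {A N : Set ℂ} {r R m0 δ : ℝ} {α β γ z : ℂ} (hr : 0 < r)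
    (hm0 : 0 < m0) (hA : Body A) (hAi : Isotropic A)
    (hrA : closedBall 0 r ⊆ A) (hR : A ⊆ closedBall 0 R) (hm : m0 ≤ av A (fun w => ‖w‖ ^ 2))
    (hN : Body N) (hNi : Isotropic N) (hαβ : ‖β‖ < ‖α‖) (h1 : A ⊆ affC α β γ '' N)
    (h2 : affC α β γ '' N ⊆ (1 + δ) • A + {z}) (hδ : 0 ≤ δ) (hδ1 : δ ≤ 1)
    (hδ2 : 1728 * R ^ 2 * δ ≤ m0) :
    MeasureTheory.volume.real A ≤ MeasureTheory.volume.real (affC α β γ '' N) ∧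
      (∀ w ∈ affC α β γ '' N, ‖w‖ ≤ 3 * R) ∧ ‖γ‖ ≤ 9 * R * δ ∧
      ‖β‖ ≤ 864 * R ^ 2 * δ / m0 * ‖α‖ ∧ ‖β‖ ≤ ‖α‖ / 2 := by
  have hV := hA.volume_pos
  set V := MeasureTheory.volume.real A with hVdef
  set A' := affC α β γ '' N with hA'
  have hA'B : Body A' := hN.image_affC hαβ.ne'
  have hzn : ‖z‖ ≤ δ * R := norm_translation_le hA hR hδ (h1.trans h2)
  have hR0 : 0 < R := by
    have : (r : ℂ) ∈ closedBall (0 : ℂ) R := hR (hrA (by simp [abs_of_pos hr]))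
    have : r ≤ R := by simpa [abs_of_pos hr] using this
    linarith
  rw [smul_add_singleton_eq] at h2
  have hne : ‖((1 + δ : ℝ) : ℂ)‖ ≠ ‖(0 : ℂ)‖ := by
    rw [norm_zero, Complex.norm_real, Real.norm_eq_abs, abs_of_pos (by linarith)]; linarith
  have hUB := hA.image_affC (γ := z) hne
  have hUV := volume_image_affC (γ := z) hne hA.compact.measurableSet
  rw [abs_norm_sq_ofReal] at hUV
  set V' := MeasureTheory.volume.real A' with hV'def
  have hV'1 : V ≤ V' := MeasureTheory.measureReal_mono h1 hA'B.compact.measure_lt_top.ne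
  have hV'2 : V' ≤ (1 + δ) ^ 2 * V := by
    rw [← hUV]; exact MeasureTheory.measureReal_mono h2 hUB.compact.measure_lt_top.ne
  have hV'3 : V' - V ≤ 3 * δ * V := by nlinarith
  have hV'0 : 0 < V' := hA'B.volume_pos
  have hbd : ∀ w ∈ A', ‖w‖ ≤ 3 * R := by
    intro w hw
    obtain ⟨a, ha, rfl⟩ := h2 hw
    have ha' := hR ha
    rw [mem_closedBall_zero_iff] at ha'
    rw [affC, zero_mul, add_zero]
    calc _ ≤ ‖((1 + δ : ℝ) : ℂ) * a‖ + ‖z‖ := norm_add_le _ _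
      _ ≤ (1 + δ) * R + δ * R := by
        rw [norm_mul, Complex.norm_real, Real.norm_eq_abs, abs_of_pos (by linarith)]
        gcongr
      _ ≤ 3 * R := by nlinarith
  -- functions with vanishing integral over the first body have small average over the second
  have hav : ∀ f : ℂ → ℂ, Continuous f → av A f = 0 → ∀ M : ℝ, 0 ≤ M → (∀ w ∈ A', ‖f w‖ ≤ M) →
      ‖av A' f‖ ≤ M * (3 * δ) := by
    intro f hf h0 M hM0 hM
    have h3 : ∫ w in A, f w = 0 := by
      rw [av, smul_eq_zero] at h0
      exact h0.resolve_left (inv_ne_zero hV.ne')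
    have h4 := norm_integral_sub_le hA.compact.measurableSet hA'B.compact h1
      (hA'B.integrableOn hf) hM
    rw [h3, sub_zero] at h4
    rw [av, norm_smul, norm_inv, Real.norm_eq_abs, abs_of_pos hV'0, inv_mul_le_iff₀ hV'0]
    calc _ ≤ M * (V' - V) := h4
      _ ≤ M * (3 * δ * V) := mul_le_mul_of_nonneg_left hV'3 hM0
      _ ≤ M * (3 * δ * V') := by gcongr
      _ = _ := by ring
  have hγ : ‖γ‖ ≤ 9 * R * δ := by
    have := hav (fun w => w) continuous_id' hAi.1 (3 * R) (by positivity) hbd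
    rw [hA', av_image_affC hαβ.ne' hN.compact.measurableSet] at this
    have h3 := hN.av_affC hNi α β γ
    rw [show affC α β γ = fun w => affC α β γ w from rfl] at h3
    rw [h3] at this
    linarith
  set M := av N (fun w => ‖w‖ ^ 2) with hM
  have hM0 : 0 ≤ M := by
    have := hN.av_mono (f := fun _ => 0) (g := fun w => ‖w‖ ^ 2) (by fun_prop) (by fun_prop)
      (fun w _ => by positivity)
    rwa [hN.av_const] at this
  have hprod : ‖α‖ * ‖β‖ * M ≤ 54 * R ^ 2 * δ := by
    have h3 := hav (fun w => w ^ 2) (by fun_prop) hAi.2 ((3 * R) ^ 2) (by positivity) (fun w hw => by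
      rw [norm_pow]; exact pow_le_pow_left₀ (norm_nonneg _) (hbd w hw) 2)
    rw [hA', av_image_affC hαβ.ne' hN.compact.measurableSet, hN.av_affC_sq hNi, ← hM] at h3
    have h4 : ‖2 * α * β * (M : ℂ)‖ ≤ (3 * R) ^ 2 * (3 * δ) + (9 * R * δ) ^ 2 := by
      calc _ = ‖(2 * α * β * (M : ℂ) + γ ^ 2) - γ ^ 2‖ := by rw [add_sub_cancel_right]
        _ ≤ ‖2 * α * β * (M : ℂ) + γ ^ 2‖ + ‖γ ^ 2‖ := norm_sub_le _ _
        _ ≤ _ := by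
          rw [norm_pow]
          have := pow_le_pow_left₀ (norm_nonneg _) hγ 2
          linarith
    rw [norm_mul, norm_mul, norm_mul, Complex.norm_real, Real.norm_eq_abs, abs_of_nonneg hM0,
      Complex.norm_ofNat] at h4
    have h5 : δ ^ 2 ≤ δ := by nlinarith
    have h6 : R ^ 2 * δ ^ 2 ≤ R ^ 2 * δ := mul_le_mul_of_nonneg_left h5 (by positivity)
    nlinarith
  have hsum : m0 / 16 ≤ ‖α‖ ^ 2 * M := by
    have h3 : m0 / 4 ≤ av A' (fun w => ‖w‖ ^ 2) := by
      have h4 : m0 * V ≤ ∫ w in A, ‖w‖ ^ 2 := by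
        rw [av, smul_eq_mul, le_inv_mul_iff₀ hV] at hm; linarith
      have h5 : ∫ w in A, ‖w‖ ^ 2 ≤ ∫ w in A', ‖w‖ ^ 2 := by
        apply MeasureTheory.setIntegral_mono_set (hA'B.integrableOn (by fun_prop))
        · exact Filter.Eventually.of_forall fun z => sq_nonneg _
        · exact Filter.Eventually.of_forall h1
      rw [av, smul_eq_mul, le_inv_mul_iff₀ hV'0]
      have h6 : V' ≤ 4 * V := by
        have : (1 + δ) ^ 2 ≤ 4 := by nlinarith
        nlinarith
      nlinarith
    rw [hA', av_image_affC hαβ.ne' hN.compact.measurableSet, hN.av_norm_affC_sq hNi, ← hM] at h3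
    have h7 : ‖γ‖ ^ 2 ≤ m0 / 8 := by
      calc ‖γ‖ ^ 2 ≤ (9 * R * δ) ^ 2 := pow_le_pow_left₀ (norm_nonneg _) hγ 2
        _ = 81 * (R ^ 2 * δ) * δ := by ring
        _ ≤ 81 * (R ^ 2 * δ) * 1 := by gcongr
        _ ≤ _ := by linarith
    have h8 : ‖β‖ ^ 2 * M ≤ ‖α‖ ^ 2 * M := by gcongr
    nlinarith
  have hα : 0 < ‖α‖ := (norm_nonneg _).trans_lt hαβ
  have hβα : ‖β‖ ≤ 864 * R ^ 2 * δ / m0 * ‖α‖ := by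
    have hMα : 0 < ‖α‖ ^ 2 * M := lt_of_lt_of_le (by positivity) hsum
    have hMpos : 0 < M := by
      rcases hM0.eq_or_lt with h | h
      · rw [← h] at hMα; simp at hMα
      · exact h
    have h3 : ‖β‖ * (‖α‖ * M) ≤ (864 * R ^ 2 * δ / m0 * ‖α‖) * (‖α‖ * M) := by
      calc ‖β‖ * (‖α‖ * M) = ‖α‖ * ‖β‖ * M := by ring
        _ ≤ 54 * R ^ 2 * δ := hprod
        _ = 864 * R ^ 2 * δ / m0 * (m0 / 16) := by field_simp; ring
        _ ≤ 864 * R ^ 2 * δ / m0 * (‖α‖ ^ 2 * M) := by gcongr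
        _ = _ := by ring
    exact le_of_mul_le_mul_right h3 (by positivity)
  have hhalf : ‖β‖ ≤ ‖α‖ / 2 := by
    have : 864 * R ^ 2 * δ / m0 ≤ 1 / 2 := by rw [div_le_iff₀ hm0]; linarith
    nlinarith
  exact ⟨hV'1, hbd, hγ, hβα, hhalf⟩

set_option maxHeartbeats 400000 in
lemma compare_subset {A N : Set ℂ} {r R m0 δ : ℝ} {α β γ z : ℂ} (hr : 0 < r)
    (hR0 : 0 < R) (hm0 : 0 < m0) (hA : Body A) (hrA : closedBall 0 r ⊆ A) (hzn : ‖z‖ ≤ δ * R)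
    (h2 : affC α β γ '' N ⊆ affC (1 + δ : ℝ) 0 z '' A) (hδ : 0 ≤ δ) (hδ1 : δ ≤ 1)
    (hbd : ∀ w ∈ affC α β γ '' N, ‖w‖ ≤ 3 * R) (hγ : ‖γ‖ ≤ 9 * R * δ)
    (hβα : ‖β‖ ≤ 864 * R ^ 2 * δ / m0 * ‖α‖) (hhalf : ‖β‖ ≤ ‖α‖ / 2) :
    affC α 0 0 '' N ⊆ affC (1 + (1 + cmpE R m0 / r) * δ : ℝ) 0 0 '' A := by
  set D := 1 + cmpE R m0 / r with hD
  have hE0 : 0 < cmpE R m0 := by unfold cmpE; positivity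
  have hD0 : 0 < D := by positivity
  rintro _ ⟨w, hw, rfl⟩
  have hw1 : affC α β γ w ∈ affC α β γ '' N := mem_image_of_mem _ hw
  have hw2 : ‖α‖ * ‖w‖ ≤ 24 * R := by
    have h3 : ‖α * w‖ ≤ ‖affC α β γ w‖ + ‖β * (starRingEnd ℂ) w‖ + ‖γ‖ := by
      calc ‖α * w‖ = ‖affC α β γ w - β * (starRingEnd ℂ) w - γ‖ := by congr 1; rw [affC]; ring
        _ ≤ ‖affC α β γ w - β * (starRingEnd ℂ) w‖ + ‖γ‖ := norm_sub_le _ _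
        _ ≤ _ := by gcongr; exact norm_sub_le _ _
    rw [norm_mul, norm_mul, RCLike.norm_conj] at h3
    have := hbd _ hw1
    have h4 : ‖β‖ * ‖w‖ ≤ ‖α‖ / 2 * ‖w‖ := by gcongr
    have h5 : 9 * R * δ ≤ 9 * R := by nlinarith
    linarith
  have hw3 : ‖β‖ * ‖w‖ ≤ 20736 * R ^ 3 / m0 * δ := by
    calc ‖β‖ * ‖w‖ ≤ (864 * R ^ 2 * δ / m0 * ‖α‖) * ‖w‖ := by gcongr
      _ = 864 * R ^ 2 * δ / m0 * (‖α‖ * ‖w‖) := by ring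
      _ ≤ 864 * R ^ 2 * δ / m0 * (24 * R) := by gcongr
      _ = _ := by ring
  obtain ⟨a, ha, hae⟩ := h2 hw1
  set e := z - β * (starRingEnd ℂ) w - γ with he
  have hen : ‖e‖ ≤ cmpE R m0 * δ := by
    calc ‖e‖ ≤ ‖z - β * (starRingEnd ℂ) w‖ + ‖γ‖ := norm_sub_le _ _
      _ ≤ ‖z‖ + ‖β * (starRingEnd ℂ) w‖ + ‖γ‖ := by gcongr; exact norm_sub_le _ _
      _ ≤ δ * R + 20736 * R ^ 3 / m0 * δ + 9 * R * δ := by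
        rw [norm_mul, RCLike.norm_conj]; gcongr
      _ = _ := by unfold cmpE; ring
  have hαw : α * w = (1 + δ : ℝ) * a + e := by
    rw [affC, affC] at hae
    rw [he]; linear_combination -hae
  rcases hδ.eq_or_lt with h0 | h0
  · refine ⟨a, ha, ?_⟩
    have : e = 0 := by rw [← norm_le_zero_iff]; rw [← h0, mul_zero] at hen; exact hen
    rw [affC, affC]
    rw [this, ← h0] at hαw
    rw [← h0]; push_cast; push_cast at hαw; linear_combination -hαw
  · set s := cmpE R m0 / r * δ with hs
    have hs0 : 0 < s := by positivity
    have hb : (s⁻¹ : ℝ) * e ∈ A := by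
      apply hrA
      rw [mem_closedBall_zero_iff, norm_mul, Complex.norm_real, Real.norm_eq_abs,
        abs_of_pos (by positivity), inv_mul_le_iff₀ hs0]
      calc _ ≤ _ := hen
        _ = s * r := by rw [hs]; field_simp
    have hmem : (1 + δ) • a + s • ((s⁻¹ : ℝ) * e) ∈ ((1 + δ) + s) • A := by
      rw [hA.convex.add_smul (by linarith) hs0.le]
      exact add_mem_add (smul_mem_smul_set ha) (smul_mem_smul_set hb)
    obtain ⟨b, hb, hbe⟩ := hmem
    refine ⟨b, hb, ?_⟩
    have hss : (s : ℂ) ≠ 0 := by exact_mod_cast hs0.ne'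
    simp only [Complex.real_smul] at hbe
    have hDs : 1 + D * δ = (1 + δ) + s := by rw [hs, hD]; ring
    rw [affC, affC, hDs]
    push_cast at hbe hαw ⊢
    rw [zero_mul, add_zero, add_zero, zero_mul, add_zero, add_zero, hbe, hαw]
    field_simp

lemma dirPow_integral_le_of_lt {A N : Set ℂ} {r R m0 δ : ℝ} {α β γ z : ℂ} (hr : 0 < r)
    (hm0 : 0 < m0) (hA : Body A) (hAi : Isotropic A)
    (hrA : closedBall 0 r ⊆ A) (hR : A ⊆ closedBall 0 R) (hm : m0 ≤ av A (fun w => ‖w‖ ^ 2))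
    (hN : Body N) (hNi : Isotropic N) (hαβ : ‖β‖ < ‖α‖) (h1 : A ⊆ affC α β γ '' N)
    (h2 : affC α β γ '' N ⊆ (1 + δ) • A + {z}) (hδ : 0 ≤ δ) (hδ1 : δ ≤ 1)
    (hδ2 : 1728 * R ^ 2 * δ ≤ m0) (m : ℕ) (hz : ∫ w in N, dirPow m w = 0) :
    ‖∫ w in A, dirPow m w‖ ≤
      2 * (((1 + (1 + cmpE R m0 / r) * δ)) ^ 2 - 1) * MeasureTheory.volume.real A := by
  obtain ⟨hV'1, hbd, hγ, hβα, hhalf⟩ := compare_coeff_bounds hr hm0 hA hAi hrA hR hm hN hNi hαβ h1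
    h2 hδ hδ1 hδ2
  have hzn : ‖z‖ ≤ δ * R := norm_translation_le hA hR hδ (h1.trans h2)
  have hR0 : 0 < R := by
    have : (r : ℂ) ∈ closedBall (0 : ℂ) R := hR (hrA (by simp [abs_of_pos hr]))
    have : r ≤ R := by simpa [abs_of_pos hr] using this
    linarith
  rw [smul_add_singleton_eq] at h2
  have hsub := compare_subset hr hR0 hm0 hA hrA hzn h2 hδ hδ1 hbd hγ hβα hhalf
  have hα : 0 < ‖α‖ := (norm_nonneg _).trans_lt hαβ
  set V := MeasureTheory.volume.real A with hVdef
  set D := 1 + cmpE R m0 / r with hD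
  have hE0 : 0 < cmpE R m0 := by unfold cmpE; positivity
  have hD0 : 0 < D := by positivity
  have hDδ : 0 ≤ D * δ := by positivity
  have hne2 : ‖((1 + D * δ : ℝ) : ℂ)‖ ≠ ‖(0 : ℂ)‖ := by
    rw [norm_zero, Complex.norm_real, Real.norm_eq_abs, abs_of_pos (by linarith)]; linarith
  have hUB2 := hA.image_affC (γ := 0) hne2
  have hUV2 := volume_image_affC (γ := 0) hne2 hA.compact.measurableSet
  rw [abs_norm_sq_ofReal, ← hVdef] at hUV2
  set U := affC (1 + D * δ : ℝ) 0 0 '' A with hU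
  have hAU : A ⊆ U := by
    intro a ha
    have h0A : (0 : ℂ) ∈ A := hrA (by simp [hr.le])
    refine ⟨((1 + D * δ)⁻¹ : ℝ) • a, ?_, ?_⟩
    · apply hA.convex.smul_mem_of_zero_mem h0A ha
      exact ⟨by positivity, inv_le_one_of_one_le₀ (by linarith)⟩
    · rw [affC, Complex.real_smul]
      have : ((1 + D * δ : ℝ) : ℂ) ≠ 0 := by
        have : (1 + D * δ : ℝ) ≠ 0 := by positivity
        exact_mod_cast this
      rw [Complex.ofReal_inv]
      field_simp
      simp
  have hα0 : ‖α‖ ≠ ‖(0 : ℂ)‖ := by rw [norm_zero]; exact hα.ne'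
  have hN''B := hN.image_affC (γ := 0) hα0
  have hN''V := volume_image_affC (γ := 0) hα0 hN.compact.measurableSet
  have hA'V := volume_image_affC (γ := γ) hαβ.ne' hN.compact.measurableSet
  have hN''low : V ≤ MeasureTheory.volume.real (affC α 0 0 '' N) := by
    refine hV'1.trans ?_
    rw [hA'V, hN''V]
    apply mul_le_mul_of_nonneg_right _ hN.volume_pos.le
    rw [norm_zero, abs_of_nonneg (by nlinarith [norm_nonneg β]),
      abs_of_nonneg (by nlinarith [sq_nonneg ‖α‖])]
    nlinarith [sq_nonneg ‖β‖]
  have hN''z : ∫ w in affC α 0 0 '' N, dirPow m w = 0 := by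
    rw [integral_image_affC hα0 hN.compact.measurableSet]
    have : (fun w => dirPow m (affC α 0 0 w)) = fun w => dirPow m α * dirPow m w := by
      ext w; rw [affC, zero_mul, add_zero, add_zero, dirPow_mul]
    rw [this, MeasureTheory.integral_const_mul, hz]; simp
  have hd1 := norm_integral_sub_le hA.compact.measurableSet hUB2.compact hAU
    (integrableOn_dirPow m hUB2.compact) (fun w _ => norm_dirPow_le m w)
  have hd2 := norm_integral_sub_le hN''B.compact.measurableSet hUB2.compact hsub
    (integrableOn_dirPow m hUB2.compact) (fun w _ => norm_dirPow_le m w)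
  rw [hN''z, sub_zero] at hd2
  calc ‖∫ w in A, dirPow m w‖ = ‖(∫ w in U, dirPow m w) -
        ((∫ w in U, dirPow m w) - ∫ w in A, dirPow m w)‖ := by rw [sub_sub_cancel]
    _ ≤ ‖∫ w in U, dirPow m w‖ + ‖(∫ w in U, dirPow m w) - ∫ w in A, dirPow m w‖ := norm_sub_le _ _
    _ ≤ _ := by rw [← hVdef] at hd1; nlinarith

lemma dBMlt_image {V W V' W' : Type*} [AddCommGroup V] [Module ℝ V] [AddCommGroup W] [Module ℝ W]
    [AddCommGroup V'] [Module ℝ V'] [AddCommGroup W'] [Module ℝ W'] {K : Set V} {L : Set W}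
    {lam : ℝ} (h : dBMlt K L lam) (S : V ≃ᵃ[ℝ] V') (S' : W ≃ᵃ[ℝ] W') :
    dBMlt (S '' K) (S' '' L) lam := by
  obtain ⟨T, z, h1, h2⟩ := h
  have him : (S'.symm.trans (T.trans S)) '' (S' '' L) = S '' (T '' L) := by
    simp [image_image]
  refine ⟨S'.symm.trans (T.trans S), S z - lam • S 0, ?_, ?_⟩
  · rw [him]; exact image_mono h1
  · rw [him]
    rintro _ ⟨w, hw, rfl⟩
    have hw' := h2 hw
    rw [add_singleton, mem_image] at hw' ⊢
    obtain ⟨_, ⟨k, hk, rfl⟩, rfl⟩ := hw'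
    refine ⟨lam • S k, smul_mem_smul_set (mem_image_of_mem S hk), ?_⟩
    have hlin : ∀ x : V, S x = S.linear x + S 0 := by
      intro x
      have := S.map_vadd 0 x
      simpa using this
    simp only
    rw [hlin (lam • k + z), hlin k, hlin z, map_add, map_smul]
    module

lemma exists_affineEquiv_affC {α β : ℂ} (γ : ℂ) (h : ‖α‖ ≠ ‖β‖) :
    ∃ S : ℂ ≃ᵃ[ℝ] ℂ, ⇑S = affC α β γ := by
  have hdet : LinearMap.det (linC α β) ≠ 0 := by
    rw [det_linC, sub_ne_zero]
    intro h'
    exact h ((sq_eq_sq₀ (norm_nonneg _) (norm_nonneg _)).1 h')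
  refine ⟨((linC α β).equivOfDetNeZero hdet).toAffineEquiv.trans (AffineEquiv.constVAdd ℝ ℂ γ), ?_⟩
  ext w
  simp [affC, linC_apply, LinearMap.equivOfDetNeZero]
  ring

lemma exists_affC_of_equiv (T : ℂ ≃ᵃ[ℝ] ℂ) : ∃ α β γ, ‖α‖ ≠ ‖β‖ ∧ ⇑T = affC α β γ := by
  obtain ⟨α, β, γ, h⟩ := exists_affC (T : ℂ →ᵃ[ℝ] ℂ)
  have hT : ⇑T = affC α β γ := funext h
  refine ⟨α, β, γ, ?_, hT⟩
  have hl : (T.linear : ℂ →ₗ[ℝ] ℂ) = linC α β := by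
    refine LinearMap.ext fun w => ?_
    have := T.map_vadd 0 w
    simp only [vadd_eq_add, add_zero, hT, affC] at this
    rw [linC_apply]
    simp only [mul_zero, map_zero, zero_add, add_left_inj] at this
    exact this.symm
  have hdet := T.linear.isUnit_det'
  rw [hl, det_linC, isUnit_iff_ne_zero] at hdet
  intro h'
  rw [h', sub_self] at hdet
  exact hdet rfl

lemma dirPow_conj (m : ℕ) (z : ℂ) :
    dirPow m ((starRingEnd ℂ) z) = (starRingEnd ℂ) (dirPow m z) := by
  rw [dirPow, dirPow, map_pow, map_div₀, RCLike.norm_conj, Complex.conj_ofReal]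

lemma Body.conj {N : Set ℂ} (hN : Body N) : Body (affC 0 1 0 '' N) :=
  hN.image_affC (by simp)

lemma Body.isotropic_conj {N : Set ℂ} (hN : Body N) (hi : Isotropic N) :
    Isotropic (affC 0 1 0 '' N) := by
  have h : ‖(0 : ℂ)‖ ≠ ‖(1 : ℂ)‖ := by simp
  constructor
  · rw [av_image_affC h hN.compact.measurableSet]
    have : (fun w => affC 0 1 0 w) = fun w => (starRingEnd ℂ) w := by
      ext w; simp [affC]
    rw [this, av_conj, hi.1, map_zero]
  · rw [av_image_affC h hN.compact.measurableSet]
    have : (fun w => affC 0 1 0 w ^ 2) = fun w => (starRingEnd ℂ) (w ^ 2) := by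
      ext w; simp [affC]
    rw [this, av_conj, hi.2, map_zero]

lemma integral_dirPow_conj {N : Set ℂ} (hN : Body N) {m : ℕ} (hz : ∫ w in N, dirPow m w = 0) :
    ∫ w in affC 0 1 0 '' N, dirPow m w = 0 := by
  have h : ‖(0 : ℂ)‖ ≠ ‖(1 : ℂ)‖ := by simp
  rw [integral_image_affC h hN.compact.measurableSet]
  have : (fun w => dirPow m (affC 0 1 0 w)) = fun w => (starRingEnd ℂ) (dirPow m w) := by
    ext w; rw [← dirPow_conj]; simp [affC]
  rw [this, integral_conj, hz]; simp

lemma dirPow_integral_le {A N : Set ℂ} {r R m0 δ : ℝ} (hr : 0 < r)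
    (hm0 : 0 < m0) (hA : Body A) (hAi : Isotropic A)
    (hrA : closedBall 0 r ⊆ A) (hR : A ⊆ closedBall 0 R) (hm : m0 ≤ av A (fun w => ‖w‖ ^ 2))
    (hN : Body N) (hNi : Isotropic N) (h : dBMlt A N (1 + δ)) (hδ : 0 ≤ δ) (hδ1 : δ ≤ 1)
    (hδ2 : 1728 * R ^ 2 * δ ≤ m0) (m : ℕ) (hz : ∫ w in N, dirPow m w = 0) :
    ‖∫ w in A, dirPow m w‖ ≤
      2 * (((1 + (1 + cmpE R m0 / r) * δ)) ^ 2 - 1) * MeasureTheory.volume.real A := by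
  obtain ⟨T, z, h1, h2⟩ := h
  obtain ⟨α, β, γ, hαβ, hT⟩ := exists_affC_of_equiv T
  rw [hT] at h1 h2
  rcases hαβ.lt_or_gt with hlt | hlt
  · have : affC α β γ '' N = affC β α γ '' (affC 0 1 0 '' N) := by
      rw [image_image]
      congr 1
      ext w
      simp [affC]; ring
    rw [this] at h1 h2
    exact dirPow_integral_le_of_lt hr hm0 hA hAi hrA hR hm hN.conj (hN.isotropic_conj hNi) hlt h1 h2
      hδ hδ1 hδ2 m (integral_dirPow_conj hN hz)
  · exact dirPow_integral_le_of_lt hr hm0 hA hAi hrA hR hm hN hNi hlt h1 h2 hδ hδ1 hδ2 m hz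

lemma Isotropic.closedBall_subset {N : Set ℂ} (hN : Body N) (hi : Isotropic N) {R m0 : ℝ}
    (hR0 : 0 < R) (hm0 : 0 < m0) (hR : N ⊆ closedBall 0 R) (hm : m0 ≤ av N (fun w => ‖w‖ ^ 2)) :
    closedBall 0 (m0 / (4 * R)) ⊆ N := by
  intro w0 hw0
  by_contra hnot
  obtain ⟨f, u, hf1, hf2⟩ := geometric_hahn_banach_closed_point hN.convex hN.compact.isClosed hnot
  set v : ℂ := (f 1 : ℂ) - (f Complex.I : ℂ) * Complex.I with hv
  have hfv : ∀ z, f z = (v * z).re := by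
    intro z
    have : f z = z.re * f 1 + z.im * f Complex.I := by
      conv_lhs => rw [show z = z.re • (1 : ℂ) + z.im • Complex.I by simp]
      rw [map_add, map_smul, map_smul, smul_eq_mul, smul_eq_mul]
    rw [this, hv]; simp; ring
  rw [mem_closedBall_zero_iff] at hw0
  have hsq : ∀ z, f z ^ 2 = (1 / 2 : ℝ) * (‖v‖ ^ 2 * ‖z‖ ^ 2 + (v ^ 2 * z ^ 2).re) := by
    intro z
    rw [hfv, Complex.sq_norm, Complex.sq_norm, Complex.normSq_apply, Complex.normSq_apply]
    simp only [pow_two, Complex.mul_re, Complex.mul_im]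
    ring
  have hav1 : av N (fun z => f z) = 0 := by
    simp only [hfv]
    rw [av_re hN (f := fun z => v * z) (by fun_prop), av_mul_left, hi.1]; simp
  have hav2 : av N (fun z => f z ^ 2) = (1 / 2 : ℝ) * (‖v‖ ^ 2 * av N (fun w => ‖w‖ ^ 2)) := by
    simp only [hsq]
    rw [av_mul_left, hN.av_add (by fun_prop) (by fun_prop), av_mul_left,
      av_re hN (f := fun z => v ^ 2 * z ^ 2) (by fun_prop), av_mul_left, hi.2]; simp
  have habs : ∀ z, |f z| ≤ ‖v‖ * ‖z‖ := by
    intro z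
    rw [hfv, ← norm_mul]; exact Complex.abs_re_le_norm _
  have hv0 : 0 < ‖v‖ := by
    rw [norm_pos_iff]
    intro h0
    obtain ⟨c, hc⟩ := hN.nonempty
    have h1 := hf1 c (interior_subset hc)
    rw [hfv, h0] at h1
    rw [hfv, h0] at hf2
    simp at h1 hf2
    linarith
  have hmono := hN.av_mono (f := fun z => f z ^ 2)
    (g := fun z => (f w0 - ‖v‖ * R) * f z + f w0 * (‖v‖ * R)) (by fun_prop) (by fun_prop) (by
      intro z hz
      have h1 := hf1 z hz
      have h2 := (abs_le.1 (habs z)).1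
      have h3 := hR hz
      rw [mem_closedBall_zero_iff] at h3
      have h4 : ‖v‖ * ‖z‖ ≤ ‖v‖ * R := by gcongr
      have : 0 ≤ (f w0 - f z) * (f z + ‖v‖ * R) := mul_nonneg (by linarith) (by linarith)
      nlinarith)
  rw [hav2, hN.av_add (by fun_prop) (by fun_prop), av_mul_left, hav1, hN.av_const] at hmono
  have h1 := (abs_le.1 (habs w0)).2
  have h2 : f w0 * (‖v‖ * R) ≤ ‖v‖ * (m0 / (4 * R)) * (‖v‖ * R) := by
    gcongr
    exact h1.trans (by gcongr)
  have h3 : ‖v‖ * (m0 / (4 * R)) * (‖v‖ * R) = ‖v‖ ^ 2 * m0 / 4 := by field_simp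
  have h4 : ‖v‖ ^ 2 * m0 ≤ ‖v‖ ^ 2 * av N (fun w => ‖w‖ ^ 2) := by gcongr
  have : 0 < ‖v‖ ^ 2 * m0 := by positivity
  linarith

lemma Body.isoMap_bounds {A : Set ℂ} (hA : Body A) {c : ℂ} (hc : closedBall c (1 / 4) ⊆ A)
    (hA2 : A ⊆ closedBall 0 2) :
    isoMap A '' A ⊆ closedBall 0 8 ∧ 1 / 2 ^ 59 ≤ av (isoMap A '' A) (fun w => ‖w‖ ^ 2) := by
  have hV := hA.volume_pos
  have hV4 : MeasureTheory.volume.real A ≤ 4 * Real.pi := by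
    calc _ ≤ MeasureTheory.volume.real (closedBall (0 : ℂ) 2) :=
          MeasureTheory.measureReal_mono hA2 (isCompact_closedBall 0 2).measure_lt_top.ne
      _ = 4 * Real.pi := by
        rw [MeasureTheory.measureReal_def, Complex.volume_closedBall]
        simp; norm_num
  have hs : ∀ u : ℂ, ‖u‖ = 1 → (1 / 2 ^ 18 : ℝ) ≤ av A (fun z => (u * (z - centroid A)).re ^ 2) := by
    intro u hu
    refine le_trans ?_ (hA.spread (by norm_num) hc hu)
    rw [le_div_iff₀ hV]
    nlinarith [Real.pi_pos]
  have hp := hA.pMoment_le hs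
  have hg : ‖centroid A‖ ≤ 2 := by
    have h1 : ‖∫ z in A, z‖ ≤ 2 * MeasureTheory.volume.real A :=
      MeasureTheory.norm_setIntegral_le_of_norm_le_const hA.compact.measure_lt_top
        fun z hz => by simpa using hA2 hz
    rw [centroid, av, norm_smul, norm_inv, Real.norm_eq_abs, abs_of_pos hV, inv_mul_le_iff₀ hV]
    linarith
  have hzg : ∀ z ∈ A, ‖z - centroid A‖ ≤ 4 := by
    intro z hz
    have := hA2 hz
    rw [mem_closedBall_zero_iff] at this
    linarith [norm_sub_le z (centroid A)]
  have hm16 : mMoment A ≤ 16 := by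
    have := hA.av_mono (f := fun z => ‖z - centroid A‖ ^ 2) (g := fun _ => (16 : ℝ)) (by fun_prop)
      (by fun_prop) (fun z hz => by nlinarith [hzg z hz, norm_nonneg (z - centroid A)])
    rwa [hA.av_const] at this
  have hmpos := hA.mMoment_pos
  have hmlow : (1 / 2 ^ 17 : ℝ) ≤ mMoment A := by linarith [norm_nonneg (pMoment A)]
  have hμ : ‖isoCoef A‖ ≤ 1 - 1 / 2 ^ 21 := by
    refine hA.norm_isoCoef_le.trans ?_
    rw [div_le_iff₀ hmpos]
    linarith
  have hμ1 := hA.norm_isoCoef_lt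
  refine ⟨?_, ?_⟩
  · rintro _ ⟨z, hz, rfl⟩
    rw [mem_closedBall_zero_iff, isoMap_apply]
    refine (norm_sub_le _ _).trans ?_
    rw [norm_mul, RCLike.norm_conj]
    have := hzg z hz
    nlinarith [norm_nonneg (z - centroid A)]
  · have : av (isoMap A '' A) (fun w => ‖w‖ ^ 2) = av A (fun z => ‖isoMap A z‖ ^ 2) :=
      av_image_affC hA.norm_ne hA.compact.measurableSet _
    rw [this]
    have hcont : Continuous (isoMap A) := continuous_affC _ _ _
    have h1 := hA.av_mono (f := fun z => (1 / 2 ^ 42 : ℝ) * ‖z - centroid A‖ ^ 2)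
      (g := fun z => ‖isoMap A z‖ ^ 2) (by fun_prop) (by fun_prop) (by
        intro z hz
        have h2 : (1 / 2 ^ 21) * ‖z - centroid A‖ ≤ ‖isoMap A z‖ := by
          rw [isoMap_apply]
          refine le_trans ?_ (norm_sub_norm_le _ _)
          rw [norm_mul, RCLike.norm_conj]
          nlinarith [norm_nonneg (z - centroid A)]
        have h3 := pow_le_pow_left₀ (by positivity) h2 2
        rw [mul_pow] at h3
        norm_num at h3 ⊢
        linarith)
    rw [av_mul_left] at h1
    change _ * mMoment A ≤ _ at h1
    norm_num at h1 hmlow ⊢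
    linarith

/-- `F` is a polynomial of degree at most two in two variables. -/
def IsQuad (F : ℝ → ℝ → ℝ) : Prop :=
  ∃ a b c d e g : ℝ, ∀ s t, F s t = a * s ^ 2 + b * (s * t) + c * t ^ 2 + d * s + e * t + g

/-- The planar set `{(s, t) | S s t}` is `ε`-close to the conic body `{F ≤ 0}`, where `F` is a
quadratic polynomial with minimum `-1`. -/
def NearConic (ε : ℝ) (S : ℝ → ℝ → Prop) : Prop :=
  ∃ F : ℝ → ℝ → ℝ, IsQuad F ∧ (∀ s t, -1 ≤ F s t) ∧ (∃ s t, F s t = -1) ∧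
    (∀ s t, S s t → F s t ≤ 0) ∧ ∀ s t, F s t ≤ -4 * ε → S s t

lemma exists_nearConic_const : ∃ C δ₀ : ℝ, 0 < C ∧ 0 < δ₀ ∧ ∀ (A : Set ℂ) (c : ℂ) (δ : ℝ), Body A →
    closedBall c (1 / 4) ⊆ A → A ⊆ closedBall 0 2 → 0 < δ → δ ≤ δ₀ →
    (∀ m : ℕ, 1 ≤ m → ∃ N, Body N ∧ Isotropic N ∧ (∫ w in N, dirPow m w = 0) ∧
      dBMlt A N (1 + δ)) →
    NearConic (C * √δ) (fun s t => (⟨s, t⟩ : ℂ) ∈ A) := by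
  set m0 : ℝ := 1 / 2 ^ 59 with hm0def
  have hm0 : 0 < m0 := by positivity
  set r : ℝ := m0 / (4 * 8) with hrdef
  have hr : 0 < r := by positivity
  set D : ℝ := 1 + cmpE 8 m0 / r with hD
  have hE0 : 0 < cmpE 8 m0 := by unfold cmpE; positivity
  have hD0 : 0 < D := by positivity
  set C1 : ℝ := 2 * (2 * D + D ^ 2) * (64 * Real.pi) with hC1
  have hC10 : 0 < C1 := by positivity
  set C : ℝ := (5 * (8 ^ 3 / r) + 1) * √C1 / r ^ 2 with hC
  have hC0 : 0 < C := by positivity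
  refine ⟨C, min 1 (min (m0 / (1728 * 8 ^ 2)) (1 / C1)), hC0, by positivity, ?_⟩
  intro A c δ hA hc hA2 hδ hδ0 H
  have hδ1 : δ ≤ 1 := hδ0.trans (min_le_left _ _)
  have hδ2 : 1728 * 8 ^ 2 * δ ≤ m0 := by
    have := hδ0.trans ((min_le_right _ _).trans (min_le_left _ _))
    rw [le_div_iff₀ (by norm_num)] at this
    linarith
  have hδ3 : C1 * δ ≤ 1 := by
    have := hδ0.trans ((min_le_right _ _).trans (min_le_right _ _))
    rw [le_div_iff₀ hC10] at this
    linarith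
  obtain ⟨S, hS⟩ := exists_affineEquiv_affC
    (-centroid A + isoCoef A * (starRingEnd ℂ) (centroid A)) hA.norm_ne
  have hS' : ⇑S = isoMap A := hS
  obtain ⟨hA8, hAm⟩ := hA.isoMap_bounds hc hA2
  have hA'B : Body (isoMap A '' A) := hA.image_affC hA.norm_ne
  have hA'i := hA.isotropic_isoMap
  set A' := isoMap A '' A with hA'
  have hrA := hA'i.closedBall_subset hA'B (by norm_num) hm0 hA8 hAm
  have hvol : MeasureTheory.volume.real A' ≤ 64 * Real.pi := by
    calc _ ≤ MeasureTheory.volume.real (closedBall (0 : ℂ) 8) :=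
          MeasureTheory.measureReal_mono hA8 (isCompact_closedBall 0 8).measure_lt_top.ne
      _ = 64 * Real.pi := by
        rw [MeasureTheory.measureReal_def, Complex.volume_closedBall]
        simp; norm_num
  have hF : ∀ m : ℕ, 1 ≤ m → ‖∫ z in A', (z / ‖z‖) ^ m‖ ≤ C1 * δ := by
    intro m hm
    obtain ⟨N, hN, hNi, hNz, hd⟩ := H m hm
    have hd' := dBMlt_image hd S (AffineEquiv.refl ℝ ℂ)
    rw [hS', ← hA'] at hd'
    simp only [AffineEquiv.coe_refl, image_id] at hd'
    refine (dirPow_integral_le hr hm0 hA'B hA'i hrA hA8 hAm hN hNi hd' hδ.le hδ1 hδ2 m hNz).trans ?_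
    rw [← hD]
    have h1 : (1 + D * δ) ^ 2 - 1 ≤ (2 * D + D ^ 2) * δ := by
      have : δ ^ 2 ≤ δ := by nlinarith
      have : D ^ 2 * δ ^ 2 ≤ D ^ 2 * δ := by gcongr
      linarith
    calc 2 * ((1 + D * δ) ^ 2 - 1) * MeasureTheory.volume.real A'
        ≤ 2 * ((2 * D + D ^ 2) * δ) * (64 * Real.pi) := by gcongr
      _ = C1 * δ := by rw [hC1]; ring
  obtain ⟨P, hrP, hP1, hP2⟩ := near_circle_of_angular_small hr hA'B.compact hA'B.convex hrA hA8
    (by positivity) hδ3 hF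
  have hP0 : 0 < P := lt_of_lt_of_le (by positivity) hrP
  refine ⟨fun s t => ‖isoMap A ⟨s, t⟩‖ ^ 2 / P - 1, ?_, ?_, ?_, ?_, ?_⟩
  · rw [isoMap]
    generalize -isoCoef A = β
    generalize -centroid A + _ = γ
    refine ⟨((1 + β.re) ^ 2 + β.im ^ 2) / P, (4 * β.im) / P, ((1 - β.re) ^ 2 + β.im ^ 2) / P,
      (2 * ((1 + β.re) * γ.re + β.im * γ.im)) / P, (2 * (β.im * γ.re + (1 - β.re) * γ.im)) / P,
      (γ.re ^ 2 + γ.im ^ 2) / P - 1, fun s t => ?_⟩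
    simp only [affC, Complex.sq_norm, Complex.normSq_apply]
    simp
    field_simp
    ring
  · intro s t
    have : 0 ≤ ‖isoMap A ⟨s, t⟩‖ ^ 2 / P := by positivity
    linarith
  · obtain ⟨w, hw⟩ := S.surjective 0
    refine ⟨w.re, w.im, ?_⟩
    rw [hS'] at hw
    simp [hw]
  · intro s t hst
    have := hP1 _ (mem_image_of_mem _ hst)
    have : ‖isoMap A ⟨s, t⟩‖ ^ 2 / P ≤ 1 := (div_le_one hP0).2 this
    linarith
  · intro s t hst
    have h1 : isoMap A ⟨s, t⟩ ∈ A' := by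
      apply hP2
      have h2 : 4 * ((5 * (8 ^ 3 / r) + 1) * √(C1 * δ)) = 4 * (C * √δ) * r ^ 2 := by
        rw [hC, Real.sqrt_mul hC10.le]; field_simp
      rw [h2]
      have h3 : ‖isoMap A ⟨s, t⟩‖ ^ 2 ≤ (1 - 4 * (C * √δ)) * P := by
        rw [← div_le_iff₀ hP0]; linarith
      have h4 : 4 * (C * √δ) * r ^ 2 ≤ 4 * (C * √δ) * P := by gcongr
      linarith
    rw [← hS'] at h1
    rw [hA', ← hS'] at h1
    exact S.injective.mem_set_image.1 h1

section Family

variable {V : Type*} [NormedAddCommGroup V] [NormedSpace ℝ V]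
  {X : Type*} [TopologicalSpace X] [FirstCountableTopology X]
  {K : Set V} {L : X → ℂ →ₗ[ℝ] V} {M : ℝ}

lemma body_preimage (hK : IsCompact K) (hc : Convex ℝ K) (h0 : 0 ∈ interior K)
    {l : ℂ →ₗ[ℝ] V} (hM : ∀ z, ‖z‖ ≤ M * ‖l z‖) : Body {z | l z ∈ K} := by
  have hl : Continuous l := l.continuous_of_finiteDimensional
  refine ⟨?_, hc.linear_preimage l, ⟨0, ?_⟩⟩
  · apply Metric.isCompact_of_isClosed_isBounded (hK.isClosed.preimage hl)
    obtain ⟨ρ, hρ⟩ := hK.isBounded.exists_norm_le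
    apply isBounded_iff_forall_norm_le.2 ⟨|M| * ρ, fun z hz => (hM z).trans ?_⟩
    have := hρ _ hz
    calc M * ‖l z‖ ≤ |M| * ‖l z‖ := by gcongr; exact le_abs_self M
      _ ≤ |M| * ρ := by gcongr
  · have : IsOpen (l ⁻¹' interior K) := isOpen_interior.preimage hl
    apply interior_maximal (preimage_mono interior_subset) this
    simpa using h0

lemma ae_preimage_interior_or_notMem (hc : Convex ℝ K) (h0 : 0 ∈ interior K) (l : ℂ →ₗ[ℝ] V) :
    ∀ᵐ z : ℂ, l z ∈ interior K ∨ l z ∉ K := by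
  have hl : Continuous l := l.continuous_of_finiteDimensional
  have hconv : Convex ℝ (l ⁻¹' K) := hc.linear_preimage l
  have hnull := hconv.addHaar_frontier MeasureTheory.volume
  rw [MeasureTheory.measure_eq_zero_iff_ae_notMem] at hnull
  filter_upwards [hnull] with z hz
  by_contra! hcon
  apply hz
  refine ⟨subset_closure hcon.2, fun hInt => hcon.1 ?_⟩
  have h1 : Filter.Tendsto (fun t : ℝ => (1 + t) • z) (nhds 0) (nhds z) := by
    have : Continuous fun t : ℝ => (1 + t) • z := by fun_prop
    simpa using this.tendsto 0
  have h2 := h1.eventually (isOpen_interior.mem_nhds hInt)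
  obtain ⟨ε, hε, hball⟩ := Metric.eventually_nhds_iff.1 h2
  have h3 := interior_subset (hball (y := ε / 2) (by simp [abs_of_pos hε, hε]))
  rw [mem_preimage, map_smul] at h3
  have h4 : l z ∈ openSegment ℝ (0 : V) ((1 + ε / 2) • l z) := by
    refine ⟨1 - (1 + ε / 2)⁻¹, (1 + ε / 2)⁻¹, ?_, by positivity, by ring, ?_⟩
    · rw [sub_pos]; exact inv_lt_one_of_one_lt₀ (by linarith)
    · rw [smul_zero, zero_add, inv_smul_smul₀ (by positivity)]
  exact hc.openSegment_interior_self_subset_interior h0 h3 h4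

lemma continuousAt_integral_preimage (hK : IsCompact K) (hc : Convex ℝ K) (h0 : 0 ∈ interior K)
    (hL : ∀ z, Continuous fun x => L x z) {ρ : ℝ} (hρ : ∀ x, {z | L x z ∈ K} ⊆ closedBall 0 ρ)
    {E : Type*} [NormedAddCommGroup E] [NormedSpace ℝ E] {f : X → ℂ → E} {x₀ : X}
    (hm : ∀ x, MeasureTheory.AEStronglyMeasurable (f x)) {C : ℝ}
    (hC : ∀ᶠ x in nhds x₀, ∀ z ∈ closedBall (0 : ℂ) ρ, ‖f x z‖ ≤ C)
    (hf : ∀ᵐ z : ℂ, ContinuousAt (fun x => f x z) x₀) :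
    ContinuousAt (fun x => ∫ z in {z | L x z ∈ K}, f x z) x₀ := by
  have hmeas : ∀ x, MeasurableSet {z | L x z ∈ K} := fun x =>
    (hK.isClosed.preimage (L x).continuous_of_finiteDimensional).measurableSet
  simp only [← MeasureTheory.integral_indicator (hmeas _)]
  apply MeasureTheory.continuousAt_of_dominated (bound := (closedBall (0 : ℂ) ρ).indicator fun _ => C)
  · exact Filter.Eventually.of_forall fun x => (hm x).indicator (hmeas x)
  · filter_upwards [hC] with x hx
    refine Filter.Eventually.of_forall fun z => ?_
    by_cases hz : z ∈ {z | L x z ∈ K}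
    · rw [indicator_of_mem hz, indicator_of_mem (hρ x hz)]
      exact hx z (hρ x hz)
    · rw [indicator_of_notMem hz, norm_zero]
      by_cases hzρ : z ∈ closedBall (0 : ℂ) ρ
      · rw [indicator_of_mem hzρ]
        exact (norm_nonneg _).trans (hx z hzρ)
      · rw [indicator_of_notMem hzρ]
  · rw [MeasureTheory.integrable_indicator_iff isClosed_closedBall.measurableSet]
    exact MeasureTheory.integrableOn_const (isCompact_closedBall 0 ρ).measure_lt_top.ne
  · filter_upwards [ae_preimage_interior_or_notMem hc h0 (L x₀), hf] with z hz hfz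
    rcases hz with hz | hz
    · have h1 : ∀ᶠ x in nhds x₀, L x z ∈ interior K :=
        (hL z).continuousAt.eventually (isOpen_interior.mem_nhds hz)
      apply hfz.congr
      filter_upwards [h1] with x hx
      rw [indicator_of_mem]
      exact (interior_subset hx : L x z ∈ K)
    · have h1 : ∀ᶠ x in nhds x₀, L x z ∈ Kᶜ :=
        (hL z).continuousAt.eventually (hK.isClosed.isOpen_compl.mem_nhds hz)
      apply (continuousAt_const (y := (0 : E))).congr
      filter_upwards [h1] with x hx
      rw [indicator_of_notMem]
      exact hx

lemma continuous_integral_preimage (hK : IsCompact K) (hc : Convex ℝ K) (h0 : 0 ∈ interior K)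
    (hL : ∀ z, Continuous fun x => L x z)
    {ρ : ℝ} (hρ : ∀ x, {z | L x z ∈ K} ⊆ closedBall 0 ρ)
    {E : Type*} [NormedAddCommGroup E] [NormedSpace ℝ E] {g : ℂ → ℂ → E} {c : X → ℂ}
    (hg : Continuous fun p : ℂ × ℂ => g p.1 p.2) (hcc : Continuous c) :
    Continuous fun x => ∫ z in {z | L x z ∈ K}, g (c x) z := by
  rw [continuous_iff_continuousAt]
  intro x₀
  obtain ⟨C, hC⟩ := ((isCompact_closedBall (c x₀) 1).prod
    (isCompact_closedBall (0 : ℂ) ρ)).exists_bound_of_continuousOn hg.continuousOn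
  apply continuousAt_integral_preimage hK hc h0 hL hρ (C := C)
  · intro x
    exact (hg.comp (by fun_prop : Continuous fun z : ℂ => (c x, z))).aestronglyMeasurable
  · have : ∀ᶠ x in nhds x₀, c x ∈ closedBall (c x₀) 1 :=
      hcc.continuousAt.eventually (closedBall_mem_nhds _ one_pos)
    filter_upwards [this] with x hx z hz
    exact hC (c x, z) ⟨hx, hz⟩
  · refine Filter.Eventually.of_forall fun z => Continuous.continuousAt ?_
    exact hg.comp (by fun_prop : Continuous fun x => (c x, z))

lemma continuous_av_preimage (hK : IsCompact K) (hc : Convex ℝ K) (h0 : 0 ∈ interior K)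
    (hL : ∀ z, Continuous fun x => L x z) (hM : ∀ x z, ‖z‖ ≤ M * ‖L x z‖)
    {ρ : ℝ} (hρ : ∀ x, {z | L x z ∈ K} ⊆ closedBall 0 ρ)
    {E : Type*} [NormedAddCommGroup E] [NormedSpace ℝ E] {g : ℂ → ℂ → E} {c : X → ℂ}
    (hg : Continuous fun p : ℂ × ℂ => g p.1 p.2) (hcc : Continuous c) :
    Continuous fun x => av {z | L x z ∈ K} (g (c x)) := by
  unfold av
  have h1 := continuous_integral_preimage hK hc h0 hL hρ (g := fun _ _ => (1 : ℝ))
    continuous_const hcc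
  simp only [MeasureTheory.setIntegral_const, smul_eq_mul, mul_one] at h1
  apply (h1.inv₀ fun x => (body_preimage hK hc h0 (hM x)).volume_pos.ne').smul
  exact continuous_integral_preimage hK hc h0 hL hρ hg hcc

/-- The directional moment of the isotropic normalization. -/
noncomputable def isoDir (m : ℕ) (A : Set ℂ) : ℂ := ∫ z in A, dirPow m (isoMap A z)

lemma continuousAt_dirPow (m : ℕ) {z : ℂ} (hz : z ≠ 0) : ContinuousAt (dirPow m) z := by
  unfold dirPow
  apply ContinuousAt.pow
  apply continuousAt_id.div (by fun_prop)
  simpa using hz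

lemma continuous_isoDir_preimage (hK : IsCompact K) (hc : Convex ℝ K) (h0 : 0 ∈ interior K)
    (hL : ∀ z, Continuous fun x => L x z) (hM : ∀ x z, ‖z‖ ≤ M * ‖L x z‖) (m : ℕ) :
    Continuous fun x => isoDir m {z | L x z ∈ K} := by
  obtain ⟨ρ, hρ⟩ : ∃ ρ, ∀ x, {z | L x z ∈ K} ⊆ closedBall 0 ρ := by
    obtain ⟨ρ, hρ⟩ := hK.isBounded.exists_norm_le
    refine ⟨|M| * ρ, fun x z hz => ?_⟩
    rw [mem_closedBall_zero_iff]
    have := hρ _ hz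
    calc _ ≤ M * ‖L x z‖ := hM x z
      _ ≤ |M| * ‖L x z‖ := by gcongr; exact le_abs_self M
      _ ≤ |M| * ρ := by gcongr
  have hB : ∀ x, Body {z | L x z ∈ K} := fun x => body_preimage hK hc h0 (hM x)
  have hcen : Continuous fun x => centroid {z | L x z ∈ K} :=
    continuous_av_preimage hK hc h0 hL hM hρ (g := fun _ z => z) (by fun_prop)
      (continuous_const (y := (0 : ℂ)))
  have hp : Continuous fun x => pMoment {z | L x z ∈ K} :=
    continuous_av_preimage hK hc h0 hL hM hρ (g := fun c z => (z - c) ^ 2) (by fun_prop) hcen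
  have hm : Continuous fun x => mMoment {z | L x z ∈ K} :=
    continuous_av_preimage hK hc h0 hL hM hρ (g := fun c z => ‖z - c‖ ^ 2) (by fun_prop) hcen
  have hco : Continuous fun x => isoCoef {z | L x z ∈ K} := by
    unfold isoCoef
    refine (Complex.continuous_ofReal.comp ?_).mul hp
    apply continuous_const.div (by fun_prop)
    intro x
    have := (hB x).mMoment_pos
    positivity
  rw [continuous_iff_continuousAt]
  intro x₀
  apply continuousAt_integral_preimage hK hc h0 hL hρ (C := 1)
  · intro x
    exact ((measurable_dirPow m).comp (continuous_affC _ _ _).measurable).aestronglyMeasurable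
  · exact Filter.Eventually.of_forall fun x z _ => norm_dirPow_le m _
  · have : ∀ᵐ z : ℂ, z ≠ centroid {z | L x₀ z ∈ K} := by
      simp [MeasureTheory.ae_iff]
    filter_upwards [this] with z hz
    have hz0 : isoMap {z | L x₀ z ∈ K} z ≠ 0 := by
      rw [isoMap_apply]
      intro h
      have h1 := (hB x₀).norm_isoCoef_lt
      have h2 := congrArg norm (sub_eq_zero.1 h)
      rw [norm_mul, RCLike.norm_conj] at h2
      have h3 : 0 < ‖z - centroid {z | L x₀ z ∈ K}‖ := norm_pos_iff.2 (sub_ne_zero.2 hz)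
      nlinarith
    have hcont : Continuous fun x => isoMap {z | L x z ∈ K} z := by
      simp only [isoMap_apply]
      exact (continuous_const.sub hcen).sub
        (hco.mul (Complex.continuous_conj.comp (continuous_const.sub hcen)))
    exact ContinuousAt.comp (g := dirPow m) (continuousAt_dirPow m hz0) hcont.continuousAt

end Family

lemma isoDir_rotate (m : ℕ) {A : Set ℂ} (hA : MeasurableSet A) {c : ℂ} (hc : ‖c‖ = 1) :
    isoDir m (affC c 0 0 '' A) = c ^ m * isoDir m A := by
  have hne : ‖c‖ ≠ ‖(0 : ℂ)‖ := by rw [hc]; simp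
  have hcc : c * (starRingEnd ℂ) c = 1 := by rw [Complex.mul_conj', hc]; simp
  have happ : ∀ w, affC c 0 0 w = c * w := fun w => by rw [affC]; ring
  have hcen : centroid (affC c 0 0 '' A) = c * centroid A := by
    rw [centroid, av_image_affC hne hA]
    simp only [happ]
    rw [av_mul_left, centroid]
  have hp : pMoment (affC c 0 0 '' A) = c ^ 2 * pMoment A := by
    rw [pMoment, av_image_affC hne hA, hcen]
    simp only [happ, ← mul_sub, mul_pow]
    rw [av_mul_left, pMoment]
  have hm : mMoment (affC c 0 0 '' A) = mMoment A := by
    rw [mMoment, av_image_affC hne hA, hcen]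
    simp only [happ, ← mul_sub, norm_mul, hc, one_mul]
    rw [mMoment]
  have hco : isoCoef (affC c 0 0 '' A) = c ^ 2 * isoCoef A := by
    rw [isoCoef, isoCoef, hm, hp, norm_mul, norm_pow, hc]
    ring_nf
  have hiso : ∀ z, isoMap (affC c 0 0 '' A) (affC c 0 0 z) = c * isoMap A z := by
    intro z
    rw [isoMap_apply, isoMap_apply, hcen, hco, happ, ← mul_sub, map_mul]
    linear_combination (-(c * isoCoef A * (starRingEnd ℂ) (z - centroid A))) * hcc
  rw [isoDir, integral_image_affC hne hA]
  simp only [hiso, dirPow_mul]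
  rw [MeasureTheory.integral_const_mul, isoDir, dirPow, hc]
  simp

/-- A family of linear maps from the plane to three-space, parametrized by polar coordinates on a
sphere of planes. -/
noncomputable def famL (q : ℝ × ℝ) : ℂ →ₗ[ℝ] ℂ × ℝ where
  toFun z := ((q.1 * Complex.exp (q.2 * Complex.I)) ^ 2 * z -
    ((1 - q.1 : ℝ) : ℂ) ^ 2 * (starRingEnd ℂ) z,
    2 * (1 - q.1) * (q.1 * Complex.exp (q.2 * Complex.I) * z).re)
  map_add' x y := by
    ext <;> simp <;> ring
  map_smul' r x := by
    ext <;> simp <;> ring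

lemma famL_sq_norm (q : ℝ × ℝ) (z : ℂ) :
    ‖(famL q z).1‖ ^ 2 + (famL q z).2 ^ 2 = (q.1 ^ 2 + (1 - q.1) ^ 2) ^ 2 * ‖z‖ ^ 2 := by
  set a : ℂ := q.1 * Complex.exp (q.2 * Complex.I) with ha
  have hn : a.re ^ 2 + a.im ^ 2 = q.1 ^ 2 := by
    have h1 : ‖a‖ ^ 2 = q.1 ^ 2 := by
      rw [ha, norm_mul, Complex.norm_exp_ofReal_mul_I, mul_one, Complex.norm_real,
        Real.norm_eq_abs, sq_abs]
    rw [Complex.sq_norm, Complex.normSq_apply] at h1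
    linarith
  have h2 : famL q z = (a ^ 2 * z - ((1 - q.1 : ℝ) : ℂ) ^ 2 * (starRingEnd ℂ) z,
      2 * (1 - q.1) * (a * z).re) := rfl
  rw [h2, ← hn, Complex.sq_norm, Complex.sq_norm, Complex.normSq_apply, Complex.normSq_apply]
  simp [pow_two]
  ring

lemma norm_le_famL (q : ℝ × ℝ) (z : ℂ) : ‖z‖ ≤ 4 * ‖famL q z‖ := by
  have h := famL_sq_norm q z
  have h1 := norm_fst_le (famL q z)
  have h2 := norm_snd_le (famL q z)
  rw [Real.norm_eq_abs] at h2
  have h3 : (1 / 2) ^ 2 ≤ (q.1 ^ 2 + (1 - q.1) ^ 2) ^ 2 :=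
    pow_le_pow_left₀ (by norm_num) (by nlinarith [sq_nonneg (q.1 - 1 / 2)]) 2
  have h4 := pow_le_pow_left₀ (norm_nonneg _) h1 2
  have h5 := pow_le_pow_left₀ (abs_nonneg _) h2 2
  rw [sq_abs] at h5
  have h6 := mul_le_mul_of_nonneg_right h3 (sq_nonneg ‖z‖)
  apply le_of_sq_le_sq _ (by positivity)
  nlinarith

lemma exists_family_zero {V : Type*} [NormedAddCommGroup V] [NormedSpace ℝ V]
    {K : Set V} (hK : IsCompact K) (hc : Convex ℝ K) (h0 : 0 ∈ interior K)
    (J : ℂ × ℝ →ₗ[ℝ] V) (hJ : Function.Injective J) {m : ℕ} (hm : 1 ≤ m) :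
    ∃ l : ℂ →ₗ[ℝ] V, Function.Injective l ∧ Body {z | l z ∈ K} ∧
      ∫ w in isoMap {z | l z ∈ K} '' {z | l z ∈ K}, dirPow m w = 0 := by
  have hJc : Continuous J := J.continuous_of_finiteDimensional
  obtain ⟨k, hk, hanti⟩ := J.exists_antilipschitzWith (LinearMap.ker_eq_bot.2 hJ)
  have hJk : ∀ x, ‖x‖ ≤ k * ‖J x‖ := by
    intro x
    have := hanti.le_mul_dist x 0
    simpa using this
  set L : ℝ × ℝ → ℂ →ₗ[ℝ] V := fun q => J ∘ₗ famL q with hLdef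
  have hL : ∀ z, Continuous fun q => L q z := by
    intro z
    refine hJc.comp ?_
    change Continuous fun q : ℝ × ℝ => (((q.1 * Complex.exp (q.2 * Complex.I)) ^ 2 * z -
      ((1 - q.1 : ℝ) : ℂ) ^ 2 * (starRingEnd ℂ) z,
      2 * (1 - q.1) * (q.1 * Complex.exp (q.2 * Complex.I) * z).re) : ℂ × ℝ)
    fun_prop
  have hM : ∀ q z, ‖z‖ ≤ (4 * k) * ‖L q z‖ := by
    intro q z
    have h1 := norm_le_famL q z
    have h2 := hJk (famL q z)
    calc _ ≤ 4 * ‖famL q z‖ := h1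
      _ ≤ 4 * (k * ‖J (famL q z)‖) := by gcongr
      _ = _ := by rw [hLdef]; simp; ring
  have hB : ∀ q, Body {z | L q z ∈ K} := fun q => body_preimage hK hc h0 (hM q)
  obtain ⟨q, hq⟩ := exists_zero_of_winding (fun q => isoDir m {z | L q z ∈ K})
    (continuous_isoDir_preimage hK hc h0 hL hM m) (by
      intro s
      have : L (s, 2 * Real.pi) = L (s, 0) := by
        ext z
        all_goals simp [hLdef, famL]
      rw [this]) (by
      intro t
      have : L (0, t) = L (0, 0) := by
        ext z
        all_goals simp [hLdef, famL]
      rw [this]) (-2 * m) (by omega) (by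
      intro t
      have hset : {z | L (1, t) z ∈ K} =
          affC (Complex.exp ((-2 * t : ℝ) * Complex.I)) 0 0 '' {z | L (1, 0) z ∈ K} := by
        have h1 : ∀ z, L (1, t) (Complex.exp ((-2 * t : ℝ) * Complex.I) * z) = L (1, 0) z := by
          intro z
          have : Complex.exp (t * Complex.I) ^ 2 * Complex.exp ((-2 * t : ℝ) * Complex.I) = 1 := by
            rw [← Complex.exp_nat_mul, ← Complex.exp_add]
            rw [← Complex.exp_zero]; congr 1; push_cast; ring
          push_cast at this
          rw [neg_mul, neg_mul] at this
          simp only [hLdef, famL, LinearMap.comp_apply, LinearMap.coe_mk, AddHom.coe_mk]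
          congr 1
          simp [← mul_assoc, this]
        ext w
        simp only [mem_image, affC, zero_mul, add_zero]
        constructor
        · intro hw
          refine ⟨Complex.exp ((2 * t : ℝ) * Complex.I) * w, ?_, ?_⟩
          · change L (1, 0) _ ∈ K
            rw [← h1, ← mul_assoc, ← Complex.exp_add]
            push_cast
            rw [show (-2 * t * Complex.I + 2 * t * Complex.I : ℂ) = 0 by ring]
            simpa using hw
          · rw [← mul_assoc, ← Complex.exp_add]
            push_cast
            rw [show (-2 * t * Complex.I + 2 * t * Complex.I : ℂ) = 0 by ring]
            simp
        · rintro ⟨z, hz, rfl⟩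
          change L (1, t) _ ∈ K
          rw [h1]; exact hz
      rw [hset, isoDir_rotate m (hB _).compact.measurableSet
        (Complex.norm_exp_ofReal_mul_I _), ← Complex.exp_nat_mul]
      congr 2
      push_cast; ring)
  refine ⟨L q, ?_, hB q, ?_⟩
  · rw [injective_iff_map_eq_zero]
    intro z hz
    have := hM q z
    rw [hz] at this
    simpa using this
  · have hne := (hB q).norm_ne
    have : ∫ w in isoMap {z | L q z ∈ K} '' {z | L q z ∈ K}, dirPow m w = _ :=
      integral_image_affC hne (hB q).compact.measurableSet (dirPow m)
    rw [this]
    have h2 : isoDir m {z | L q z ∈ K} = 0 := hq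
    rw [isoDir] at h2
    rw [isoMap] at h2
    rw [h2, smul_zero]

/-- A compact set with `0` in its interior contains a basis with respect to which all
its points have coordinates of absolute value at most one. -/
lemma exists_basis_mem_abs_repr_le {E : Type*} [NormedAddCommGroup E] [NormedSpace ℝ E]
    [FiniteDimensional ℝ E] {d : ℕ} (hd : Module.finrank ℝ E = d) {K : Set E} (hK : IsCompact K)
    (h0 : 0 ∈ interior K) :
    ∃ b : Module.Basis (Fin d) ℝ E, (∀ i, b i ∈ K) ∧ ∀ x ∈ K, ∀ i, |b.repr x i| ≤ 1 := by
  let e := Module.finBasisOfFinrankEq ℝ E hd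
  have hcont : Continuous fun v : Fin d → E => e.det v := by
    simp only [Module.Basis.det_apply]
    apply Continuous.matrix_det
    refine continuous_matrix fun i j => ?_
    simp only [Module.Basis.toMatrix_apply]
    have : Continuous (e.coord i) := (e.coord i).continuous_of_finiteDimensional
    exact this.comp (continuous_apply j)
  obtain ⟨v, hv, hmax⟩ := (isCompact_univ_pi fun _ : Fin d => hK).exists_isMaxOn
    ⟨fun _ => 0, fun _ _ => interior_subset h0⟩ (f := fun v => |e.det v|)
    hcont.abs.continuousOn
  have hpos : 0 < |e.det v| := by
    have h1 : ∀ i, ∀ᶠ t : ℝ in nhds 0, t • e i ∈ K := by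
      intro i
      have : Filter.Tendsto (fun t : ℝ => t • e i) (nhds 0) (nhds 0) := by
        have : Continuous fun t : ℝ => t • e i := by fun_prop
        simpa using this.tendsto 0
      exact this.eventually (mem_interior_iff_mem_nhds.1 h0)
    obtain ⟨ε, hε, hball⟩ := Metric.eventually_nhds_iff.1 (Filter.eventually_all.2 h1)
    have h2 := hball (y := ε / 2) (by simp [abs_of_pos hε, hε])
    have h3 : |e.det fun i => (ε / 2) • e i| ≤ |e.det v| := hmax fun i _ => h2 i
    refine lt_of_lt_of_le ?_ h3
    have h4 := e.det.toMultilinearMap.map_smul_univ (fun _ => ε / 2) e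
    have h5 : (e.det fun i => (ε / 2) • e i) = (∏ _i : Fin d, ε / 2) • e.det e := h4
    rw [h5, e.det_self]
    simp [hε.ne']
  have hunit : IsUnit (e.det v) := isUnit_iff_ne_zero.2 (abs_pos.1 hpos)
  obtain ⟨hli, hsp⟩ := (Module.Basis.is_basis_iff_det e).2 hunit
  refine ⟨Module.Basis.mk hli hsp.ge, fun i => ?_, fun x hx i => ?_⟩
  · rw [Module.Basis.mk_apply]; exact hv i (mem_univ i)
  · have h1 := congrArg (fun f => f x) (e.det_smul_mk_coord_eq_det_update hli hsp.ge i)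
    have h2 : e.det v * (Module.Basis.mk hli hsp.ge).repr x i = e.det (Function.update v i x) := h1
    have h3 : |e.det (Function.update v i x)| ≤ |e.det v| := by
      apply hmax
      intro j _
      by_cases hj : j = i
      · subst hj; simpa using hx
      · rw [Function.update_of_ne hj]; exact hv j (mem_univ j)
    rw [← h2, abs_mul] at h3
    exact le_of_mul_le_mul_left (by linarith) hpos

lemma NearConic.comp_linear {ε : ℝ} {S : ℝ → ℝ → Prop} (h : NearConic ε S) (p q r u : ℝ)
    (hsurj : ∀ s t, ∃ s' t', p * s' + q * t' = s ∧ r * s' + u * t' = t) :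
    NearConic ε fun s t => S (p * s + q * t) (r * s + u * t) := by
  obtain ⟨F, ⟨a, b, c, d, e, g, hF⟩, h1, ⟨s, t, hst⟩, h3, h4⟩ := h
  refine ⟨fun s t => F (p * s + q * t) (r * s + u * t), ?_, fun _ _ => h1 _ _, ?_,
    fun _ _ => h3 _ _, fun _ _ => h4 _ _⟩
  · refine ⟨a * p ^ 2 + b * (p * r) + c * r ^ 2, 2 * a * p * q + b * (p * u + q * r) + 2 * c * r * u,
      a * q ^ 2 + b * (q * u) + c * u ^ 2, d * p + e * r, d * q + e * u, g, fun s t => ?_⟩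
    simp only [hF]; ring
  · obtain ⟨s', t', hs, ht⟩ := hsurj s t
    exact ⟨s', t', by simp only [hs, ht, hst]⟩

lemma dBMlt_preimage_of_submodule {V : Type*} [AddCommGroup V] [Module ℝ V] {K : Set V} {lam : ℝ}
    (H : ∀ E F : Submodule ℝ V, Module.finrank ℝ E = 2 → Module.finrank ℝ F = 2 →
      dBMlt (Subtype.val ⁻¹' K : Set E) (Subtype.val ⁻¹' K : Set F) lam)
    {l l' : ℂ →ₗ[ℝ] V} (hl : Function.Injective l) (hl' : Function.Injective l') :
    dBMlt {z | l z ∈ K} {z | l' z ∈ K} lam := by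
  have key : ∀ {l : ℂ →ₗ[ℝ] V} (hl : Function.Injective l),
      (LinearEquiv.ofInjective l hl).symm.toAffineEquiv '' (Subtype.val ⁻¹' K) = {z | l z ∈ K} := by
    intro l hl
    ext z
    constructor
    · rintro ⟨w, hw, rfl⟩
      obtain ⟨y, rfl⟩ := (LinearEquiv.ofInjective l hl).surjective w
      simpa using hw
    · intro hz
      exact ⟨LinearEquiv.ofInjective l hl z, hz, by simp⟩
  have h := dBMlt_image (H (LinearMap.range l) (LinearMap.range l')
    (by rw [LinearMap.finrank_range_of_inj hl, Complex.finrank_real_complex])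
    (by rw [LinearMap.finrank_range_of_inj hl', Complex.finrank_real_complex]))
    (LinearEquiv.ofInjective l hl).symm.toAffineEquiv
    (LinearEquiv.ofInjective l' hl').symm.toAffineEquiv
  rwa [key hl, key hl'] at h

lemma closedBall_subset_of_triangle {A : Set ℂ} (hA : Convex ℝ A) (h0 : 0 ∈ A) (h1 : 1 ∈ A)
    (hI : Complex.I ∈ A) : closedBall (⟨1 / 4, 1 / 4⟩ : ℂ) (1 / 4) ⊆ A := by
  intro z hz
  rw [mem_closedBall, dist_eq_norm] at hz
  have h2 : (z.re - 1 / 4) ^ 2 + (z.im - 1 / 4) ^ 2 ≤ (1 / 4) ^ 2 := by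
    have := pow_le_pow_left₀ (norm_nonneg _) hz 2
    rw [Complex.sq_norm, Complex.normSq_apply] at this
    simp only [Complex.sub_re, Complex.sub_im] at this
    linarith
  have hre : 0 ≤ z.re := by nlinarith [sq_nonneg (z.im - 1 / 4)]
  have him : 0 ≤ z.im := by nlinarith [sq_nonneg (z.re - 1 / 4)]
  have hsum : z.re + z.im ≤ 1 := by nlinarith [sq_nonneg (z.re - z.im)]
  have hz' : z = (1 - z.re - z.im) • (0 : ℂ) + z.re • (1 : ℂ) + z.im • Complex.I := by simp
  have h3 := hA.sum_mem (t := (Finset.univ : Finset (Fin 3)))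
    (w := ![1 - z.re - z.im, z.re, z.im]) (z := ![(0 : ℂ), 1, Complex.I])
    (by intro i _; fin_cases i <;> simp <;> linarith) (by simp [Fin.sum_univ_three]; ring)
    (by intro i _; fin_cases i <;> simpa)
  rw [Fin.sum_univ_three] at h3
  rw [hz']
  exact h3

lemma exists_sections_nearConic : ∃ C δ₀ : ℝ, 0 < C ∧ 0 < δ₀ ∧ ∀ {V : Type} [NormedAddCommGroup V]
    [NormedSpace ℝ V] [FiniteDimensional ℝ V] (K : Set V) (δ : ℝ), 3 ≤ Module.finrank ℝ V →
    IsCompact K → Convex ℝ K → 0 ∈ interior K → 0 < δ → δ ≤ δ₀ →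
    (∀ E F : Submodule ℝ V, Module.finrank ℝ E = 2 → Module.finrank ℝ F = 2 →
      dBMlt (Subtype.val ⁻¹' K : Set E) (Subtype.val ⁻¹' K : Set F) (1 + δ)) →
    ∀ x y : V, LinearIndependent ℝ ![x, y] → NearConic (C * √δ) (fun s t => s • x + t • y ∈ K) := by
  obtain ⟨C, δ₀, hC, hδ₀, hconic⟩ := exists_nearConic_const
  refine ⟨C, δ₀, hC, hδ₀, ?_⟩
  intro V _ _ _ K δ hV hK hc h0 hδ hδ0 H x y hxy
  have hsec : ∀ {l : ℂ →ₗ[ℝ] V}, Function.Injective l → Body {z | l z ∈ K} := by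
    intro l hl
    obtain ⟨k, hk, hanti⟩ := l.exists_antilipschitzWith (LinearMap.ker_eq_bot.2 hl)
    exact body_preimage hK hc h0 (M := k) fun z => by simpa using hanti.le_mul_dist z 0
  let l : ℂ →ₗ[ℝ] V := Complex.basisOneI.constr ℝ ![x, y]
  have hl : Function.Injective l := Complex.basisOneI.injective_constr_of_linearIndependent hxy
  have hlv : ∀ z, l z = z.re • x + z.im • y := by
    intro z
    simp [l, Module.Basis.constr_apply_fintype, Fin.sum_univ_two]
  have hA0 := hsec hl
  have h0A0 : (0 : ℂ) ∈ interior {z | l z ∈ K} := by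
    have : IsOpen (l ⁻¹' interior K) := isOpen_interior.preimage l.continuous_of_finiteDimensional
    exact interior_maximal (preimage_mono interior_subset) this (by simpa using h0)
  obtain ⟨b, hb1, hb2⟩ := exists_basis_mem_abs_repr_le Complex.finrank_real_complex hA0.compact h0A0
  let T : ℂ →ₗ[ℝ] ℂ := Complex.basisOneI.constr ℝ b
  have hT : Function.Injective T :=
    Complex.basisOneI.injective_constr_of_linearIndependent b.linearIndependent
  have hTv : ∀ z, T z = z.re • b 0 + z.im • b 1 := by
    intro z
    simp [T, Module.Basis.constr_apply_fintype, Fin.sum_univ_two]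
  have hrepr : ∀ z : ℂ, T ⟨b.repr z 0, b.repr z 1⟩ = z := by
    intro z
    rw [hTv]
    conv_rhs => rw [← b.sum_repr z, Fin.sum_univ_two]
  have hlT : Function.Injective (l ∘ₗ T) := hl.comp hT
  have hA := hsec hlT
  have hsq : {z | (l ∘ₗ T) z ∈ K} ⊆ closedBall 0 2 := by
    intro z hz
    have h1 := hb2 (T z) hz
    have h2 : ∀ i, b.repr (T z) i = ![z.re, z.im] i := by
      intro i
      rw [hTv, map_add, map_smul, map_smul, b.repr_self, b.repr_self]
      fin_cases i <;> simp
    have h3 := h1 0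
    have h4 := h1 1
    rw [h2] at h3 h4
    rw [mem_closedBall_zero_iff]
    have := Complex.norm_le_abs_re_add_abs_im z
    simp at h3 h4
    linarith
  have htri := closedBall_subset_of_triangle hA.convex (by simpa using interior_subset h0)
    (by
      have := hb1 0
      simpa [hTv] using this)
    (by
      have := hb1 1
      simpa [hTv] using this)
  have hN := hconic _ _ δ hA htri hsq hδ hδ0 (by
    intro m hm
    obtain ⟨J, hJ⟩ := (finrank_le_iff_exists_linearMap (R := ℝ) (M := ℂ × ℝ) (M' := V)).1 (
      by simpa using hV)
    obtain ⟨l', hl', hB, hzero⟩ := exists_family_zero hK hc h0 J hJ hm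
    refine ⟨_, hB.image_affC hB.norm_ne, hB.isotropic_isoMap, hzero, ?_⟩
    obtain ⟨S, hS⟩ := exists_affineEquiv_affC _ hB.norm_ne
    have h1 := dBMlt_image (dBMlt_preimage_of_submodule H hlT hl') (AffineEquiv.refl ℝ ℂ) S
    rw [hS] at h1
    simpa using h1)
  have hfin := hN.comp_linear (b.repr 1 0) (b.repr Complex.I 0) (b.repr 1 1) (b.repr Complex.I 1) (by
    intro s t
    refine ⟨(T ⟨s, t⟩).re, (T ⟨s, t⟩).im, ?_⟩
    have h1 : T ⟨s, t⟩ = (T ⟨s, t⟩).re • (1 : ℂ) + (T ⟨s, t⟩).im • Complex.I := by simp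
    have h2 : ∀ i, b.repr (T ⟨s, t⟩) i = ![s, t] i := by
      intro i
      rw [hTv, map_add, map_smul, map_smul, b.repr_self, b.repr_self]
      fin_cases i <;> simp
    have h3 : ∀ i, (T ⟨s, t⟩).re * b.repr 1 i + (T ⟨s, t⟩).im * b.repr Complex.I i = ![s, t] i := by
      intro i
      rw [← h2]
      conv_rhs => rw [h1]
      rw [map_add, map_smul, map_smul]
      simp
    have h4 := h3 0
    have h5 := h3 1
    simp at h4 h5
    constructor <;> linarith)
  have hset : (fun s t : ℝ => s • x + t • y ∈ K) = fun s t : ℝ =>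
      (⟨b.repr 1 0 * s + b.repr Complex.I 0 * t, b.repr 1 1 * s + b.repr Complex.I 1 * t⟩ : ℂ) ∈
        {z | (l ∘ₗ T) z ∈ K} := by
    funext s t
    have h1 : T ⟨b.repr 1 0 * s + b.repr Complex.I 0 * t,
        b.repr 1 1 * s + b.repr Complex.I 1 * t⟩ = ⟨s, t⟩ := by
      rw [← hrepr ⟨s, t⟩]
      have : (⟨s, t⟩ : ℂ) = s • (1 : ℂ) + t • Complex.I := by
        apply Complex.ext <;> simp
      congr 1
      rw [this, map_add, map_smul, map_smul]
      apply Complex.ext <;> simp <;> ring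
    rw [Set.mem_ofPred_eq, LinearMap.comp_apply, h1, hlv]
  rw [hset]
  exact hfin

section Polarize

variable {E : Type*} [AddCommGroup E] [Module ℝ E]

/-- The polarization of the square of a seminorm. -/
noncomputable def polarize (P : Seminorm ℝ E) (x z : E) : ℝ :=
  (P (x + z) ^ 2 - P (x - z) ^ 2) / 4

lemma polarize_comm (P : Seminorm ℝ E) (x z : E) : polarize P x z = polarize P z x := by
  rw [polarize, polarize, add_comm, map_sub_rev]

lemma polarize_neg_left (P : Seminorm ℝ E) (x z : E) : polarize P (-x) z = -polarize P x z := by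
  have h1 : P (-x + z) = P (x - z) := by rw [← map_neg_eq_map]; congr 1; abel
  have h2 : P (-x - z) = P (x + z) := by rw [← map_neg_eq_map]; congr 1; abel
  rw [polarize, polarize, h1, h2]
  ring

lemma polarize_self (P : Seminorm ℝ E) (x : E) : polarize P x x = P x ^ 2 := by
  have h : P (x + x) = 2 * P x := by rw [← two_smul ℝ x, map_smul_eq_mul]; simp
  rw [polarize, h]
  simp
  ring

lemma polarize_zero_left (P : Seminorm ℝ E) (z : E) : polarize P 0 z = 0 := by
  simp [polarize]

lemma abs_polarize_le (P : Seminorm ℝ E) {x z : E} {R : ℝ} (hx : P x ≤ R) (hz : P z ≤ R) :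
    |polarize P x z| ≤ R ^ 2 := by
  have h1 := pow_le_pow_left₀ (apply_nonneg P _) ((map_add_le_add P x z).trans (add_le_add hx hz)) 2
  have h2 := pow_le_pow_left₀ (apply_nonneg P _) ((map_sub_le_add P x z).trans (add_le_add hx hz)) 2
  rw [polarize, abs_le]
  constructor <;> nlinarith [sq_nonneg (P (x + z)), sq_nonneg (P (x - z))]

lemma abs_polarize_add_sub_le {P : Seminorm ℝ E} {η : ℝ} (hη : 0 ≤ η)
    (h : ∀ x z, |P (x + z) ^ 2 + P (x - z) ^ 2 - 2 * P x ^ 2 - 2 * P z ^ 2| ≤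
      η * (P x ^ 2 + P z ^ 2)) {x y z : E} {R : ℝ} (hx : P x ≤ R) (hy : P y ≤ R) (hz : P z ≤ R) :
    |polarize P (x + y) z - polarize P x z - polarize P y z| ≤ 5 / 2 * η * R ^ 2 := by
  have hbd : ∀ {v w : E}, P v ≤ 2 * R → P w ≤ R →
      |P (v + w) ^ 2 + P (v - w) ^ 2 - 2 * P v ^ 2 - 2 * P w ^ 2| ≤ η * (5 * R ^ 2) := by
    intro v w hv hw
    refine (h v w).trans (mul_le_mul_of_nonneg_left ?_ hη)
    have h1 := pow_le_pow_left₀ (apply_nonneg P _) hv 2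
    have h2 := pow_le_pow_left₀ (apply_nonneg P _) hw 2
    linarith
  have key : ∀ {x y : E}, P x ≤ R → P y ≤ R →
      |4 * polarize P (x + y) z + 4 * polarize P (x - y) z - 8 * polarize P x z| ≤
        2 * (η * (5 * R ^ 2)) := by
    intro x y hx hy
    have h1 := hbd (v := x + z) (by linarith [map_add_le_add P x z]) hy
    have h2 := hbd (v := x - z) (by linarith [map_sub_le_add P x z]) hy
    have e1 : x + z + y = x + y + z := by abel
    have e2 : x + z - y = x - y + z := by abel
    have e3 : x - z + y = x + y - z := by abel
    have e4 : x - z - y = x - y - z := by abel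
    rw [e1, e2] at h1
    rw [e3, e4] at h2
    rw [abs_le] at *
    simp only [polarize]
    constructor <;> linarith
  have h1 := key hx hy
  have h2 := key hy hx
  rw [← neg_sub x y, polarize_neg_left, add_comm y x] at h2
  rw [abs_le] at *
  constructor <;> linarith

lemma abs_polarize_smul_sub_le {P : Seminorm ℝ E} {η : ℝ} (hη : 0 ≤ η)
    (h : ∀ x z, |P (x + z) ^ 2 + P (x - z) ^ 2 - 2 * P x ^ 2 - 2 * P z ^ 2| ≤
      η * (P x ^ 2 + P z ^ 2)) {x z : E} {R u : ℝ} (hx : P x ≤ R) (hz : P z ≤ R) (hu : |u| ≤ 1) :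
    |polarize P (u • x) z - u * polarize P x z| ≤ 15 / 2 * η * R ^ 2 := by
  have hle : ∀ {u : ℝ}, |u| ≤ 1 → P (u • x) ≤ R := by
    intro u hu
    rw [map_smul_eq_mul, Real.norm_eq_abs]
    nlinarith [apply_nonneg P x, abs_nonneg u]
  have hiter : ∀ k : ℕ, ∀ u : ℝ, 0 ≤ u → u ≤ 1 →
      |polarize P (u • x) z - u * polarize P x z| ≤ 2 * R ^ 2 / 2 ^ k + 15 / 2 * η * R ^ 2 := by
    intro k
    induction k with
    | zero =>
      intro u hu0 hu1
      have h1 := abs_polarize_le P (hle (u := u) (by rwa [abs_of_nonneg hu0])) hz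
      have h2 := abs_polarize_le P hx hz
      have h3 : |u * polarize P x z| ≤ R ^ 2 := by
        rw [abs_mul, abs_of_nonneg hu0]
        nlinarith [abs_nonneg (polarize P x z)]
      have h4 := abs_sub (polarize P (u • x) z) (u * polarize P x z)
      have h5 : 0 ≤ 15 / 2 * η * R ^ 2 := by positivity
      simp only [pow_zero, div_one]
      linarith
    | succ k ih =>
      have half : ∀ u : ℝ, 0 ≤ u → u ≤ 1 / 2 → |polarize P (u • x) z - u * polarize P x z| ≤
          R ^ 2 / 2 ^ k + 5 * η * R ^ 2 := by
        intro u hu0 hu1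
        have h1 := ih (2 * u) (by linarith) (by linarith)
        have hux := hle (u := u) (by rw [abs_of_nonneg hu0]; linarith)
        have h2 := abs_polarize_add_sub_le hη h hux hux hz
        rw [← two_smul ℝ (u • x), smul_smul] at h2
        have h3 : 2 * R ^ 2 / 2 ^ k = 2 * (R ^ 2 / 2 ^ k) := by ring
        rw [h3] at h1
        rw [abs_le] at *
        constructor <;> linarith
      intro u hu0 hu1
      have h3 : 2 * R ^ 2 / 2 ^ (k + 1) = R ^ 2 / 2 ^ k := by field_simp; ring
      rw [h3]
      rcases le_total u (1 / 2) with hu | hu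
      · refine (half u hu0 hu).trans ?_
        have : 0 ≤ η * R ^ 2 := by positivity
        linarith
      · have h1 := half (1 - u) (by linarith) (by linarith)
        have h2 := abs_polarize_add_sub_le hη h (hle (u := u) (by rwa [abs_of_nonneg hu0]))
          (hle (u := 1 - u) (by rw [abs_of_nonneg] <;> linarith)) hz
        rw [← add_smul, add_sub_cancel, one_smul] at h2
        rw [abs_le] at *
        constructor <;> linarith
  have hlim : ∀ u : ℝ, 0 ≤ u → u ≤ 1 →
      |polarize P (u • x) z - u * polarize P x z| ≤ 15 / 2 * η * R ^ 2 := by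
    intro u hu0 hu1
    have ht : Filter.Tendsto (fun k : ℕ => 2 * R ^ 2 / 2 ^ k + 15 / 2 * η * R ^ 2) Filter.atTop
        (nhds (0 + 15 / 2 * η * R ^ 2)) := by
      refine Filter.Tendsto.add_const _ ?_
      have := (tendsto_pow_atTop_nhds_zero_of_lt_one (r := (1 / 2 : ℝ)) (by norm_num)
        (by norm_num)).const_mul (2 * R ^ 2)
      rw [mul_zero] at this
      refine this.congr fun k => ?_
      rw [one_div, inv_pow, div_eq_mul_inv]
    rw [zero_add] at ht
    exact ge_of_tendsto' ht fun k => hiter k u hu0 hu1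
  rcases le_total 0 u with hu0 | hu0
  · exact hlim u hu0 (by rwa [abs_of_nonneg hu0] at hu)
  · have h1 := hlim (-u) (by linarith) (by rwa [abs_of_nonpos hu0] at hu)
    rw [neg_smul, polarize_neg_left] at h1
    rw [abs_le] at *
    constructor <;> linarith

lemma abs_polarize_sum_sub_le {P : Seminorm ℝ E} {η : ℝ} (hη : 0 ≤ η)
    (h : ∀ x z, |P (x + z) ^ 2 + P (x - z) ^ 2 - 2 * P x ^ 2 - 2 * P z ^ 2| ≤
      η * (P x ^ 2 + P z ^ 2)) {ι : Type*} [Fintype ι] {b : ι → E} (hb : ∀ i, P (b i) ≤ 2)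
    {c : ι → ℝ} (hc : ∀ i, |c i| ≤ 1) {z : E} {R : ℝ} (hR : 2 * (Fintype.card ι : ℝ) + 2 ≤ R)
    (hz : P z ≤ R) :
    |polarize P (∑ i, c i • b i) z - ∑ i, c i * polarize P (b i) z| ≤
      Fintype.card ι * (10 * η * R ^ 2) := by
  classical
  have hcb : ∀ i, P (c i • b i) ≤ 2 := by
    intro i
    rw [map_smul_eq_mul, Real.norm_eq_abs]
    nlinarith [hc i, hb i, abs_nonneg (c i), apply_nonneg P (b i)]
  have hcard : (0 : ℝ) ≤ Fintype.card ι := Nat.cast_nonneg _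
  have key : ∀ s : Finset ι, P (∑ i ∈ s, c i • b i) ≤ 2 * s.card ∧
      |polarize P (∑ i ∈ s, c i • b i) z - ∑ i ∈ s, c i * polarize P (b i) z| ≤
      s.card * (10 * η * R ^ 2) := by
    intro s
    induction s using Finset.induction_on with
    | empty => simp [polarize_zero_left]
    | insert i s hi ih =>
      have hs : (s.card : ℝ) ≤ Fintype.card ι := by exact_mod_cast s.card_le_univ
      rw [Finset.sum_insert hi, Finset.sum_insert hi, Finset.card_insert_of_notMem hi]
      push_cast
      refine ⟨(map_add_le_add P _ _).trans (by linarith [hcb i, ih.1]), ?_⟩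
      have h1 := abs_polarize_add_sub_le hη h (x := c i • b i) (y := ∑ i ∈ s, c i • b i) (z := z)
        (R := R) (by linarith [hcb i]) (by linarith [ih.1]) hz
      have h2 := abs_polarize_smul_sub_le hη h (x := b i) (z := z) (R := R)
        (by linarith [hb i]) hz (hc i)
      have h3 := ih.2
      rw [abs_le] at *
      constructor <;> linarith
  exact (key Finset.univ).2

/-- A norm satisfying the parallelogram law approximately is close to a Euclidean one. -/
lemma exists_quadraticForm_of_parallelogram {P : Seminorm ℝ E} {η : ℝ} (hη : 0 ≤ η)
    (h : ∀ x z, |P (x + z) ^ 2 + P (x - z) ^ 2 - 2 * P x ^ 2 - 2 * P z ^ 2| ≤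
      η * (P x ^ 2 + P z ^ 2)) {d : ℕ} (hd : 1 ≤ d) (b : Module.Basis (Fin d) ℝ E)
    (hb : ∀ i, P (b i) ≤ 2) (hb' : ∀ x i, |b.repr x i| ≤ 2 * P x) :
    ∃ q : QuadraticForm ℝ E, ∀ x, |P x ^ 2 - q x| ≤ 1280 * d ^ 4 * η * P x ^ 2 := by
  let M : Matrix (Fin d) (Fin d) ℝ := fun i j => polarize P (b i) (b j)
  let q : QuadraticForm ℝ E := (Matrix.toBilin b M).toQuadraticMap
  have hq : ∀ x, q x = ∑ i, b.repr x i * ∑ j, b.repr x j * polarize P (b j) (b i) := by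
    intro x
    rw [LinearMap.BilinMap.toQuadraticMap_apply, Matrix.toBilin_apply]
    refine Finset.sum_congr rfl fun i _ => ?_
    rw [Finset.mul_sum]
    refine Finset.sum_congr rfl fun j _ => ?_
    rw [polarize_comm P (b j)]
    simp only [M]
    ring
  have hd1 : (1 : ℝ) ≤ d := by exact_mod_cast hd
  have hhalf : ∀ x, P x ≤ 1 / 2 → |P x ^ 2 - q x| ≤ 320 * d ^ 4 * η := by
    intro x hx
    have hc : ∀ i, |b.repr x i| ≤ 1 := fun i => (hb' x i).trans (by linarith)
    have hR : 2 * (Fintype.card (Fin d) : ℝ) + 2 ≤ 4 * d := by simp; linarith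
    have h1 := abs_polarize_sum_sub_le hη h hb hc hR (z := x) (by linarith)
    rw [b.sum_repr, polarize_self, Fintype.card_fin] at h1
    have h2 : ∀ i, |polarize P (b i) x - ∑ j, b.repr x j * polarize P (b j) (b i)| ≤
        d * (10 * η * (4 * d) ^ 2) := by
      intro i
      have := abs_polarize_sum_sub_le hη h hb hc hR (z := b i) (by linarith [hb i])
      rwa [b.sum_repr, polarize_comm P x, Fintype.card_fin] at this
    have h3 : |∑ i, b.repr x i * polarize P (b i) x - q x| ≤ d * (d * (10 * η * (4 * d) ^ 2)) := by
      rw [hq, ← Finset.sum_sub_distrib]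
      refine (Finset.abs_sum_le_sum_abs _ _).trans ?_
      refine (Finset.sum_le_card_nsmul _ _ (d * (10 * η * (4 * d) ^ 2)) fun i _ => ?_).trans
        (by simp)
      rw [← mul_sub, abs_mul]
      refine (mul_le_of_le_one_left (abs_nonneg _) (hc i)).trans (h2 i)
    have h4 := abs_sub_le (P x ^ 2) (∑ i, b.repr x i * polarize P (b i) x) (q x)
    have h5 : (d : ℝ) ^ 3 * η ≤ d ^ 4 * η := by
      refine mul_le_mul_of_nonneg_right ?_ hη
      exact pow_le_pow_right₀ hd1 (by norm_num)
    nlinarith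
  refine ⟨q, fun x => ?_⟩
  rcases (apply_nonneg P x).eq_or_lt with hx | hx
  · have : x = 0 := by
      refine b.repr.map_eq_zero_iff.1 (Finsupp.ext fun i => ?_)
      have := hb' x i
      rw [← hx, mul_zero] at this
      simpa using abs_nonpos_iff.1 this
    simp [this]
  · have hpos : 0 < (2 * P x)⁻¹ := by positivity
    have h1 := hhalf ((2 * P x)⁻¹ • x) (by
      rw [map_smul_eq_mul, Real.norm_eq_abs, abs_of_pos hpos]
      apply le_of_eq; field_simp)
    rw [map_smul_eq_mul, Real.norm_eq_abs, abs_of_pos hpos, QuadraticMap.map_smul,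
      smul_eq_mul] at h1
    have h2 : ((2 * P x)⁻¹ * P x) ^ 2 - (2 * P x)⁻¹ * (2 * P x)⁻¹ * q x =
        (P x ^ 2 - q x) / (4 * P x ^ 2) := by field_simp; ring
    rw [h2, abs_div, abs_of_pos (show 0 < 4 * P x ^ 2 by positivity),
      div_le_iff₀ (by positivity)] at h1
    linarith

end Polarize

section Parallelogram

variable {E : Type*} [AddCommGroup E] [Module ℝ E]

/-- If the square of a seminorm is close to a quadratic polynomial along all lines `y + u • k`
with `y` and `k` in the unit sphere, then the parallelogram law holds approximately. -/
lemma parallelogram_of_quadratic_lines {P : Seminorm ℝ E} {η : ℝ}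
    (hQ : ∀ y k, P y = 1 → P k = 1 → ∃ b c : ℝ, ∀ u : ℝ, |u| ≤ 2 →
      |P (y + u • k) ^ 2 - 1 - b * u - c * u ^ 2| ≤ η) (x z : E) :
    |P (x + z) ^ 2 + P (x - z) ^ 2 - 2 * P x ^ 2 - 2 * P z ^ 2| ≤
      7 * η * (P x ^ 2 + P z ^ 2) := by
  have hunit : ∀ y k, P y = 1 → P k = 1 → ∀ u : ℝ, |u| ≤ 1 →
      |P (y + u • k) ^ 2 + P (y - u • k) ^ 2 - 2 - 2 * u ^ 2| ≤ 7 * η := by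
    intro y k hy hk
    have hsum : ∀ y k, P y = 1 → P k = 1 → ∃ c : ℝ, ∀ u : ℝ, |u| ≤ 2 →
        |P (y + u • k) ^ 2 + P (y - u • k) ^ 2 - 2 - 2 * c * u ^ 2| ≤ 2 * η := by
      intro y k hy hk
      obtain ⟨b, c, h⟩ := hQ y k hy hk
      refine ⟨c, fun u hu => ?_⟩
      have h1 := h u hu
      have h2 := h (-u) (by rwa [abs_neg])
      rw [neg_smul, ← sub_eq_add_neg] at h2
      rw [abs_le] at *
      constructor <;> linarith
    obtain ⟨c, hc⟩ := hsum y k hy hk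
    obtain ⟨c', hc'⟩ := hsum k y hk hy
    have h1 := hc 1 (by norm_num)
    have h2 := hc' 1 (by norm_num)
    have h3 := hc 2 (by norm_num)
    have h4 := hc' (1 / 2) (by rw [abs_of_pos] <;> norm_num)
    have e1 : P (k + (1 : ℝ) • y) = P (y + (1 : ℝ) • k) := by rw [one_smul, one_smul, add_comm]
    have e2 : P (k - (1 : ℝ) • y) = P (y - (1 : ℝ) • k) := by rw [one_smul, one_smul, map_sub_rev]
    have e3 : P (y + (2 : ℝ) • k) = 2 * P (k + (1 / 2 : ℝ) • y) := by
      have : y + (2 : ℝ) • k = (2 : ℝ) • (k + (1 / 2 : ℝ) • y) := by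
        rw [smul_add, smul_smul]; norm_num [add_comm]
      rw [this, map_smul_eq_mul]
      simp
    have e4 : P (y - (2 : ℝ) • k) = 2 * P (k - (1 / 2 : ℝ) • y) := by
      have : y - (2 : ℝ) • k = (-2 : ℝ) • (k - (1 / 2 : ℝ) • y) := by
        rw [smul_sub, smul_smul]; norm_num
        abel
      rw [this, map_smul_eq_mul]
      simp
    rw [e1, e2] at h2
    rw [e3, e4] at h3
    have hη : 0 ≤ η := by have := (abs_nonneg _).trans h1; linarith
    intro u hu
    have h5 := hc u (hu.trans (by norm_num))
    have hu2 : u ^ 2 ≤ 1 := by rwa [sq_le_one_iff_abs_le_one]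
    have hcl : |c - 1| ≤ 7 / 3 * η := by
      rw [abs_le] at *
      constructor <;> linarith
    have h6 : |(c - 1) * u ^ 2| ≤ 7 / 3 * η := by
      rw [abs_mul, abs_of_nonneg (sq_nonneg u)]
      nlinarith [abs_nonneg (c - 1), sq_nonneg u]
    rw [abs_le] at *
    constructor <;> linarith
  have hle : ∀ x z, P z ≤ P x → |P (x + z) ^ 2 + P (x - z) ^ 2 - 2 * P x ^ 2 - 2 * P z ^ 2| ≤
      7 * η * P x ^ 2 := by
    intro x z hzx
    rcases (apply_nonneg P z).eq_or_lt with hz | hz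
    · have h1 : P (x + z) = P x := by
        apply le_antisymm
        · linarith [map_add_le_add P x z]
        · have := map_sub_le_add P (x + z) z
          rw [add_sub_cancel_right] at this
          linarith
      have h2 : P (x - z) = P x := by
        apply le_antisymm
        · linarith [map_sub_le_add P x z]
        · have := map_add_le_add P (x - z) z
          rw [sub_add_cancel] at this
          linarith
      rw [h1, h2, ← hz]
      rcases (apply_nonneg P x).eq_or_lt with hx | hx
      · simp [← hx]
      · have hx1 : P ((P x)⁻¹ • x) = 1 := by
          rw [map_smul_eq_mul, Real.norm_eq_abs, abs_of_pos (inv_pos.2 hx), inv_mul_cancel₀ hx.ne']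
        have hη : 0 ≤ 7 * η := (abs_nonneg _).trans (hunit _ _ hx1 hx1 0 (by norm_num))
        have : P x ^ 2 + P x ^ 2 - 2 * P x ^ 2 - 2 * 0 ^ 2 = 0 := by ring
        rw [this, abs_zero]
        positivity
    · have hx : 0 < P x := hz.trans_le hzx
      have hx1 : P ((P x)⁻¹ • x) = 1 := by
        rw [map_smul_eq_mul, Real.norm_eq_abs, abs_of_pos (inv_pos.2 hx), inv_mul_cancel₀ hx.ne']
      have hz1 : P ((P z)⁻¹ • z) = 1 := by
        rw [map_smul_eq_mul, Real.norm_eq_abs, abs_of_pos (inv_pos.2 hz), inv_mul_cancel₀ hz.ne']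
      have h1 := hunit _ _ hx1 hz1 (P z / P x) (by
        rw [abs_of_pos (by positivity)]
        exact (div_le_one hx).2 hzx)
      have e : (P z / P x) • (P z)⁻¹ • z = (P x)⁻¹ • z := by
        rw [smul_smul]
        congr 1
        field_simp
      have hpos : 0 < (P x)⁻¹ := inv_pos.2 hx
      rw [e, ← smul_add, ← smul_sub, map_smul_eq_mul, map_smul_eq_mul, Real.norm_eq_abs,
        abs_of_pos hpos] at h1
      have h2 : ((P x)⁻¹ * P (x + z)) ^ 2 + ((P x)⁻¹ * P (x - z)) ^ 2 - 2 - 2 * (P z / P x) ^ 2 =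
          (P (x + z) ^ 2 + P (x - z) ^ 2 - 2 * P x ^ 2 - 2 * P z ^ 2) / P x ^ 2 := by
        field_simp
      rw [h2, abs_div, abs_of_pos (show 0 < P x ^ 2 by positivity),
        div_le_iff₀ (by positivity)] at h1
      exact h1
  have hη : ∀ x, 0 ≤ 7 * η * P x ^ 2 := fun x => (abs_nonneg _).trans (hle x x le_rfl)
  rcases le_total (P z) (P x) with hzx | hxz
  · linarith [hle x z hzx, hη z]
  · have h1 := hle z x hxz
    rw [add_comm z x, map_sub_rev P z x] at h1
    have h2 : P (x + z) ^ 2 + P (x - z) ^ 2 - 2 * P x ^ 2 - 2 * P z ^ 2 =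
        P (x + z) ^ 2 + P (x - z) ^ 2 - 2 * P z ^ 2 - 2 * P x ^ 2 := by ring
    rw [h2]
    linarith [hη x]

end Parallelogram

lemma leading_coeff_nonneg {g₂ g₁ g₀ : ℝ} (hg : ∀ s, -1 ≤ g₂ * s ^ 2 + g₁ * s + g₀)
    (hg₀ : g₀ ≤ 0) : 0 ≤ g₂ := by
  by_contra hcon
  push Not at hcon
  obtain ⟨s, hs⟩ : ∃ s, -g₂ * s = -g₂ + |g₁| + 1 :=
    ⟨(-g₂ + |g₁| + 1) / -g₂, mul_div_cancel₀ _ (by linarith)⟩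
  have hs1 : 1 ≤ s := by
    by_contra hs1
    push Not at hs1
    nlinarith [abs_nonneg g₁]
  have h2 := hg s
  have h4 : g₁ ≤ |g₁| := le_abs_self _
  nlinarith

lemma coeff_bounds_of_nonpos {g₂ g₁ g₀ x y : ℝ} (hg : ∀ s, -1 ≤ g₂ * s ^ 2 + g₁ * s + g₀)
    (hg₀ : g₀ ≤ 0) (hx0 : 0 ≤ x) (hx1 : x ≤ 1) (hy0 : y ≤ 0) (hy1 : -1 ≤ y)
    (hxy : 8 / 100 ≤ x - y) (hgx : g₂ * x ^ 2 + g₁ * x + g₀ ≤ 0)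
    (hgy : g₂ * y ^ 2 + g₁ * y + g₀ ≤ 0) : g₂ ≤ 625 ∧ |g₁| ≤ 650 := by
  have hg₂0 := leading_coeff_nonneg hg hg₀
  have hg₂ : g₂ ≤ 625 := by
    have h1 := hg ((x + y) / 2)
    have h2 : g₂ * (x - y) ^ 2 ≤ 4 := by nlinarith
    by_contra hcon
    push Not at hcon
    have h3 : (8 / 100) ^ 2 ≤ (x - y) ^ 2 := pow_le_pow_left₀ (by norm_num) hxy 2
    nlinarith
  refine ⟨hg₂, ?_⟩
  have key : ∀ z, |z| ≤ 1 → 4 / 100 ≤ |z| → g₂ * z ^ 2 + g₁ * z + g₀ ≤ 0 → |g₁| ≤ 650 := by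
    intro z hz1 hz2 hz
    have h1 := hg z
    have h2 := hg 0
    have h3 : |g₁ * z| ≤ 1 + g₂ * z ^ 2 := by
      rw [abs_le]
      constructor <;> nlinarith
    rw [abs_mul, (sq_abs z).symm] at h3
    have h5 : g₂ * |z| ^ 2 ≤ 625 * |z| := by
      have : g₂ * |z| ≤ 625 * 1 := mul_le_mul hg₂ hz1 (abs_nonneg z) (by norm_num)
      nlinarith [abs_nonneg z]
    by_contra hcon
    push Not at hcon
    nlinarith [abs_nonneg z]
  rcases le_total (4 / 100) x with h | h
  · exact key x (by rwa [abs_of_nonneg hx0]) (by rwa [abs_of_nonneg hx0]) hgx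
  · exact key y (by rw [abs_of_nonpos hy0]; linarith) (by rw [abs_of_nonpos hy0]; linarith) hgy

lemma quadratic_lipschitz {g₂ g₁ g₀ s t : ℝ} (hg₂0 : 0 ≤ g₂) (hg₂ : g₂ ≤ 625) (hg₁ : |g₁| ≤ 650)
    (hs : |s| ≤ 11 / 10) (ht : |t| ≤ 1) :
    |(g₂ * s ^ 2 + g₁ * s + g₀) - (g₂ * t ^ 2 + g₁ * t + g₀)| ≤ 2000 * |s - t| := by
  have h1 : (g₂ * s ^ 2 + g₁ * s + g₀) - (g₂ * t ^ 2 + g₁ * t + g₀) =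
      (g₂ * (s + t) + g₁) * (s - t) := by ring
  rw [h1, abs_mul]
  refine mul_le_mul_of_nonneg_right ?_ (abs_nonneg _)
  have h2 := abs_add_le (g₂ * (s + t)) g₁
  have h3 : |g₂ * (s + t)| ≤ 625 * (21 / 10) := by
    rw [abs_mul, abs_of_nonneg hg₂0]
    exact mul_le_mul hg₂ ((abs_add_le s t).trans (by linarith)) (abs_nonneg _) (by norm_num)
  linarith

/-- A nonnegative-up-to-`1` quadratic polynomial that changes sign near `p` and `q` is small there. -/
lemma abs_quadratic_le_of_sign_change {e g₂ g₁ g₀ p q : ℝ} (he : 0 < e) (he' : e ≤ 1 / 1000)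
    (hg : ∀ s, -1 ≤ g₂ * s ^ 2 + g₁ * s + g₀) (hg₀ : g₀ ≤ 0) (hp : 0 ≤ p) (hp1 : p ≤ 1)
    (hq : q ≤ 0) (hq1 : -1 ≤ q) (hpq : 1 / 10 ≤ p - q)
    (hpi : 8 * e ≤ p → g₂ * (p - 8 * e) ^ 2 + g₁ * (p - 8 * e) + g₀ ≤ 0)
    (hpo : -4 * e ^ 2 ≤ g₂ * (p + 5 * e) ^ 2 + g₁ * (p + 5 * e) + g₀)
    (hqi : q ≤ -(8 * e) → g₂ * (q + 8 * e) ^ 2 + g₁ * (q + 8 * e) + g₀ ≤ 0)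
    (hqo : -4 * e ^ 2 ≤ g₂ * (q - 5 * e) ^ 2 + g₁ * (q - 5 * e) + g₀) :
    |g₂ * p ^ 2 + g₁ * p + g₀| ≤ 16000 * e ∧ |g₂ * q ^ 2 + g₁ * q + g₀| ≤ 16000 * e := by
  obtain ⟨x, hx0, hxp, hx1, hgx⟩ : ∃ x, 0 ≤ x ∧ p - 8 * e ≤ x ∧ x ≤ p ∧
      g₂ * x ^ 2 + g₁ * x + g₀ ≤ 0 := by
    rcases le_total (8 * e) p with h | h
    · exact ⟨p - 8 * e, by linarith, le_rfl, by linarith, hpi h⟩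
    · exact ⟨0, le_rfl, by linarith, hp, by simpa⟩
  obtain ⟨y, hy0, hyq, hy1, hgy⟩ : ∃ y, y ≤ 0 ∧ y ≤ q + 8 * e ∧ q ≤ y ∧
      g₂ * y ^ 2 + g₁ * y + g₀ ≤ 0 := by
    rcases le_total q (-(8 * e)) with h | h
    · exact ⟨q + 8 * e, by linarith, le_rfl, by linarith, hqi h⟩
    · exact ⟨0, le_rfl, by linarith, hq, by simpa⟩
  obtain ⟨hg₂, hg₁⟩ := coeff_bounds_of_nonpos hg hg₀ hx0 (hx1.trans hp1) hy0 (hq1.trans hy1)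
    (by linarith) hgx hgy
  have hg₂0 := leading_coeff_nonneg hg hg₀
  have he2 : e ^ 2 ≤ e := by nlinarith
  constructor
  · have hp' : |p| ≤ 1 := by rwa [abs_of_nonneg hp]
    have h1 := quadratic_lipschitz (g₀ := g₀) (s := x) hg₂0 hg₂ hg₁
      (by rw [abs_of_nonneg hx0]; linarith) hp'
    have h2 := quadratic_lipschitz (g₀ := g₀) (s := p + 5 * e) hg₂0 hg₂ hg₁
      (by rw [abs_of_nonneg] <;> linarith) hp'
    have h3 : |x - p| ≤ 8 * e := by rw [abs_le]; constructor <;> linarith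
    have h4 : |p + 5 * e - p| = 5 * e := by rw [abs_of_nonneg] <;> linarith
    rw [h4] at h2
    have h5 := (abs_le.1 h1).1
    have h6 := (abs_le.1 h2).2
    rw [abs_le]
    constructor <;> linarith
  · have hq' : |q| ≤ 1 := by rw [abs_of_nonpos hq]; linarith
    have h1 := quadratic_lipschitz (g₀ := g₀) (s := y) hg₂0 hg₂ hg₁
      (by rw [abs_of_nonpos hy0]; linarith) hq'
    have h2 := quadratic_lipschitz (g₀ := g₀) (s := q - 5 * e) hg₂0 hg₂ hg₁
      (by rw [abs_of_nonpos] <;> linarith) hq'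
    have h3 : |y - q| ≤ 8 * e := by rw [abs_le]; constructor <;> linarith
    have h4 : |q - 5 * e - q| = 5 * e := by rw [abs_of_nonpos] <;> linarith
    rw [h4] at h2
    have h5 := (abs_le.1 h1).1
    have h6 := (abs_le.1 h2).2
    rw [abs_le]
    constructor <;> linarith

lemma abs_coeff_le_of_sign_change {e g₂ g₁ g₀ h ν : ℝ} (he : 0 < e) (he' : e ≤ 1 / 1000)
    (hh : 1 / 2 ≤ h) (hh1 : h ≤ 1) (hν : 0 ≤ ν) (hν9 : ν ≤ 9)
    (hg : ∀ s, -1 ≤ g₂ * s ^ 2 + g₁ * s + g₀) (hg₀ : g₀ ≤ 0)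
    (hi : ∀ s, (s - (1 - h)) ^ 2 + ν * s ^ 2 - h ^ 2 ≤ -(4 * e) → g₂ * s ^ 2 + g₁ * s + g₀ ≤ 0)
    (ho : ∀ s, 4 * e ≤ (s - (1 - h)) ^ 2 + ν * s ^ 2 - h ^ 2 →
      -4 * e ^ 2 ≤ g₂ * s ^ 2 + g₁ * s + g₀) :
    |g₁ + 2 * (g₂ / (1 + ν)) * (1 - h)| ≤ 400000 * e ∧
      |g₀ + g₂ / (1 + ν) * (2 * h - 1)| ≤ 400000 * e := by
  set m := 1 - h with hm
  have hm0 : 0 ≤ m := by linarith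
  set R := √(m ^ 2 + (1 + ν) * (2 * h - 1)) with hR
  have hν1 : 0 < 1 + ν := by linarith
  have hR0 : 0 ≤ R := Real.sqrt_nonneg _
  have hΔ : 0 ≤ m ^ 2 + (1 + ν) * (2 * h - 1) := by
    have : 0 ≤ (1 + ν) * (2 * h - 1) := mul_nonneg hν1.le (by linarith)
    positivity
  have hR2 : R ^ 2 = m ^ 2 + (1 + ν) * (2 * h - 1) := Real.sq_sqrt hΔ
  have hRh : h ≤ R := by
    apply abs_le_of_sq_le_sq' _ hR0 |>.2
    nlinarith
  have hRm : m ≤ R := by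
    apply abs_le_of_sq_le_sq' _ hR0 |>.2
    nlinarith
  have hR1 : R ≤ 1 + ν - m := by
    apply abs_le_of_sq_le_sq' _ (by linarith) |>.2
    nlinarith
  obtain ⟨p, hp⟩ : ∃ p, (1 + ν) * p = m + R := ⟨(m + R) / (1 + ν), by field_simp⟩
  obtain ⟨q, hq⟩ : ∃ q, (1 + ν) * q = m - R := ⟨(m - R) / (1 + ν), by field_simp⟩
  have hpt : ∀ t, (p + t - m) ^ 2 + ν * (p + t) ^ 2 - h ^ 2 = 2 * R * t + (1 + ν) * t ^ 2 := by
    intro t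
    have h1 : (1 + ν) * ((p + t - m) ^ 2 + ν * (p + t) ^ 2 - h ^ 2) =
        (1 + ν) * (2 * R * t + (1 + ν) * t ^ 2) := by
      have : (1 + ν) * ((p + t - m) ^ 2 + ν * (p + t) ^ 2 - h ^ 2) =
        ((1 + ν) * p + (1 + ν) * t - m) ^ 2 - (m ^ 2 + (1 + ν) * (h ^ 2 - m ^ 2)) := by ring
      rw [this, hp]
      have e1 : h ^ 2 - m ^ 2 = 2 * h - 1 := by rw [hm]; ring
      rw [e1, ← hR2]
      ring
    exact mul_left_cancel₀ hν1.ne' h1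
  have hqt : ∀ t, (q - t - m) ^ 2 + ν * (q - t) ^ 2 - h ^ 2 = 2 * R * t + (1 + ν) * t ^ 2 := by
    intro t
    have h1 : (1 + ν) * ((q - t - m) ^ 2 + ν * (q - t) ^ 2 - h ^ 2) =
        (1 + ν) * (2 * R * t + (1 + ν) * t ^ 2) := by
      have : (1 + ν) * ((q - t - m) ^ 2 + ν * (q - t) ^ 2 - h ^ 2) =
        ((1 + ν) * q - (1 + ν) * t - m) ^ 2 - (m ^ 2 + (1 + ν) * (h ^ 2 - m ^ 2)) := by ring
      rw [this, hq]
      have e1 : h ^ 2 - m ^ 2 = 2 * h - 1 := by rw [hm]; ring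
      rw [e1, ← hR2]
      ring
    exact mul_left_cancel₀ hν1.ne' h1
  have hp0 : 0 ≤ p := by by_contra hcon; push Not at hcon; nlinarith
  have hp1 : p ≤ 1 := by by_contra hcon; push Not at hcon; nlinarith
  have hq0 : q ≤ 0 := by by_contra hcon; push Not at hcon; nlinarith
  have hq1 : -1 ≤ q := by by_contra hcon; push Not at hcon; nlinarith
  have hpq : 1 / 10 ≤ p - q := by by_contra hcon; push Not at hcon; nlinarith
  have hin : 2 * R * (-(8 * e)) + (1 + ν) * (-(8 * e)) ^ 2 ≤ -(4 * e) := by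
    have h1 : (1 + ν) * (-(8 * e)) ^ 2 ≤ 10 * (-(8 * e)) ^ 2 :=
      mul_le_mul_of_nonneg_right (by linarith) (sq_nonneg _)
    have h2 : 1 / 2 * e ≤ R * e := mul_le_mul_of_nonneg_right (by linarith) he.le
    nlinarith
  have hout : 4 * e ≤ 2 * R * (5 * e) + (1 + ν) * (5 * e) ^ 2 := by
    have h1 : 0 ≤ (1 + ν) * (5 * e) ^ 2 := by positivity
    have h2 : 1 / 2 * e ≤ R * e := mul_le_mul_of_nonneg_right (by linarith) he.le
    linarith
  obtain ⟨hgp, hgq⟩ := abs_quadratic_le_of_sign_change he he' hg hg₀ hp0 hp1 hq0 hq1 hpq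
    (fun _ => by
      have := hi (p + -(8 * e)) ((hpt _).trans_le hin)
      rwa [← sub_eq_add_neg] at this)
    (ho _ (hout.trans_eq (hpt _).symm))
    (fun _ => by
      have := hi (q - -(8 * e)) ((hqt _).trans_le hin)
      rwa [sub_neg_eq_add] at this)
    (ho _ (hout.trans_eq (hqt _).symm))
  set lam := g₂ / (1 + ν) with hlam
  have hlam' : g₂ = lam * (1 + ν) := by rw [hlam]; field_simp
  have e1 : g₂ * p ^ 2 + g₁ * p + g₀ = (g₁ + 2 * lam * m) * p + (g₀ + lam * (2 * h - 1)) := by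
    have := hpt 0
    have e1 : h ^ 2 - m ^ 2 = 2 * h - 1 := by rw [hm]; ring
    rw [hlam']
    linear_combination lam * this + lam * e1
  have e2 : g₂ * q ^ 2 + g₁ * q + g₀ = (g₁ + 2 * lam * m) * q + (g₀ + lam * (2 * h - 1)) := by
    have := hqt 0
    have e1 : h ^ 2 - m ^ 2 = 2 * h - 1 := by rw [hm]; ring
    rw [hlam']
    linear_combination lam * this + lam * e1
  rw [e1] at hgp
  rw [e2] at hgq
  have hslope : |g₁ + 2 * lam * m| ≤ 320000 * e := by
    have h1 : |(g₁ + 2 * lam * m) * (p - q)| ≤ 32000 * e := by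
      rw [abs_le] at hgp hgq ⊢
      constructor <;> linarith only [hgp.1, hgp.2, hgq.1, hgq.2]
    rw [abs_mul, abs_of_nonneg (by linarith : 0 ≤ p - q)] at h1
    nlinarith [abs_nonneg (g₁ + 2 * lam * m)]
  refine ⟨hslope.trans (by linarith), ?_⟩
  have h2 : |(g₁ + 2 * lam * m) * p| ≤ 320000 * e := by
    rw [abs_mul, abs_of_nonneg hp0]
    exact (mul_le_of_le_one_right (abs_nonneg _) hp1).trans hslope
  rw [abs_le] at hgp h2 ⊢
  constructor <;> linarith only [hgp.1, hgp.2, h2.1, h2.2, he]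

/-- If a quadratic polynomial nearly describes the section of an ellipsoid-like body by a ray, then
its coefficients are nearly proportional to those of the ellipsoid. -/
lemma abs_coeff_le_of_ray {e g₂ g₁ g₀ h N : ℝ} (he : 0 < e) (he' : e ≤ 1 / 1000)
    (hh : 1 / 2 ≤ h) (hh1 : h ≤ 1) (hN : 0 ≤ N) (hN3 : N ≤ 3)
    (hg : ∀ s, -1 ≤ g₂ * s ^ 2 + g₁ * s + g₀) (hg₀ : g₀ ≤ 0)
    (hi : ∀ σ, |σ| ≤ 1 → |1 - h + h * σ| * N ≤ √(1 - σ ^ 2) - e →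
      g₂ * (1 - h + h * σ) ^ 2 + g₁ * (1 - h + h * σ) + g₀ ≤ 0)
    (ho : ∀ σ, ¬ (|σ| ≤ 1 ∧ |1 - h + h * σ| * N ≤ √(1 - σ ^ 2) + e) →
      -4 * e ^ 2 ≤ g₂ * (1 - h + h * σ) ^ 2 + g₁ * (1 - h + h * σ) + g₀) :
    |g₁ + 2 * (g₂ / (1 + (h * N) ^ 2)) * (1 - h)| ≤ 400000 * e ∧
      |g₀ + g₂ / (1 + (h * N) ^ 2) * (2 * h - 1)| ≤ 400000 * e := by
  have hh0 : 0 < h := by linarith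
  have hhN : h * N ≤ 3 := by nlinarith
  have hσ : ∀ s, ∃ σ, s = 1 - h + h * σ := fun s => ⟨(s - (1 - h)) / h, by field_simp; ring⟩
  have hsq : ∀ σ, (1 - h + h * σ - (1 - h)) ^ 2 + (h * N) ^ 2 * (1 - h + h * σ) ^ 2 - h ^ 2 =
      h ^ 2 * ((|1 - h + h * σ| * N) ^ 2 - (1 - σ ^ 2)) := by
    intro σ
    rw [mul_pow |_|, sq_abs]
    ring
  have hhsq : h ^ 2 ≤ 1 := by nlinarith
  refine abs_coeff_le_of_sign_change he he' hh hh1 (sq_nonneg _) (by nlinarith [mul_nonneg hh0.le hN])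
    hg hg₀ (fun s hs => ?_) fun s hs => ?_
  · obtain ⟨σ, rfl⟩ := hσ s
    rw [hsq] at hs
    have h1 : (|1 - h + h * σ| * N) ^ 2 - (1 - σ ^ 2) ≤ -(4 * e) := by
      by_contra hcon
      push Not at hcon
      rcases le_total 0 ((|1 - h + h * σ| * N) ^ 2 - (1 - σ ^ 2)) with hX | hX
      · nlinarith [mul_nonneg (sq_nonneg h) hX]
      · nlinarith
    have h2 : 0 ≤ 1 - σ ^ 2 := by nlinarith [sq_nonneg (|1 - h + h * σ| * N)]
    have hw := Real.sq_sqrt h2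
    have hw0 := Real.sqrt_nonneg (1 - σ ^ 2)
    have hw1 : √(1 - σ ^ 2) ≤ 1 := Real.sqrt_le_one.2 (by nlinarith)
    have hwe : e ≤ √(1 - σ ^ 2) := by
      apply Real.le_sqrt_of_sq_le
      nlinarith [sq_nonneg (|1 - h + h * σ| * N)]
    refine hi σ (by rw [← sq_le_one_iff_abs_le_one]; linarith) ?_
    apply abs_le_of_sq_le_sq' _ (by linarith) |>.2
    nlinarith
  · obtain ⟨σ, rfl⟩ := hσ s
    refine ho σ ?_
    rintro ⟨h1, h2⟩
    rw [hsq] at hs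
    have h3 : 0 ≤ 1 - σ ^ 2 := by rw [← sq_le_one_iff_abs_le_one] at h1; linarith
    have hw := Real.sq_sqrt h3
    have hw1 : √(1 - σ ^ 2) ≤ 1 := Real.sqrt_le_one.2 (by nlinarith)
    have h4 := pow_le_pow_left₀ (by positivity) h2 2
    have h5 : (|1 - h + h * σ| * N) ^ 2 - (1 - σ ^ 2) ≤ 3 * e := by nlinarith
    nlinarith

section Lines

variable {E : Type*} [AddCommGroup E] [Module ℝ E]

lemma IsQuad.le_of_nonpos {F : ℝ → ℝ → ℝ} (hF : IsQuad F) (hF1 : ∀ s t, -1 ≤ F s t)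
    {s t s' t' : ℝ} (h : F s t ≤ 0) :
    F (1 / 10 * s + 9 / 10 * s') (1 / 10 * t + 9 / 10 * t') ≤
      1 / 10 * F s t + 9 / 10 * F s' t' := by
  obtain ⟨a, b, c, d, l, g, hF⟩ := hF
  have h1 := leading_coeff_nonneg
    (g₂ := a * (s' - s) ^ 2 + b * ((s' - s) * (t' - t)) + c * (t' - t) ^ 2)
    (g₁ := 2 * a * s * (s' - s) + b * (s * (t' - t) + t * (s' - s)) + 2 * c * t * (t' - t) +
      d * (s' - s) + l * (t' - t)) (g₀ := F s t) (fun x => by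
        have := hF1 (s + x * (s' - s)) (t + x * (t' - t))
        rw [hF] at this ⊢
        linarith) h
  rw [hF, hF, hF]
  linarith

lemma NearConic.abs_coeff_le {P : Seminorm ℝ E} {S : ℝ → ℝ → Prop} {F : ℝ → ℝ → ℝ} {e h : ℝ}
    (he : 0 < e) (he' : e ≤ 1 / 10 ^ 8) (hh : 1 / 2 ≤ h) (hh1 : h ≤ 1) {y k : E} (hy : P y = 1)
    (hk : P k = 1) {a b c d l g : ℝ}
    (hF : ∀ s t, F s t = a * s ^ 2 + b * (s * t) + c * t ^ 2 + d * s + l * t + g)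
    (hF1 : ∀ s t, -1 ≤ F s t) (hF0 : ∀ s t, S s t → F s t ≤ 0)
    (hnot : ∀ s r, ¬ S s r → -4 * e ^ 2 ≤ F s r) (hS0 : S 0 0)
    (hout : ∀ σ r, S (1 - h + h * σ) r →
      |σ| ≤ 1 ∧ P ((1 - h + h * σ) • y + r • k) ≤ √(1 - σ ^ 2) + e)
    (hin : ∀ σ r, |σ| ≤ 1 → P ((1 - h + h * σ) • y + r • k) ≤ √(1 - σ ^ 2) - e →
      S (1 - h + h * σ) r) :
    |l| ≤ 50 * e := by
  have hh0 : 0 < h := by linarith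
  have hP : ∀ s r, P (s • y + r • k) ≤ |s| + |r| := by
    intro s r
    refine (map_add_le_add P _ _).trans ?_
    rw [map_smul_eq_mul, map_smul_eq_mul, hy, hk, mul_one, mul_one, Real.norm_eq_abs,
      Real.norm_eq_abs]
  have hm : |1 - h| ≤ 1 / 2 := by rw [abs_of_nonneg] <;> linarith
  have hc16 : c ≤ 16 := by
    have key : ∀ r, |r| = 1 / 4 → F (1 - h) r ≤ 0 := by
      intro r hr
      have := hin 0 r (by simp) (by
        have := hP (1 - h) r
        rw [hr] at this
        simp only [mul_zero, add_zero]
        norm_num at he' ⊢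
        linarith)
      rw [mul_zero, add_zero] at this
      exact hF0 _ _ this
    have h1 := key (1 / 4) (by rw [abs_of_pos]; all_goals norm_num)
    have h2 := key (-(1 / 4)) (by rw [abs_neg, abs_of_pos]; all_goals norm_num)
    have h3 := hF1 (1 - h) 0
    rw [hF] at h1 h2 h3
    nlinarith
  set σ₀ := -((1 - h) / h) with hσ₀
  have e0 : 1 - h + h * σ₀ = 0 := by rw [hσ₀]; field_simp; ring
  have hσ₀1 : |σ₀| ≤ 1 := by
    rw [hσ₀, abs_neg, abs_of_nonneg (div_nonneg (by linarith) hh0.le), div_le_one hh0]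
    linarith
  set w := √(1 - σ₀ ^ 2) with hw
  have hw0 : 0 ≤ w := Real.sqrt_nonneg _
  have hPr : ∀ r, P ((1 - h + h * σ₀) • y + r • k) = |r| := by
    intro r
    rw [e0, zero_smul, zero_add, map_smul_eq_mul, hk, mul_one, Real.norm_eq_abs]
  have hi : ∃ r, 0 ≤ r ∧ w - e ≤ r ∧ r ≤ w ∧ F 0 r ≤ 0 ∧ F 0 (-r) ≤ 0 := by
    rcases le_total e w with hwe | hwe
    · have hr : ∀ r, |r| ≤ w - e → F 0 r ≤ 0 := by
        intro r hr
        have := hin σ₀ r hσ₀1 (by rw [hPr]; exact hr)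
        rw [e0] at this
        exact hF0 _ _ this
      exact ⟨w - e, by linarith, le_rfl, by linarith,
        hr _ (by rw [abs_of_nonneg]; linarith), hr _ (by rw [abs_neg, abs_of_nonneg]; linarith)⟩
    · exact ⟨0, le_rfl, by linarith, hw0, hF0 _ _ hS0, by simpa using hF0 _ _ hS0⟩
  obtain ⟨r, hr0, hr1, hrw, hr2, hr3⟩ := hi
  have ho : ∀ t, |t| = w + 2 * e → -4 * e ^ 2 ≤ F 0 t := by
    intro t ht
    apply hnot
    intro hcon
    have := (hout σ₀ t (by rwa [e0])).2
    rw [hPr, ht] at this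
    linarith
  have h1 := ho (w + 2 * e) (abs_of_nonneg (by linarith))
  have h2 := ho (-(w + 2 * e)) (by rw [abs_neg]; exact abs_of_nonneg (by linarith))
  rw [hF] at h1 h2 hr2 hr3
  have hsum : 0 < w + 2 * e + r := by linarith
  have h3 : c * ((w + 2 * e) - r) ≤ 16 * (3 * e) := by
    refine (mul_le_mul_of_nonneg_right hc16 (by linarith)).trans ?_
    linarith
  have h4 : c * ((w + 2 * e) - r) * (w + 2 * e + r) ≤ 16 * (3 * e) * (w + 2 * e + r) :=
    mul_le_mul_of_nonneg_right h3 hsum.le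
  have h5 : 4 * e ^ 2 ≤ 2 * e * (w + 2 * e + r) := by nlinarith
  have h6 : l * (w + 2 * e + r) ≤ 50 * e * (w + 2 * e + r) := by nlinarith
  have h7 : -l * (w + 2 * e + r) ≤ 50 * e * (w + 2 * e + r) := by nlinarith
  exact abs_le'.2 ⟨le_of_mul_le_mul_right h6 hsum, le_of_mul_le_mul_right h7 hsum⟩

lemma NearConic.exists_deep_point {P : Seminorm ℝ E} {S : ℝ → ℝ → Prop} {F : ℝ → ℝ → ℝ}
    {e h ε : ℝ} (he' : e ≤ 1 / 10 ^ 8) (hh : 1 / 2 ≤ h) (hh1 : h ≤ 1)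
    {y k : E} (hy : P y = 1) (hε : 4 * ε ≤ 1) (hF : IsQuad F)
    (hF1 : ∀ s t, -1 ≤ F s t) {s₁ r₁ : ℝ} (hmin : F s₁ r₁ = -1) (hF0 : ∀ s t, S s t → F s t ≤ 0)
    (hFS : ∀ s t, F s t ≤ -4 * ε → S s t)
    (hout : ∀ σ r, S (1 - h + h * σ) r →
      |σ| ≤ 1 ∧ P ((1 - h + h * σ) • y + r • k) ≤ √(1 - σ ^ 2) + e)
    (hin : ∀ σ r, |σ| ≤ 1 → P ((1 - h + h * σ) • y + r • k) ≤ √(1 - σ ^ 2) - e →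
      S (1 - h + h * σ) r) :
    F (1 - h) 0 ≤ -(1 / 10) := by
  have hh0 : 0 < h := by linarith
  have hm : |1 - h| ≤ 1 / 2 := by rw [abs_of_nonneg] <;> linarith
  have hS1 : S s₁ r₁ := hFS _ _ (by rw [hmin]; linarith)
  obtain ⟨σ₁, rfl⟩ : ∃ σ, s₁ = 1 - h + h * σ := ⟨(s₁ - (1 - h)) / h, by field_simp; ring⟩
  obtain ⟨hσ₁, hP₁⟩ := hout _ _ hS1
  have hσ₁2 : σ₁ ^ 2 ≤ 1 := by rwa [sq_le_one_iff_abs_le_one]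
  have hw1 : √(1 - σ₁ ^ 2) ≤ 1 := Real.sqrt_le_one.2 (by nlinarith)
  have hS2 : S (1 - h + h * (-(σ₁ / 9))) (-(r₁ / 9)) := by
    apply hin
    · rw [abs_neg, abs_div, abs_of_pos (by norm_num : (0 : ℝ) < 9)]
      linarith
    · have hw2 : 9 / 10 ≤ √(1 - (-(σ₁ / 9)) ^ 2) := by
        apply Real.le_sqrt_of_sq_le
        nlinarith
      have h1 : (1 - h + h * (-(σ₁ / 9))) • y + (-(r₁ / 9)) • k =
          (10 / 9 * (1 - h)) • y - (1 / 9 : ℝ) • ((1 - h + h * σ₁) • y + r₁ • k) := by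
        module
      have h2 := map_sub_le_add P ((10 / 9 * (1 - h)) • y)
        ((1 / 9 : ℝ) • ((1 - h + h * σ₁) • y + r₁ • k))
      rw [← h1, map_smul_eq_mul, map_smul_eq_mul, hy, Real.norm_eq_abs, Real.norm_eq_abs,
        abs_mul, abs_of_pos (by norm_num : (0 : ℝ) < 10 / 9),
        abs_of_pos (by norm_num : (0 : ℝ) < 1 / 9)] at h2
      norm_num at he'
      linarith
  have h2 := hF0 _ _ hS2
  have h3 := hF.le_of_nonpos hF1 (s := 1 - h + h * σ₁) (t := r₁)
    (s' := 1 - h + h * (-(σ₁ / 9))) (t' := -(r₁ / 9)) (by rw [hmin]; norm_num)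
  have e1 : 1 / 10 * (1 - h + h * σ₁) + 9 / 10 * (1 - h + h * (-(σ₁ / 9))) = 1 - h := by ring
  have e2 : 1 / 10 * r₁ + 9 / 10 * (-(r₁ / 9)) = 0 := by ring
  rw [e1, e2, hmin] at h3
  linarith

private lemma lam_lower_bound {e h lam b c d l g : ℝ} (he : 0 < e) (he' : e ≤ 1 / 10 ^ 8)
    (hh : 1 / 2 ≤ h) (hh1 : h ≤ 1) (h1 : -(400000 * e) ≤ d + 2 * lam * (1 - h))
    (h2 : -(400000 * e) ≤ g + lam * (2 * h - 1))
    (hdeep : (lam * (1 + h ^ 2)) * (1 - h) ^ 2 + b * ((1 - h) * 0) + c * 0 ^ 2 + d * (1 - h) +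
      l * 0 + g ≤ -(1 / 10)) : 1 / 20 ≤ lam := by
  have h3 : (lam * (1 + h ^ 2)) * (1 - h) ^ 2 + b * ((1 - h) * 0) + c * 0 ^ 2 + d * (1 - h) +
      l * 0 + g = -(lam * (h ^ 2 * (1 - (1 - h) ^ 2))) +
        (d + 2 * lam * (1 - h)) * (1 - h) + (g + lam * (2 * h - 1)) := by ring
  rw [h3] at hdeep
  have h4 : -(400000 * e) ≤ (d + 2 * lam * (1 - h)) * (1 - h) := by nlinarith
  norm_num at he'
  have h5 : 1 / 20 ≤ lam * (h ^ 2 * (1 - (1 - h) ^ 2)) := by linarith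
  have h6 : 0 ≤ h ^ 2 * (1 - (1 - h) ^ 2) := mul_nonneg (sq_nonneg _) (by nlinarith)
  have h7 : h ^ 2 * (1 - (1 - h) ^ 2) ≤ 1 :=
    mul_le_one₀ (pow_le_one₀ (by linarith) hh1) (by nlinarith) (by nlinarith)
  by_contra hcon
  push Not at hcon
  nlinarith

private lemma abs_sq_sub_quadratic_le {e h lam mu a b c u N : ℝ} (he : 0 < e) (hh : 1 / 2 ≤ h)
    (hh1 : h ≤ 1) (hlam : 1 / 20 ≤ lam) (ha : a = lam * (1 + h ^ 2))
    (hmu : a + b * u + c * u ^ 2 = mu * (1 + (h * N) ^ 2)) (hdiff : |mu - lam| ≤ 1700000 * e)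
    (hN0 : 0 ≤ N) (hN : N ≤ 3) :
    |N ^ 2 - 1 - b / (lam * h ^ 2) * u - c / (lam * h ^ 2) * u ^ 2| ≤ 2 * 10 ^ 9 * e := by
  have hh0 : 0 < h := by linarith
  have hh4 : 1 / 4 ≤ h ^ 2 := by nlinarith
  have hlamh : 1 / 80 ≤ lam * h ^ 2 := by nlinarith
  have hlamh0 : 0 < lam * h ^ 2 := by linarith
  have hhN : (h * N) ^ 2 ≤ 9 := by
    have h1 : h * N ≤ 3 := by nlinarith
    nlinarith [mul_nonneg hh0.le hN0]
  have hfin : N ^ 2 - 1 - b / (lam * h ^ 2) * u - c / (lam * h ^ 2) * u ^ 2 =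
      -((mu - lam) * (1 + (h * N) ^ 2)) / (lam * h ^ 2) := by
    have : lam ≠ 0 := by linarith
    field_simp
    linarith
  rw [hfin, abs_div, abs_neg, abs_mul, abs_of_pos hlamh0, div_le_iff₀ hlamh0,
    abs_of_pos (show 0 < 1 + (h * N) ^ 2 by positivity)]
  have h8 : |mu - lam| * (1 + (h * N) ^ 2) ≤ 1700000 * e * 10 :=
    mul_le_mul hdiff (by linarith) (by positivity) (by positivity)
  have h9 : 2 * 10 ^ 9 * e * (1 / 80) ≤ 2 * 10 ^ 9 * e * (lam * h ^ 2) :=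
    mul_le_mul_of_nonneg_left hlamh (by positivity)
  norm_num at h9 ⊢
  linarith

/-- If the body `{(s, r) | S s r}` is nearly a conic and nearly given by
`((s - (1 - h)) / h) ^ 2 + P (s • y + r • k) ^ 2 ≤ 1`, then `u ↦ P (y + u • k) ^ 2` is nearly a
quadratic polynomial. -/
lemma exists_quadratic_line {P : Seminorm ℝ E} {S : ℝ → ℝ → Prop} {e h ε : ℝ} (he : 0 < e)
    (he' : e ≤ 1 / 10 ^ 8) (hh : 1 / 2 ≤ h) (hh1 : h ≤ 1) {y k : E} (hy : P y = 1) (hk : P k = 1)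
    (hε : ε ≤ e ^ 2) (hS : NearConic ε S) (hS0 : S 0 0)
    (hout : ∀ σ r, S (1 - h + h * σ) r →
      |σ| ≤ 1 ∧ P ((1 - h + h * σ) • y + r • k) ≤ √(1 - σ ^ 2) + e)
    (hin : ∀ σ r, |σ| ≤ 1 → P ((1 - h + h * σ) • y + r • k) ≤ √(1 - σ ^ 2) - e →
      S (1 - h + h * σ) r) :
    ∃ b c : ℝ, ∀ u : ℝ, |u| ≤ 2 →
      |P (y + u • k) ^ 2 - 1 - b * u - c * u ^ 2| ≤ 2 * 10 ^ 9 * e := by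
  obtain ⟨F, ⟨a, b, c, d, l, g, hF⟩, hF1, ⟨s₁, r₁, hmin⟩, hF0, hFS⟩ := hS
  have hh0 : 0 < h := by linarith
  have he2 : 4 * e ^ 2 ≤ 1 := by nlinarith
  have hnot : ∀ s r, ¬ S s r → -4 * e ^ 2 ≤ F s r := by
    intro s r hsr
    by_contra hcon
    push Not at hcon
    exact hsr (hFS s r (by linarith))
  have hg0 : g ≤ 0 := by
    have := hF0 0 0 hS0
    rw [hF] at this
    linarith
  have hP : ∀ s r, P (s • y + r • k) ≤ |s| + |r| := by
    intro s r
    refine (map_add_le_add P _ _).trans ?_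
    rw [map_smul_eq_mul, map_smul_eq_mul, hy, hk, mul_one, mul_one, Real.norm_eq_abs,
      Real.norm_eq_abs]
  have hm : |1 - h| ≤ 1 / 2 := by rw [abs_of_nonneg] <;> linarith
  have hl := NearConic.abs_coeff_le he he' hh hh1 hy hk hF hF1 hF0 hnot hS0 hout hin
  have hdeep := NearConic.exists_deep_point he' hh hh1 hy (by linarith) ⟨a, b, c, d, l, g, hF⟩ hF1
    hmin hF0 hFS hout hin
  have hray : ∀ u : ℝ, |u| ≤ 2 → P (y + u • k) ≤ 3 ∧
      |d + l * u + 2 * ((a + b * u + c * u ^ 2) / (1 + (h * P (y + u • k)) ^ 2)) * (1 - h)| ≤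
        400000 * e ∧
      |g + (a + b * u + c * u ^ 2) / (1 + (h * P (y + u • k)) ^ 2) * (2 * h - 1)| ≤
        400000 * e := by
    intro u hu
    have hN3 : P (y + u • k) ≤ 3 := by
      have := hP 1 u
      rw [one_smul, abs_one] at this
      linarith
    have hFu : ∀ s, (a + b * u + c * u ^ 2) * s ^ 2 + (d + l * u) * s + g = F s (s * u) := by
      intro s
      rw [hF]
      ring
    have hPu : ∀ s, P (s • y + (s * u) • k) = |s| * P (y + u • k) := by
      intro s
      rw [mul_smul, ← smul_add, map_smul_eq_mul, Real.norm_eq_abs]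
    refine ⟨hN3, abs_coeff_le_of_ray he (he'.trans (by norm_num)) hh hh1 (apply_nonneg P _) hN3
      (fun s => by rw [hFu]; exact hF1 _ _) hg0 (fun σ hσ hσ' => ?_) fun σ hσ => ?_⟩
    · rw [hFu]
      exact hF0 _ _ (hin σ _ hσ (by rwa [hPu]))
    · rw [hFu]
      refine hnot _ _ fun hcon => hσ ?_
      have := hout σ _ hcon
      rwa [hPu] at this
  have h0 := (hray 0 (by norm_num)).2
  simp only [zero_smul, add_zero, hy, mul_one, mul_zero, ne_eq, OfNat.ofNat_ne_zero,
    not_false_eq_true, zero_pow] at h0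
  obtain ⟨h01, h02⟩ := h0
  set lam := a / (1 + h ^ 2) with hlam
  have ha : a = lam * (1 + h ^ 2) := by rw [hlam]; field_simp
  have hlam20 : 1 / 20 ≤ lam := by
    rw [hF, ha] at hdeep
    exact lam_lower_bound he he' hh hh1 (abs_le.1 h01).1 (abs_le.1 h02).1 hdeep
  refine ⟨b / (lam * h ^ 2), c / (lam * h ^ 2), fun u hu => ?_⟩
  obtain ⟨hN3, hu1, hu2⟩ := hray u hu
  set N := P (y + u • k) with hN
  have hN0 : 0 ≤ N := apply_nonneg P _
  set mu := (a + b * u + c * u ^ 2) / (1 + (h * N) ^ 2) with hmu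
  have hmu' : a + b * u + c * u ^ 2 = mu * (1 + (h * N) ^ 2) := by rw [hmu]; field_simp
  have hlu : |l * u| ≤ 100 * e := by
    rw [abs_mul]
    nlinarith [abs_nonneg l, abs_nonneg u]
  have hdiff : |mu - lam| ≤ 1700000 * e := by
    rw [abs_le] at h01 h02 hu1 hu2 hlu ⊢
    constructor <;> linarith only [h01.1, h01.2, h02.1, h02.2, hu1.1, hu1.2, hu2.1, hu2.2, hlu.1,
      hlu.2, he]
  exact abs_sq_sub_quadratic_le he hh hh1 hlam20 ha hmu' hdiff hN0 hN3

end Lines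

section Width

private lemma width_estimates {e w ρ L B a F : ℝ} (he : 0 < e) (hw : 0 ≤ w) (hw1 : w ^ 2 ≤ 1)
    (hρ : 0 ≤ ρ) (hl1 : -4 * e ^ 2 ≤ L) (hl2 : L ≤ 0) (hb1 : -(4 * e * ρ) ≤ B)
    (hb2 : B ≤ 4 * e * ρ) (ha : 1 - 8 * e ^ 2 ≤ a) (ha1 : a ≤ 1)
    (hF : F = -(a * w ^ 2) + L + B + ρ ^ 2) :
    (F ≤ 0 → ρ ≤ w + 5 * e) ∧ (ρ ≤ w - 7 * e → F ≤ -4 * e ^ 2) := by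
  have haw : a * w ^ 2 ≤ w ^ 2 := by nlinarith only [sq_nonneg w, ha1]
  have haw' : w ^ 2 - 8 * e ^ 2 ≤ a * w ^ 2 := by
    nlinarith only [mul_nonneg (sub_nonneg.2 ha) (sq_nonneg w), mul_nonneg (sq_nonneg e)
      (sub_nonneg.2 hw1)]
  rw [hF]
  constructor
  · intro h3
    have h4 : (ρ - 2 * e) ^ 2 ≤ w ^ 2 + 8 * e ^ 2 := by linarith only [hb1, h3, hl1, haw]
    have h5 : ρ - 2 * e ≤ w + 3 * e := by
      refine (abs_le_of_sq_le_sq' ?_ (by positivity)).2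
      nlinarith only [h4, mul_nonneg hw he.le, sq_nonneg e]
    linarith
  · intro hs
    have h4 : (ρ + 2 * e) ^ 2 ≤ (w - 5 * e) ^ 2 :=
      pow_le_pow_left₀ (by positivity) (by linarith) 2
    have h5 : 7 * e * e ≤ w * e := mul_le_mul_of_nonneg_right (by linarith) he.le
    nlinarith only [h4, h5, hb2, hl2, haw']

/-- A nearly conical planar body inscribed in the slab `|σ| ≤ 1`, touching it at `(±1, 0)`, is
nearly an ellipse with axes parallel to the coordinate axes. -/
lemma NearConic.exists_width_of_slab {S : ℝ → ℝ → Prop} {ε e : ℝ} (he : 0 < e) (he' : e ≤ 1 / 10)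
    (hε : ε ≤ e ^ 2) (hS : NearConic ε S) (hslab : ∀ σ r, S σ r → |σ| ≤ 1) (h1 : S 1 0)
    (h2 : S (-1) 0) {R : ℝ} (hbd : ∀ σ r, S σ r → |r| ≤ R) :
    ∃ N : ℝ, 0 < N ∧ ∀ σ r, |σ| ≤ 1 → (S σ r → N * |r| ≤ √(1 - σ ^ 2) + 5 * e) ∧
      (N * |r| ≤ √(1 - σ ^ 2) - 7 * e → S σ r) := by
  obtain ⟨F, ⟨a, b, c, d, l, g, hF⟩, hF1, ⟨s₁, r₁, hmin⟩, hF0, hFS⟩ := hS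
  have he2 : e ^ 2 ≤ 1 / 100 := by nlinarith
  have hFS' : ∀ s r, F s r ≤ -4 * e ^ 2 → S s r := fun s r h => hFS s r (by linarith)
  have hS1 : S s₁ r₁ := hFS' _ _ (by rw [hmin]; linarith)
  have hs1 := hslab _ _ hS1
  have hfib : ∀ v, F s₁ (r₁ + v) = -1 + (b * s₁ + 2 * c * r₁ + l) * v + c * v ^ 2 := by
    intro v
    have h3 := hF s₁ r₁
    rw [hmin] at h3
    rw [hF, h3]
    ring
  have hslope : b * s₁ + 2 * c * r₁ + l = 0 ∧ 0 ≤ c := by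
    have key : ∀ v, 0 ≤ (b * s₁ + 2 * c * r₁ + l) * v + c * v ^ 2 := by
      intro v
      have := hF1 s₁ (r₁ + v)
      rw [hfib] at this
      linarith
    set p := b * s₁ + 2 * c * r₁ + l
    have hc : 0 ≤ c := by linarith [key 1, key (-1)]
    refine ⟨?_, hc⟩
    have h3 := key (-(p / (c + 1)))
    have h4 : p * -(p / (c + 1)) + c * (-(p / (c + 1))) ^ 2 = -(p ^ 2 / (c + 1) ^ 2) := by
      field_simp
      ring
    rw [h4] at h3
    have h5 : 0 ≤ p ^ 2 / (c + 1) ^ 2 := by positivity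
    have h6 : p ^ 2 / (c + 1) ^ 2 = 0 := by linarith
    rw [div_eq_zero_iff] at h6
    rcases h6 with h6 | h6
    · exact pow_eq_zero_iff two_ne_zero |>.1 h6
    · have : c + 1 = 0 := pow_eq_zero_iff two_ne_zero |>.1 h6
      linarith
  have hc : 0 < c := by
    refine lt_of_le_of_ne hslope.2 fun hc => ?_
    have h3 : S s₁ (r₁ + (R + |r₁| + 1)) := by
      apply hFS'
      rw [hfib, hslope.1, ← hc]
      linarith
    have h4 := hbd _ _ h3
    have h5 := le_abs_self (r₁ + (R + |r₁| + 1))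
    have h6 := neg_abs_le r₁
    linarith
  have hnot : ∀ s r, 1 < |s| → -4 * e ^ 2 ≤ F s r := by
    intro s r hs
    by_contra hcon
    push Not at hcon
    exact absurd (hslab _ _ (hFS' _ _ hcon.le)) (not_le.2 hs)
  have hcontF : ∀ r, Continuous fun s => F s r := by
    intro r
    simp only [hF]
    fun_prop
  have hb1 : ∀ r, -4 * e ^ 2 ≤ F 1 r := by
    intro r
    refine ge_of_tendsto ((hcontF r).tendsto 1 |>.mono_left (nhdsWithin_le_nhds (s := Ioi 1))) ?_
    filter_upwards [self_mem_nhdsWithin] with s hs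
    exact hnot _ _ (lt_of_lt_of_le hs (le_abs_self s))
  have hb2 : ∀ r, -4 * e ^ 2 ≤ F (-1) r := by
    intro r
    refine ge_of_tendsto ((hcontF r).tendsto (-1) |>.mono_left
      (nhdsWithin_le_nhds (s := Iio (-1)))) ?_
    filter_upwards [self_mem_nhdsWithin] with s hs
    exact hnot _ _ (lt_of_lt_of_le (by linarith [mem_Iio.1 hs]) (neg_le_abs s))
  have hf1 := hF0 _ _ h1
  have hf2 := hF0 _ _ h2
  have hf1' := hb1 0
  have hf2' := hb2 0
  rw [hF] at hf1 hf2 hf1' hf2'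
  set N := √c with hN
  have hN2 : N ^ 2 = c := Real.sq_sqrt hc.le
  have hN0 : 0 < N := Real.sqrt_pos.2 hc
  have hdisc : ∀ β f₀ : ℝ, f₀ ≤ 0 → (∀ r, -4 * e ^ 2 ≤ f₀ + β * r + c * r ^ 2) →
      |β| ≤ 4 * e * N := by
    intro β f₀ hf₀ h
    have h3 := h (-(β / (2 * c)))
    have h4 : f₀ + β * -(β / (2 * c)) + c * (-(β / (2 * c))) ^ 2 = f₀ - β ^ 2 / (4 * c) := by
      field_simp
      ring
    rw [h4] at h3
    have h5 : β ^ 2 / (4 * c) ≤ 4 * e ^ 2 := by linarith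
    rw [div_le_iff₀ (by positivity)] at h5
    apply abs_le_of_sq_le_sq _ (by positivity)
    rw [mul_pow, hN2]
    linarith
  have hβ1 : |b + l| ≤ 4 * e * N := by
    refine hdisc _ (a + d + g) (by linarith) fun r => ?_
    have := hb1 r
    rw [hF] at this
    linarith
  have hβ2 : |-b + l| ≤ 4 * e * N := by
    refine hdisc _ (a - d + g) (by linarith) fun r => ?_
    have := hb2 r
    rw [hF] at this
    linarith
  have hβ : ∀ σ, |σ| ≤ 1 → |b * σ + l| ≤ 4 * e * N := by
    intro σ hσ
    rw [abs_le] at hβ1 hβ2 hσ ⊢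
    constructor <;> nlinarith
  have hβr : ∀ σ r, |σ| ≤ 1 → |(b * σ + l) * r| ≤ 4 * e * (N * |r|) := by
    intro σ r hσ
    rw [abs_mul, ← mul_assoc]
    exact mul_le_mul_of_nonneg_right (hβ σ hσ) (abs_nonneg r)
  have hlin : ∀ σ, |σ| ≤ 1 → -4 * e ^ 2 ≤ a + d * σ + g ∧ a + d * σ + g ≤ 0 := by
    intro σ hσ
    rw [abs_le] at hσ
    constructor <;> nlinarith
  have hFeq : ∀ σ r, F σ r =
      -(a * (1 - σ ^ 2)) + (a + d * σ + g) + (b * σ + l) * r + (N * |r|) ^ 2 := by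
    intro σ r
    rw [hF, mul_pow, sq_abs, hN2]
    ring
  have ha1 : a ≤ 1 := by
    have h3 := hF1 0 0
    have h4 := (hlin 0 (by simp)).2
    rw [hF] at h3
    linarith
  have ha2 : 1 - 8 * e ^ 2 ≤ a * (1 - s₁ ^ 2) := by
    have h3 := hFeq s₁ r₁
    rw [hmin] at h3
    have h4 := (hlin _ hs1).1
    have h5 := (abs_le.1 (hβr s₁ r₁ hs1)).1
    nlinarith [sq_nonneg (N * |r₁| - 2 * e)]
  have hs1' : 0 ≤ 1 - s₁ ^ 2 := by
    rw [abs_le] at hs1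
    nlinarith
  have ha3 : 1 - 8 * e ^ 2 ≤ a := by
    have ha0 : 0 < a := by
      by_contra hcon
      push Not at hcon
      nlinarith
    nlinarith [sq_nonneg s₁]
  refine ⟨N, hN0, fun σ r hσ => ?_⟩
  have hw0 : 0 ≤ 1 - σ ^ 2 := by
    rw [abs_le] at hσ
    nlinarith
  set w := √(1 - σ ^ 2) with hw
  have hww : 1 - σ ^ 2 = w ^ 2 := (Real.sq_sqrt hw0).symm
  have hwn : 0 ≤ w := Real.sqrt_nonneg _
  have hw1 : w ^ 2 ≤ 1 := by rw [← hww]; nlinarith [sq_nonneg σ]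
  obtain ⟨hl1, hl2⟩ := hlin σ hσ
  have hFσ := hFeq σ r
  have hβσ := abs_le.1 (hβr σ r hσ)
  rw [hww] at hFσ
  have key := width_estimates he hwn hw1 (mul_nonneg hN0.le (abs_nonneg r)) hl1 hl2 hβσ.1 hβσ.2
    ha3 ha1 hFσ
  exact ⟨fun hs => key.1 (hF0 _ _ hs), fun hs => hFS' _ _ (key.2 hs)⟩

/-- A nearly conical planar body inscribed in the slab `|s - (1 - h)| ≤ h`, touching it on the first
axis, is nearly an ellipse with axes parallel to the coordinate axes. -/
lemma NearConic.exists_width {S : ℝ → ℝ → Prop} {ε e h : ℝ} (he : 0 < e) (he' : e ≤ 1 / 10)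
    (hε : ε ≤ e ^ 2) (hh : 0 < h) (hS : NearConic ε S)
    (hslab : ∀ σ r, S (1 - h + h * σ) r → |σ| ≤ 1) (h1 : S 1 0)
    (h2 : S (1 - 2 * h) 0) {R : ℝ} (hbd : ∀ s r, S s r → |r| ≤ R) :
    ∃ N : ℝ, 0 < N ∧ ∀ σ r, |σ| ≤ 1 → (S (1 - h + h * σ) r → N * |r| ≤ √(1 - σ ^ 2) + 5 * e) ∧
      (N * |r| ≤ √(1 - σ ^ 2) - 7 * e → S (1 - h + h * σ) r) := by
  refine NearConic.exists_width_of_slab (S := fun σ r => S (1 - h + h * σ) r) he he' hε ?_ hslab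
    (by simpa using h1) (by convert h2 using 1; ring) fun σ r hσ => hbd _ r hσ
  obtain ⟨F, ⟨a, b, c, d, l, g, hF⟩, hF1, ⟨s₁, r₁, hmin⟩, hF0, hFS⟩ := hS
  refine ⟨fun σ r => F (1 - h + h * σ) r, ⟨a * h ^ 2, b * h, c, 2 * a * (1 - h) * h + d * h,
    b * (1 - h) + l, a * (1 - h) ^ 2 + d * (1 - h) + g, fun s t => ?_⟩, fun s t => hF1 _ _,
    ⟨(s₁ - (1 - h)) / h, r₁, ?_⟩, fun s t => hF0 _ _, fun s t => hFS _ _⟩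
  · change F _ _ = _
    rw [hF]
    ring
  · change F _ _ = _
    rw [← hmin]
    congr 1
    field_simp
    ring

end Width

section Diameter

variable {V : Type*} [NormedAddCommGroup V] [NormedSpace ℝ V]

/-- A convex body with `0` in its interior has a pair of parallel supporting hyperplanes touching it
at the endpoints of a chord through `0`. -/
lemma exists_affine_diameter [Nontrivial V] {K : Set V} (hK : IsCompact K) (hc : Convex ℝ K)
    (h0 : (0 : V) ∈ interior K) :
    ∃ a ∈ K, ∃ (ψ : V →ₗ[ℝ] ℝ) (t : ℝ), 0 < t ∧ t ≤ 1 ∧ ψ a = 1 ∧ -(t • a) ∈ K ∧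
      ∀ x ∈ K, -t ≤ ψ x ∧ ψ x ≤ 1 := by
  have hn : K ∈ nhds (0 : V) := mem_interior_iff_mem_nhds.1 h0
  have hgc := continuous_gauge hc hn
  have habs : Absorbent ℝ K := absorbent_nhds_zero hn
  have hgle : ∀ x, gauge K x ≤ 1 ↔ x ∈ K := fun x => by
    rw [gauge_le_one_iff_mem_closure hc hn, hK.isClosed.closure_eq]
  obtain ⟨a, haK, hamax⟩ := hK.exists_isMaxOn ⟨0, interior_subset h0⟩
    (hgc.comp continuous_neg).continuousOn
  have hmax : ∀ x ∈ K, gauge K (-x) ≤ gauge K (-a) := fun x hx => hamax hx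
  set G := gauge K (-a) with hG
  have hG1 : 1 ≤ G := by
    by_contra hcon
    push Not at hcon
    obtain ⟨v, hv⟩ := exists_ne (0 : V)
    have hgv : 0 < gauge K v :=
      (gauge_pos habs (NormedSpace.isVonNBounded_of_isBounded ℝ hK.isBounded)).2 hv
    have h1 : gauge K ((gauge K v)⁻¹ • v) = 1 := by
      rw [gauge_smul_of_nonneg (inv_nonneg.2 hgv.le), smul_eq_mul, inv_mul_cancel₀ hgv.ne']
    have h2 := hmax _ ((hgle _).1 h1.le)
    have h3 := hmax _ ((hgle _).1 (h2.trans hcon.le))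
    rw [neg_neg, h1] at h3
    linarith
  have hG0 : 0 < G := by linarith
  have hsm : ∀ x, gauge K x ≤ G → G⁻¹ • x ∈ K := by
    intro x hx
    rw [← hgle, gauge_smul_of_nonneg (inv_nonneg.2 hG0.le), smul_eq_mul, inv_mul_le_iff₀ hG0,
      mul_one]
    exact hx
  have hb1 : gauge K (G⁻¹ • -a) = 1 := by
    rw [gauge_smul_of_nonneg (inv_nonneg.2 hG0.le), smul_eq_mul, ← hG, inv_mul_cancel₀ hG0.ne']
  have hbint : G⁻¹ • -a ∉ interior K := by
    rw [← gauge_lt_one_iff_mem_interior hc hn, hb1]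
    exact lt_irrefl 1
  obtain ⟨f, hf⟩ := geometric_hahn_banach_open_point hc.interior isOpen_interior hbint
  have hfb : ∀ x ∈ K, f x ≤ f (G⁻¹ • -a) := by
    have hcl : closure (interior K) = K := by
      rw [hc.closure_interior_eq_closure_of_nonempty_interior ⟨0, h0⟩, hK.isClosed.closure_eq]
    intro x hx
    rw [← hcl] at hx
    exact closure_minimal (fun y hy => (hf y hy).le) (isClosed_le f.continuous continuous_const) hx
  have hf0 := hf 0 h0
  simp only [map_zero, map_smul, map_neg, smul_eq_mul] at hf0 hfb
  have hfa : f a < 0 := by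
    by_contra hcon
    push Not at hcon
    have : 0 ≤ G⁻¹ * f a := by positivity
    linarith
  have hlow : ∀ x ∈ K, -G⁻¹ ≤ (f a)⁻¹ * f x := by
    intro x hx
    have h1 := mul_le_mul_of_nonpos_left (hfb x hx) (inv_nonpos.2 hfa.le)
    have h2 : (f a)⁻¹ * (G⁻¹ * -f a) = -G⁻¹ := by
      have := hfa.ne
      field_simp
    rwa [h2] at h1
  refine ⟨a, haK, (f a)⁻¹ • f.toLinearMap, G⁻¹, inv_pos.2 hG0, inv_le_one_of_one_le₀ hG1, ?_, ?_,
    fun x hx => ⟨hlow x hx, ?_⟩⟩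
  · exact inv_mul_cancel₀ hfa.ne
  · rw [← smul_neg]
    exact hsm _ le_rfl
  · have h1 := hlow _ (hsm _ (hmax x hx))
    simp only [map_smul, map_neg, smul_eq_mul] at h1
    have h2 : G⁻¹ * ((f a)⁻¹ * f x) ≤ G⁻¹ * 1 := by linarith
    exact le_of_mul_le_mul_left h2 (inv_pos.2 hG0)

end Diameter

section Slice

/-- The symmetrization of the gauge of an absorbent convex set. -/
noncomputable def symmGauge {E : Type*} [AddCommGroup E] [Module ℝ E] (A : Set E)
    (hA : Convex ℝ A) (habs : Absorbent ℝ A) : Seminorm ℝ E :=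
  Seminorm.of (fun x => (gauge A x + gauge A (-x)) / 2)
    (fun x y => by
      have h1 := gauge_add_le hA habs x y
      have h2 := gauge_add_le hA habs (-x) (-y)
      rw [neg_add]
      linarith)
    (fun c x => by
      have key : ∀ r : ℝ, 0 ≤ r → ∀ z : E, gauge A (r • z) = r * gauge A z := fun r hr z => by
        rw [gauge_smul_of_nonneg hr, smul_eq_mul]
      rcases le_total 0 c with hc | hc
      · rw [← smul_neg, key c hc, key c hc, Real.norm_eq_abs, abs_of_nonneg hc]
        ring
      · have h1 : c • x = (-c) • (-x) := by module
        have h2 : -(c • x) = (-c) • x := by module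
        rw [h2, h1, key (-c) (by linarith), key (-c) (by linarith), Real.norm_eq_abs,
          abs_of_nonpos hc]
        ring)

lemma symmGauge_apply {E : Type*} [AddCommGroup E] [Module ℝ E] (A : Set E)
    (hA : Convex ℝ A) (habs : Absorbent ℝ A) (x : E) :
    symmGauge A hA habs x = (gauge A x + gauge A (-x)) / 2 := rfl

/-- If the segments `A ∩ ℝ x` are nearly symmetric, the gauge is nearly its symmetrization. -/
lemma gauge_bounds_of_width {E : Type*} [NormedAddCommGroup E] [NormedSpace ℝ E] {A : Set E}
    (hA : Convex ℝ A) (hcomp : IsCompact A) (h0 : A ∈ nhds (0 : E)) {x : E} (hx : x ≠ 0)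
    {N l u : ℝ} (hN : 0 < N) (hl : 0 < l) (hout : ∀ r : ℝ, r • x ∈ A → N * |r| ≤ u)
    (hin : ∀ r : ℝ, N * |r| ≤ l → r • x ∈ A) : N ≤ u * gauge A x ∧ l * gauge A x ≤ N := by
  have hp : 0 < gauge A x :=
    (gauge_pos (absorbent_nhds_zero h0)
      (NormedSpace.isVonNBounded_of_isBounded ℝ hcomp.isBounded)).2 hx
  constructor
  · have h1 : gauge A ((gauge A x)⁻¹ • x) ≤ 1 := by
      rw [gauge_smul_of_nonneg (inv_nonneg.2 hp.le), smul_eq_mul, inv_mul_cancel₀ hp.ne']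
    rw [gauge_le_one_iff_mem_closure hA h0, hcomp.isClosed.closure_eq] at h1
    have h2 := hout _ h1
    rw [abs_of_pos (inv_pos.2 hp), ← div_eq_mul_inv, div_le_iff₀ hp] at h2
    exact h2
  · have h1 : (l / N) • x ∈ A := hin _ (by rw [abs_of_pos (by positivity)]; field_simp; rfl)
    have h2 := gauge_le_one_of_mem h1
    rw [gauge_smul_of_nonneg (by positivity), smul_eq_mul, div_mul_eq_mul_div, div_le_one hN] at h2
    exact h2

variable {V : Type} [NormedAddCommGroup V] [NormedSpace ℝ V] [FiniteDimensional ℝ V]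

/-- A convex body all of whose planar sections through an affine diameter are nearly conical has
nearly homothetic slices, with the profile of an ellipsoid. -/
lemma exists_slice_seminorm {K : Set V} (hK : IsCompact K) (hc : Convex ℝ K)
    (h0 : (0 : V) ∈ interior K) {a : V} (ha : a ∈ K) {ψ : V →ₗ[ℝ] ℝ} {h : ℝ} (hh : 1 / 2 < h)
    (hh1 : h ≤ 1) (hψa : ψ a = 1) (ha' : (1 - 2 * h) • a ∈ K)
    (hψ : ∀ x ∈ K, 1 - 2 * h ≤ ψ x ∧ ψ x ≤ 1) {ε e : ℝ} (he : 0 < e) (he' : e ≤ 1 / 20)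
    (hε : ε ≤ e ^ 2)
    (hS : ∀ y ∈ LinearMap.ker ψ, y ≠ 0 → NearConic ε fun s t => s • a + t • y ∈ K) {d : ℕ}
    (hd : Module.finrank ℝ (LinearMap.ker ψ) = d) :
    ∃ (P : Seminorm ℝ (LinearMap.ker ψ)) (b : Module.Basis (Fin d) ℝ (LinearMap.ker ψ)),
      (∀ i, P (b i) ≤ 2) ∧ (∀ x i, |b.repr x i| ≤ 2 * P x) ∧
      (∀ (σ : ℝ) (y : LinearMap.ker ψ), (1 - h + h * σ) • a + (y : V) ∈ K →
        |σ| ≤ 1 ∧ P y ≤ √(1 - σ ^ 2) + 20 * e) ∧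
      ∀ (σ : ℝ) (y : LinearMap.ker ψ), |σ| ≤ 1 → P y ≤ √(1 - σ ^ 2) - 20 * e →
        (1 - h + h * σ) • a + (y : V) ∈ K := by
  have hh0 : 0 < h := by linarith
  have hslab : ∀ (σ : ℝ) (y : LinearMap.ker ψ), (1 - h + h * σ) • a + (y : V) ∈ K → |σ| ≤ 1 := by
    intro σ y hy
    have h1 := hψ _ hy
    rw [map_add, map_smul, hψa, LinearMap.mem_ker.1 y.2, smul_eq_mul, mul_one, add_zero] at h1
    rw [abs_le]
    constructor <;> nlinarith
  have hwidth : ∀ y : LinearMap.ker ψ, y ≠ 0 → ∃ N : ℝ, 0 < N ∧ ∀ σ r : ℝ, |σ| ≤ 1 →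
      ((1 - h + h * σ) • a + r • (y : V) ∈ K → N * |r| ≤ √(1 - σ ^ 2) + 5 * e) ∧
      (N * |r| ≤ √(1 - σ ^ 2) - 7 * e → (1 - h + h * σ) • a + r • (y : V) ∈ K) := by
    intro y hy
    have hy' : (y : V) ≠ 0 := by simpa using hy
    obtain ⟨C, hC⟩ := hK.isBounded.exists_norm_le
    refine NearConic.exists_width (S := fun s t => s • a + t • (y : V) ∈ K) he (by linarith) hε hh0
      (hS y y.2 hy') (fun σ r hr => hslab σ (r • y) hr) (by simpa using ha) (by simpa using ha')
      (R := (C + ‖a‖) / ‖(y : V)‖) fun s r hr => ?_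
    rw [le_div_iff₀ (norm_pos_iff.2 hy'), ← Real.norm_eq_abs, ← norm_smul]
    have h1 := hψ _ hr
    rw [map_add, map_smul, map_smul, hψa, LinearMap.mem_ker.1 y.2, smul_zero, smul_eq_mul, mul_one,
      add_zero] at h1
    have h2 : ‖s • a‖ ≤ ‖a‖ := by
      rw [norm_smul, Real.norm_eq_abs]
      exact mul_le_of_le_one_left (norm_nonneg a) (abs_le.2 ⟨by linarith, h1.2⟩)
    have h3 : r • (y : V) = (s • a + r • (y : V)) - s • a := by module
    rw [h3]
    exact (norm_sub_le _ _).trans (add_le_add (hC _ hr) h2)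
  set A : Set (LinearMap.ker ψ) := {y | (1 - h) • a + (y : V) ∈ K} with hA
  have hAcont : Continuous fun y : LinearMap.ker ψ => (1 - h) • a + (y : V) := by fun_prop
  have hAc : Convex ℝ A := by
    intro x hx y hy s t hs ht hst
    have h1 := hc hx hy hs ht hst
    change (1 - h) • a + (((s • x + t • y : LinearMap.ker ψ)) : V) ∈ K
    convert h1 using 1
    obtain rfl : t = 1 - s := by linarith
    rw [Submodule.coe_add, Submodule.coe_smul, Submodule.coe_smul]
    module
  have hAcomp : IsCompact A := by
    have h1 : Topology.IsClosedEmbedding fun y : LinearMap.ker ψ => (1 - h) • a + (y : V) :=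
      (Homeomorph.addLeft ((1 - h) • a)).isClosedEmbedding.comp
        (Submodule.closed_of_finiteDimensional (LinearMap.ker ψ)).isClosedEmbedding_subtypeVal
    exact h1.isCompact_preimage hK
  have hInt : (1 - h) • a ∈ interior K := by
    have h1 := hc.combo_interior_self_mem_interior h0 ha hh0 (by linarith : 0 ≤ 1 - h) (by ring)
    simpa using h1
  have hA0 : A ∈ nhds (0 : LinearMap.ker ψ) := by
    apply hAcont.continuousAt
    change K ∈ nhds ((1 - h) • a + ((0 : LinearMap.ker ψ) : V))
    rw [Submodule.coe_zero, add_zero]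
    exact mem_interior_iff_mem_nhds.1 hInt
  have habs : Absorbent ℝ A := absorbent_nhds_zero hA0
  have hgb : ∀ y : LinearMap.ker ψ, y ≠ 0 → ∃ N : ℝ, 0 < N ∧
      (N ≤ (1 + 5 * e) * gauge A y ∧ (1 - 7 * e) * gauge A y ≤ N) ∧
      (N ≤ (1 + 5 * e) * symmGauge A hAc habs y ∧ (1 - 7 * e) * symmGauge A hAc habs y ≤ N) ∧
      ∀ σ : ℝ, |σ| ≤ 1 → ((1 - h + h * σ) • a + (y : V) ∈ K → N ≤ √(1 - σ ^ 2) + 5 * e) ∧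
        (N ≤ √(1 - σ ^ 2) - 7 * e → (1 - h + h * σ) • a + (y : V) ∈ K) := by
    intro y hy
    obtain ⟨N, hN, hNS⟩ := hwidth y hy
    have h1 : ∀ r : ℝ, (r • y ∈ A → N * |r| ≤ 1 + 5 * e) ∧ (N * |r| ≤ 1 - 7 * e → r • y ∈ A) := by
      intro r
      have h2 := hNS 0 r (by simp)
      simp only [mul_zero, add_zero, ne_eq, OfNat.ofNat_ne_zero, not_false_eq_true, zero_pow,
        sub_zero, Real.sqrt_one] at h2
      exact h2
    have g1 := gauge_bounds_of_width hAc hAcomp hA0 hy hN (by linarith : 0 < 1 - 7 * e)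
      (fun r => (h1 r).1) fun r => (h1 r).2
    have g2 := gauge_bounds_of_width hAc hAcomp hA0 (neg_ne_zero.2 hy) hN
      (by linarith : 0 < 1 - 7 * e) (u := 1 + 5 * e)
      (fun r hr => by
        rw [← abs_neg]
        exact (h1 (-r)).1 (by rwa [neg_smul, ← smul_neg]))
      fun r hr => by
        rw [smul_neg, ← neg_smul]
        exact (h1 (-r)).2 (by rwa [abs_neg])
    refine ⟨N, hN, g1, ?_, fun σ hσ => by simpa using hNS σ 1 hσ⟩
    rw [symmGauge_apply]
    constructor <;> linarith
  obtain ⟨b, hbA, hb⟩ := exists_basis_mem_abs_repr_le hd hAcomp (mem_interior_iff_mem_nhds.2 hA0)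
  refine ⟨symmGauge A hAc habs, b, fun i => ?_, fun x i => ?_, fun σ y hy => ⟨hslab σ y hy, ?_⟩,
    fun σ y hσ hy => ?_⟩
  · obtain ⟨N, hN, g1, g2, -⟩ := hgb (b i) (b.ne_zero i)
    have h1 := gauge_le_one_of_mem (hbA i)
    nlinarith
  · rcases eq_or_ne x 0 with rfl | hx
    · simp
    obtain ⟨N, hN, g1, g2, -⟩ := hgb x hx
    have hp : 0 < gauge A x := by
      by_contra hcon
      push Not at hcon
      nlinarith
    have h1 : gauge A ((gauge A x)⁻¹ • x) ≤ 1 := by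
      rw [gauge_smul_of_nonneg (inv_nonneg.2 hp.le), smul_eq_mul, inv_mul_cancel₀ hp.ne']
    rw [gauge_le_one_iff_mem_closure hAc hA0, hAcomp.isClosed.closure_eq] at h1
    have h2 := hb _ h1 i
    rw [map_smul, Finsupp.smul_apply, smul_eq_mul, abs_mul, abs_of_pos (inv_pos.2 hp),
      inv_mul_le_iff₀ hp, mul_one] at h2
    have h3 := apply_nonneg (symmGauge A hAc habs) x
    nlinarith
  · rcases eq_or_ne y 0 with rfl | hy0
    · rw [map_zero]
      positivity
    obtain ⟨N, hN, -, g2, hNS⟩ := hgb y hy0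
    have h1 := (hNS σ (hslab σ y hy)).1 hy
    have h2 : √(1 - σ ^ 2) ≤ 1 := Real.sqrt_le_one.2 (by nlinarith [sq_nonneg σ])
    by_contra hcon
    push Not at hcon
    nlinarith
  · rcases eq_or_ne y 0 with rfl | hy0
    · rw [abs_le] at hσ
      have h1 := hc ha ha' (by linarith : 0 ≤ (1 + σ) / 2) (by linarith : 0 ≤ (1 - σ) / 2) (by ring)
      rw [Submodule.coe_zero]
      convert h1 using 1
      module
    obtain ⟨N, hN, -, g2, hNS⟩ := hgb y hy0
    have h2 : √(1 - σ ^ 2) ≤ 1 := Real.sqrt_le_one.2 (by nlinarith [sq_nonneg σ])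
    refine (hNS σ hσ).2 ?_
    nlinarith

end Slice

section Ellipsoid

variable {V : Type*} [AddCommGroup V] [Module ℝ V] [FiniteDimensional ℝ V]

/-- A positive definite quadratic form is the square of the Euclidean norm in suitable linear
coordinates. -/
lemma QuadraticMap.PosDef.exists_norm_sq_eq {Q : QuadraticForm ℝ V} (hQ : Q.PosDef)
    {n : ℕ} (hn : Module.finrank ℝ V = n) :
    ∃ T : V ≃ₗ[ℝ] EuclideanSpace ℝ (Fin n), ∀ x, ‖T x‖ ^ 2 = Q x := by
  subst hn
  obtain ⟨w, hw, ⟨f⟩⟩ := Q.equivalent_one_zero_neg_one_weighted_sum_squared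
  have hf : ∀ x, QuadraticMap.weightedSumSquares ℝ w (f x) = Q x := f.map_app
  have hw1 : ∀ i, w i = 1 := by
    intro i
    have h1 : 0 < Q (f.symm (Pi.single i 1)) := by
      refine hQ _ fun h => ?_
      have h2 := congrArg f h
      rw [QuadraticMap.IsometryEquiv.apply_symm_apply] at h2
      have h3 : f (0 : V) = 0 := map_zero f.toLinearEquiv
      rw [h3] at h2
      simpa using congrFun h2 i
    rw [← hf, QuadraticMap.IsometryEquiv.apply_symm_apply,
      QuadraticMap.weightedSumSquares_apply] at h1
    have h2 : ∑ j, w j • ((Pi.single i 1 : Fin _ → ℝ) j * (Pi.single i 1 : Fin _ → ℝ) j) = w i := by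
      simp [Pi.single_apply]
    rw [h2] at h1
    rcases hw i with h3 | h3 | h3 <;> linarith
  refine ⟨f.toLinearEquiv.trans (WithLp.linearEquiv 2 ℝ (Fin _ → ℝ)).symm, fun x => ?_⟩
  rw [← hf, QuadraticMap.weightedSumSquares_apply, EuclideanSpace.norm_sq_eq]
  refine Finset.sum_congr rfl fun i _ => ?_
  rw [hw1, one_smul, Real.norm_eq_abs, sq_abs, pow_two]
  rfl

/-- A convex body squeezed between two concentric homothetic ellipsoids is close to a ball. -/
lemma dBMlt_closedBall_of_quadraticForm {K : Set V} {Q : QuadraticForm ℝ V} (hQ : Q.PosDef)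
    {n : ℕ} (hn : Module.finrank ℝ V = n) {o : V} {τ : ℝ} (hτ : 0 ≤ τ) (hτ' : τ ≤ 1 / 4)
    (hout : ∀ v, o + v ∈ K → Q v ≤ 1 + τ) (hin : ∀ v, Q v ≤ 1 - τ → o + v ∈ K) :
    dBMlt K (closedBall (0 : EuclideanSpace ℝ (Fin n)) 1) (1 + 3 * τ) := by
  obtain ⟨T, hT⟩ := hQ.exists_norm_sq_eq hn
  have hR2 : √(1 + τ) ^ 2 = 1 + τ := Real.sq_sqrt (by linarith)
  have hR : 0 < √(1 + τ) := Real.sqrt_pos.2 (by linarith)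
  set R := √(1 + τ)
  have hlam : 0 < 1 + 3 * τ := by linarith
  have himage : ∀ x, x ∈ ((T.symm.trans (LinearEquiv.smulOfNeZero ℝ V R hR.ne')).toAffineEquiv.trans
      (AffineEquiv.constVAdd ℝ V o)) '' closedBall (0 : EuclideanSpace ℝ (Fin n)) 1 ↔
      Q (x - o) ≤ 1 + τ := by
    intro x
    rw [← hT, ← hR2, sq_le_sq₀ (norm_nonneg _) hR.le]
    constructor
    · rintro ⟨u, hu, rfl⟩
      have h1 : ((T.symm.trans (LinearEquiv.smulOfNeZero ℝ V R hR.ne')).toAffineEquiv.trans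
        (AffineEquiv.constVAdd ℝ V o)) u = o + R • T.symm u := rfl
      rw [h1, add_sub_cancel_left, map_smul, LinearEquiv.apply_symm_apply, norm_smul,
        Real.norm_eq_abs, abs_of_pos hR]
      rw [mem_closedBall_zero_iff] at hu
      exact mul_le_of_le_one_right hR.le hu
    · intro hx
      refine ⟨R⁻¹ • T (x - o), ?_, ?_⟩
      · rw [mem_closedBall_zero_iff, norm_smul, Real.norm_eq_abs, abs_of_pos (inv_pos.2 hR),
          inv_mul_le_iff₀ hR, mul_one]
        exact hx
      · change o + R • T.symm (R⁻¹ • T (x - o)) = x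
        rw [map_smul, smul_inv_smul₀ hR.ne', LinearEquiv.symm_apply_apply, add_sub_cancel]
  refine ⟨_, (-(3 * τ)) • o, fun x hx => (himage x).2 ?_, fun x hx => ?_⟩
  · apply hout
    rwa [add_sub_cancel]
  · rw [himage] at hx
    refine ⟨(1 + 3 * τ) • (o + (1 + 3 * τ)⁻¹ • (x - o)), smul_mem_smul_set (hin _ ?_), _,
      mem_singleton _, ?_⟩
    · rw [QuadraticMap.map_smul, smul_eq_mul, ← mul_inv, inv_mul_le_iff₀ (by positivity)]
      nlinarith [mul_nonneg hτ hτ, mul_nonneg (mul_nonneg hτ hτ) hτ]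
    · change (1 + 3 * τ) • (o + (1 + 3 * τ)⁻¹ • (x - o)) + -(3 * τ) • o = x
      rw [smul_add, smul_inv_smul₀ hlam.ne']
      module

end Ellipsoid

section Core

private lemma sq_add_le_of_profile {σ p q E θ τ : ℝ} (hE : 0 ≤ E) (hE1 : E ≤ 1) (hθ : 0 ≤ θ)
    (hθ1 : θ ≤ 1) (hτ : θ + 6 * E ≤ τ) (hσ : |σ| ≤ 1) (hp : 0 ≤ p) (hpw : p ≤ √(1 - σ ^ 2) + E)
    (hq : |p ^ 2 - q| ≤ θ * p ^ 2) : σ ^ 2 + q ≤ 1 + τ := by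
  have hσ2 : σ ^ 2 ≤ 1 := (sq_le_one_iff_abs_le_one σ).2 hσ
  have hw2 : √(1 - σ ^ 2) ^ 2 = 1 - σ ^ 2 := Real.sq_sqrt (by linarith)
  have hw1 : √(1 - σ ^ 2) ≤ 1 := Real.sqrt_le_one.2 (by nlinarith [sq_nonneg σ])
  set w := √(1 - σ ^ 2)
  have h1 : p ^ 2 ≤ (w + E) ^ 2 := pow_le_pow_left₀ hp hpw 2
  have h2 : p ^ 2 ≤ w ^ 2 + 3 * E := by nlinarith
  have h3 := (abs_le.1 hq).1
  have h4 : θ * p ^ 2 ≤ θ * (1 + 3 * E) := mul_le_mul_of_nonneg_left (by nlinarith [sq_nonneg σ]) hθ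
  nlinarith

private lemma le_profile_of_sq_add_le {σ p q E θ τ : ℝ} (hE : 0 ≤ E) (hE1 : E ≤ 1) (hθ : 0 ≤ θ)
    (hθ1 : θ ≤ 1 / 4) (hτ : θ + 6 * E ≤ τ) (hq : |p ^ 2 - q| ≤ θ * p ^ 2)
    (h : σ ^ 2 + q ≤ 1 - τ) : |σ| ≤ 1 ∧ p ≤ √(1 - σ ^ 2) - E := by
  have h3 := (abs_le.1 hq).2
  have hq0 : (1 - θ) * p ^ 2 ≤ q := by linarith
  have hq1 : 0 ≤ (1 - θ) * p ^ 2 := mul_nonneg (by linarith) (sq_nonneg p)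
  have hσ2 : σ ^ 2 ≤ 1 := by linarith
  have hw2 : √(1 - σ ^ 2) ^ 2 = 1 - σ ^ 2 := Real.sq_sqrt (by linarith)
  have hw1 : √(1 - σ ^ 2) ≤ 1 := Real.sqrt_le_one.2 (by nlinarith [sq_nonneg σ])
  have hw0 : 0 ≤ √(1 - σ ^ 2) := Real.sqrt_nonneg _
  refine ⟨(sq_le_one_iff_abs_le_one σ).1 hσ2, ?_⟩
  set w := √(1 - σ ^ 2)
  have hwE : E ≤ w := by
    refine (abs_le_of_sq_le_sq' ?_ hw0).2
    nlinarith
  have h4 : (1 - θ) * p ^ 2 ≤ (1 - θ) * (w - E) ^ 2 := by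
    have h5 : (w - E) ^ 2 ≤ 1 := pow_le_one₀ (by linarith) (by linarith)
    have h6 : θ * (w - E) ^ 2 ≤ θ * 1 := mul_le_mul_of_nonneg_left h5 hθ
    nlinarith
  have h5 : p ^ 2 ≤ (w - E) ^ 2 := le_of_mul_le_mul_left h4 (by linarith)
  exact (abs_le_of_sq_le_sq' h5 (by linarith)).2

variable {V : Type} [NormedAddCommGroup V] [NormedSpace ℝ V] [FiniteDimensional ℝ V]

/-- A convex body all of whose central planar sections are nearly conical is nearly an ellipsoid. -/
lemma dBMlt_of_sections_nearConic {K : Set V} (hK : IsCompact K) (hc : Convex ℝ K)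
    (h0 : (0 : V) ∈ interior K) {n : ℕ} (hn : Module.finrank ℝ V = n) (hn2 : 2 ≤ n) {ε e : ℝ}
    (he : 0 < e) (hε : ε ≤ e ^ 2)
    (hS : ∀ x y, LinearIndependent ℝ ![x, y] → NearConic ε fun s t => s • x + t • y ∈ K)
    (hsmall : 10 ^ 15 * (n : ℝ) ^ 4 * e ≤ 1 / 4) :
    dBMlt K (closedBall (0 : EuclideanSpace ℝ (Fin n)) 1)
      (1 + 3 * (10 ^ 15 * (n : ℝ) ^ 4 * e)) := by
  have hn1 : (1 : ℝ) ≤ (n : ℝ) ^ 4 := one_le_pow₀ (by exact_mod_cast (by lia : 1 ≤ n))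
  have hne : 1 * e ≤ (n : ℝ) ^ 4 * e := mul_le_mul_of_nonneg_right hn1 he.le
  have hesmall : 10 ^ 15 * e ≤ 1 / 4 := by linarith
  norm_num at hesmall
  have : Nontrivial V := Module.nontrivial_of_finrank_pos (R := ℝ) (by lia)
  obtain ⟨a, haK, ψ, t, ht0, ht1, hψa, htK, hψK⟩ := exists_affine_diameter hK hc h0
  obtain ⟨h, rfl⟩ : ∃ h, t = 2 * h - 1 := ⟨(t + 1) / 2, by ring⟩
  have hh : 1 / 2 < h := by linarith
  have hh1 : h ≤ 1 := by linarith
  have hh0 : 0 < h := by linarith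
  have hψ0 : ψ ≠ 0 := by
    rintro rfl
    simp at hψa
  have hd : Module.finrank ℝ (LinearMap.ker ψ) = n - 1 := by
    have := Module.Dual.finrank_ker_add_one_of_ne_zero (f := ψ) hψ0
    lia
  have hli : ∀ x : V, ψ x = 1 → ∀ y ∈ LinearMap.ker ψ, y ≠ 0 → LinearIndependent ℝ ![x, y] := by
    intro x hx y hy hy0
    rw [LinearIndependent.pair_iff]
    intro s r hsr
    have h1 := congrArg ψ hsr
    rw [map_add, map_smul, map_smul, hx, LinearMap.mem_ker.1 hy, smul_zero, smul_eq_mul, mul_one,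
      add_zero, map_zero] at h1
    rw [h1, zero_smul, zero_add] at hsr
    exact ⟨h1, (smul_eq_zero.1 hsr).resolve_right hy0⟩
  obtain ⟨P, b, hPb, hbP, hout, hin⟩ := exists_slice_seminorm hK hc h0 haK hh hh1 hψa
    (by convert htK using 1; module)
    (fun x hx => ⟨by linarith [(hψK x hx).1], (hψK x hx).2⟩) he (by linarith) hε
    (fun y hy hy0 => hS _ _ (hli a hψa y hy hy0)) hd
  have hP0 : ∀ y, P y = 0 → y = 0 := by
    intro y hy
    rw [← b.forall_coord_eq_zero_iff]
    intro i
    have h1 := hbP y i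
    rw [hy, mul_zero] at h1
    exact abs_nonpos_iff.1 h1
  set E := 20 * e with hE
  have hE0 : 0 < E := by positivity
  have hlines : ∀ y k, P y = 1 → P k = 1 → ∃ β γ : ℝ, ∀ u : ℝ, |u| ≤ 2 →
      |P (y + u • k) ^ 2 - 1 - β * u - γ * u ^ 2| ≤ 2 * 10 ^ 9 * E := by
    intro y k hy hk
    have hk0 : (k : V) ≠ 0 := by
      intro hk0
      rw [Submodule.coe_eq_zero.1 hk0, map_zero] at hk
      exact zero_ne_one hk
    have hcoe : ∀ s r : ℝ, s • (a + (y : V)) + r • (k : V) =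
        s • a + ((s • y + r • k : LinearMap.ker ψ) : V) := by
      intro s r
      rw [Submodule.coe_add, Submodule.coe_smul, Submodule.coe_smul]
      module
    refine exists_quadratic_line (S := fun s r => s • (a + (y : V)) + r • (k : V) ∈ K) (h := h)
      hE0 (by norm_num; linarith) hh.le hh1 hy hk (hε.trans ?_) (hS _ _ (hli _ ?_ k k.2 hk0)) ?_
      (fun σ r hr => hout σ _ ?_) fun σ r hσ hr => ?_
    · rw [hE]
      nlinarith
    · rw [map_add, hψa, LinearMap.mem_ker.1 y.2, add_zero]
    · simpa using interior_subset h0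
    · rwa [← hcoe]
    · rw [hcoe]
      exact hin σ _ hσ hr
  obtain ⟨q, hq⟩ := exists_quadraticForm_of_parallelogram (P := P) (by positivity)
    (parallelogram_of_quadratic_lines hlines) (by lia) b hPb hbP
  set θ : ℝ := 1280 * ((n - 1 : ℕ) : ℝ) ^ 4 * (7 * (2 * 10 ^ 9 * E)) with hθ
  have hθ0 : 0 ≤ θ := by positivity
  set τ := 10 ^ 15 * (n : ℝ) ^ 4 * e with hτ
  have hτ1 : θ + 6 * E ≤ τ := by
    have h1 : ((n - 1 : ℕ) : ℝ) ^ 4 * e ≤ (n : ℝ) ^ 4 * e := by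
      refine mul_le_mul_of_nonneg_right (pow_le_pow_left₀ (by positivity) ?_ 4) he.le
      exact_mod_cast Nat.sub_le n 1
    rw [hθ, hτ, hE]
    linarith only [h1, hne, he]
  let π : V →ₗ[ℝ] LinearMap.ker ψ := LinearMap.codRestrict _ (LinearMap.id - ψ.smulRight a)
    fun x => by simp [hψa]
  have hπ : ∀ x, ((π x : LinearMap.ker ψ) : V) = x - ψ x • a := fun x => rfl
  let Q : QuadraticForm ℝ V := QuadraticMap.linMulLin (h⁻¹ • ψ) (h⁻¹ • ψ) + q.comp π
  have hQ : ∀ x, Q x = (h⁻¹ * ψ x) ^ 2 + q (π x) := by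
    intro x
    rw [pow_two]
    rfl
  have hq0 : ∀ y, (1 - θ) * P y ^ 2 ≤ q y := fun y => by linarith [(abs_le.1 (hq y)).2]
  have hdec : ∀ v, (1 - h) • a + v = (1 - h + h * (h⁻¹ * ψ v)) • a + (π v : V) := by
    intro v
    rw [mul_inv_cancel_left₀ hh0.ne', hπ]
    module
  have hpos : Q.PosDef := by
    intro x hx
    rw [hQ]
    have h1 : 0 ≤ (1 - θ) * P (π x) ^ 2 := mul_nonneg (by linarith) (sq_nonneg _)
    rcases eq_or_ne (ψ x) 0 with h2 | h2
    · have h3 : π x ≠ 0 := by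
        intro h3
        have h4 := hπ x
        rw [h3, h2, zero_smul, sub_zero, Submodule.coe_zero] at h4
        exact hx h4.symm
      have h4 : 0 < P (π x) := lt_of_le_of_ne (apply_nonneg P _) fun h4 => h3 (hP0 _ h4.symm)
      have h5 : 0 < (1 - θ) * P (π x) ^ 2 := mul_pos (by linarith) (by positivity)
      exact add_pos_of_nonneg_of_pos (sq_nonneg _) (h5.trans_le (hq0 _))
    · have h3 : h⁻¹ * ψ x ≠ 0 := mul_ne_zero (inv_ne_zero hh0.ne') h2
      exact add_pos_of_pos_of_nonneg (by positivity) (h1.trans (hq0 _))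
  refine dBMlt_closedBall_of_quadraticForm (o := (1 - h) • a) hpos hn (by positivity) hsmall
    (fun v hv => ?_) fun v hv => ?_
  · rw [hdec] at hv
    obtain ⟨h1, h2⟩ := hout _ _ hv
    rw [hQ]
    exact sq_add_le_of_profile hE0.le (by linarith) hθ0 (by linarith) hτ1 h1 (apply_nonneg P _) h2
      (hq _)
  · rw [hQ] at hv
    rw [hdec]
    obtain ⟨h1, h2⟩ := le_profile_of_sq_add_le hE0.le (by linarith) hθ0 (by linarith) hτ1
      (hq _) hv
    exact hin _ _ h1 h2

end Core

section Main

lemma dBMlt.mono {V W : Type*} [AddCommGroup V] [Module ℝ V] [AddCommGroup W] [Module ℝ W]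
    {K : Set V} {L : Set W} {r s : ℝ} (h : dBMlt K L r) (hK : Convex ℝ K) (h0 : (0 : V) ∈ K)
    (hr : 0 ≤ r) (hrs : r ≤ s) : dBMlt K L s := by
  obtain ⟨T, z, h1, h2⟩ := h
  refine ⟨T, z, h1, h2.trans (add_subset_add_right ?_)⟩
  rintro _ ⟨x, hx, rfl⟩
  rcases hr.eq_or_lt with rfl | hr
  · exact ⟨0, h0, by simp⟩
  have hs : 0 < s := hr.trans_le hrs
  refine ⟨(r / s) • x, hK.smul_mem_of_zero_mem h0 hx ⟨by positivity, (div_le_one hs).2 hrs⟩, ?_⟩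
  change s • (r / s) • x = r • x
  rw [smul_smul, mul_div_cancel₀ _ hs.ne']

variable {V : Type*} [NormedAddCommGroup V] [NormedSpace ℝ V] [FiniteDimensional ℝ V]

/-- A rough bound on the Banach–Mazur distance between a convex body and a ball. -/
lemma dBMlt_closedBall_of_two_mul_sq_le {K : Set V} (hK : IsCompact K) (hc : Convex ℝ K)
    (h0 : (0 : V) ∈ interior K) {n : ℕ} (hn : Module.finrank ℝ V = n) (hn1 : 1 ≤ n) {r : ℝ}
    (hr : 2 * (n : ℝ) ^ 2 ≤ r) : dBMlt K (closedBall (0 : EuclideanSpace ℝ (Fin n)) 1) r := by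
  obtain ⟨b, hbK, hb⟩ := exists_basis_mem_abs_repr_le hn hK h0
  have hn0 : (1 : ℝ) ≤ n := by exact_mod_cast hn1
  have hnpos : (0 : ℝ) < n := by linarith
  have hr0 : 0 < r := lt_of_lt_of_le (by positivity) hr
  have hsimplex : ∀ v : V, (∀ i, 0 ≤ b.repr v i) → ∑ i, b.repr v i ≤ 1 → v ∈ K := by
    intro v hv hsum
    have h1 := hc.sum_mem (t := Finset.univ) (w := fun i : Option (Fin n) =>
      i.elim (1 - ∑ j, b.repr v j) fun j => b.repr v j) (z := fun i => i.elim 0 fun j => b j)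
      (fun i _ => ?_) (by simp) (fun i _ => ?_)
    · rw [Fintype.sum_option] at h1
      simpa [b.sum_repr] using h1
    · cases i with
      | none => simpa using hsum
      | some i => exact hv i
    · cases i with
      | none => exact interior_subset h0
      | some i => exact hbK i
  let T : EuclideanSpace ℝ (Fin n) ≃ₗ[ℝ] V :=
    (WithLp.linearEquiv 2 ℝ (Fin n → ℝ)).trans (b.equivFun.symm.trans
      (LinearEquiv.smulOfNeZero ℝ V (n : ℝ) hnpos.ne'))
  have hT : ∀ u i, b.repr (T u) i = n * u i := by
    intro u i
    change b.repr ((n : ℝ) • b.equivFun.symm (fun j => u j)) i = _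
    rw [map_smul, Finsupp.smul_apply, smul_eq_mul, ← b.equivFun_apply,
      LinearEquiv.apply_symm_apply]
  set o : V := (1 / (2 * n) : ℝ) • ∑ i, b i with ho
  have hoi : ∀ i, b.repr o i = 1 / (2 * n) := by
    intro i
    rw [ho, map_smul, map_sum, Finsupp.smul_apply, Finsupp.finsetSum_apply, smul_eq_mul]
    simp [Finsupp.single_apply]
  refine ⟨T.toAffineEquiv, -(r • o), fun x hx => ⟨T.symm x, ?_, T.apply_symm_apply x⟩, ?_⟩
  · rw [mem_closedBall_zero_iff, ← abs_norm, ← sq_le_one_iff_abs_le_one,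
      EuclideanSpace.norm_sq_eq]
    have h1 : ∀ i, ‖T.symm x i‖ ^ 2 ≤ 1 / n := by
      intro i
      have h2 := hT (T.symm x) i
      rw [LinearEquiv.apply_symm_apply] at h2
      have h3 := hb x hx i
      rw [h2, abs_mul, abs_of_pos hnpos] at h3
      rw [Real.norm_eq_abs, le_div_iff₀ hnpos]
      nlinarith [abs_nonneg (T.symm x i)]
    calc ∑ i, ‖T.symm x i‖ ^ 2 ≤ ∑ _i : Fin n, (1 / n : ℝ) := Finset.sum_le_sum fun i _ => h1 i
      _ = 1 := by
        rw [Finset.sum_const, Finset.card_univ, Fintype.card_fin, nsmul_eq_mul]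
        field_simp
  · rintro _ ⟨u, hu, rfl⟩
    rw [mem_closedBall_zero_iff] at hu
    have hcoord : ∀ i, b.repr (o + r⁻¹ • T u) i = 1 / (2 * n) + r⁻¹ * (n * u i) := by
      intro i
      rw [map_add, Finsupp.add_apply, hoi, map_smul, Finsupp.smul_apply, smul_eq_mul, hT]
    have hle : ∀ i, |r⁻¹ * (n * u i)| ≤ 1 / (2 * n) := by
      intro i
      have h1 : |u i| ≤ 1 := (PiLp.norm_apply_le u i).trans hu
      rw [abs_mul, abs_mul, abs_of_pos (inv_pos.2 hr0), abs_of_pos hnpos, inv_mul_le_iff₀ hr0,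
        mul_one_div, le_div_iff₀ (by positivity)]
      nlinarith
    refine ⟨r • (o + r⁻¹ • T u), smul_mem_smul_set (hsimplex _ ?_ ?_), _, mem_singleton _, ?_⟩
    · intro i
      rw [hcoord]
      linarith [(abs_le.1 (hle i)).1]
    · calc ∑ i, b.repr (o + r⁻¹ • T u) i ≤ ∑ _i : Fin n, (1 / n : ℝ) := by
            refine Finset.sum_le_sum fun i _ => ?_
            rw [hcoord]
            have h1 := (abs_le.1 (hle i)).2
            have h2 : (1 / n : ℝ) = 1 / (2 * n) + 1 / (2 * n) := by field_simp; norm_num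
            linarith
        _ = 1 := by
          rw [Finset.sum_const, Finset.card_univ, Fintype.card_fin, nsmul_eq_mul]
          field_simp
    · change r • (o + r⁻¹ • T u) + -(r • o) = T u
      rw [smul_add, smul_inv_smul₀ hr0.ne']
      abel

end Main

theorem stmt0 :
    ∃ c : ℝ, 0 < c ∧
      ∀ (n : ℕ), 3 ≤ n →
        ∀ K : Set (EuclideanSpace ℝ (Fin n)),
          IsCompact K → Convex ℝ K → 0 ∈ interior K →
            ∀ δ : ℝ, 0 < δ →
              (∀ E F : Submodule ℝ (EuclideanSpace ℝ (Fin n)),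
                Module.finrank ℝ E = 2 → Module.finrank ℝ F = 2 →
                dBMlt (Subtype.val ⁻¹' K : Set E) (Subtype.val ⁻¹' K : Set F) (1 + δ)) →
              dBMlt K (closedBall (0 : EuclideanSpace ℝ (Fin n)) 1)
                (1 + c * (n : ℝ) ^ (2 * n ^ 2) * δ ^ ((1 : ℝ) / 6)) := by
  obtain ⟨C, δ₀, hC, hδ₀, hsec⟩ := exists_sections_nearConic
  set d := min δ₀ 1 with hd
  have hd0 : 0 < d := lt_min hδ₀ one_pos
  have hd6 : 0 < d ^ ((1 : ℝ) / 6) := Real.rpow_pos_of_pos hd0 _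
  refine ⟨8 * 10 ^ 15 * √C + 2 / d ^ ((1 : ℝ) / 6), by positivity,
    fun n hn K hK hc h0 δ hδ hdist => ?_⟩
  have hfin : Module.finrank ℝ (EuclideanSpace ℝ (Fin n)) = n := finrank_euclideanSpace_fin
  have hn1 : (1 : ℝ) ≤ n := by exact_mod_cast (by lia : 1 ≤ n)
  have hpow : ∀ k ≤ 18, (n : ℝ) ^ k ≤ (n : ℝ) ^ (2 * n ^ 2) := fun k hk =>
    pow_le_pow_right₀ hn1 (hk.trans (by nlinarith))
  have hδ6 : 0 < δ ^ ((1 : ℝ) / 6) := Real.rpow_pos_of_pos hδ _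
  set M := (n : ℝ) ^ (2 * n ^ 2)
  have hM : 0 < M := by positivity
  rcases lt_or_ge d δ with hlt | hle
  · refine dBMlt_closedBall_of_two_mul_sq_le hK hc h0 hfin (by lia) ?_
    have h1 : d ^ ((1 : ℝ) / 6) ≤ δ ^ ((1 : ℝ) / 6) :=
      Real.rpow_le_rpow hd0.le hlt.le (by norm_num)
    have h2 : 2 * M ≤ 2 / d ^ ((1 : ℝ) / 6) * M * δ ^ ((1 : ℝ) / 6) := by
      rw [div_mul_eq_mul_div, div_mul_eq_mul_div, le_div_iff₀ hd6]
      exact mul_le_mul_of_nonneg_left h1 (by positivity)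
    have h3 : 0 ≤ 8 * 10 ^ 15 * √C * M * δ ^ ((1 : ℝ) / 6) := by positivity
    have h4 := hpow 2 (by norm_num)
    rw [add_mul, add_mul]
    linarith
  have hδ1 : δ ≤ 1 := hle.trans (min_le_right _ _)
  have h4 : δ ^ ((1 : ℝ) / 4) ≤ δ ^ ((1 : ℝ) / 6) :=
    Real.rpow_le_rpow_of_exponent_ge hδ hδ1 (by norm_num)
  set e := √C * δ ^ ((1 : ℝ) / 4) with he
  have he0 : 0 < e := by positivity
  have he2 : C * √δ = e ^ 2 := by
    rw [he, mul_pow, Real.sq_sqrt hC.le, ← Real.rpow_natCast (δ ^ ((1 : ℝ) / 4)),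
      ← Real.rpow_mul hδ.le, Real.sqrt_eq_rpow]
    norm_num
  have he6 : e ≤ √C * δ ^ ((1 : ℝ) / 6) := mul_le_mul_of_nonneg_left h4 (by positivity)
  have hsum : 8 * 10 ^ 15 * (√C * δ ^ ((1 : ℝ) / 6)) * M ≤
      (8 * 10 ^ 15 * √C + 2 / d ^ ((1 : ℝ) / 6)) * M * δ ^ ((1 : ℝ) / 6) := by
    have : 0 ≤ 2 / d ^ ((1 : ℝ) / 6) * M * δ ^ ((1 : ℝ) / 6) := by positivity
    linarith
  have hmain : ∀ k ≤ 18, 10 ^ 15 * (n : ℝ) ^ k * e ≤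
      10 ^ 15 * (√C * δ ^ ((1 : ℝ) / 6)) * M := by
    intro k hk
    have := mul_le_mul (hpow k hk) he6 he0.le hM.le
    linarith
  rcases le_or_gt (10 ^ 15 * (n : ℝ) ^ 4 * e) (1 / 4) with hsmall | hlarge
  · refine (dBMlt_of_sections_nearConic hK hc h0 hfin (by lia) he0 he2.le
      (hsec K δ (hn.trans hfin.ge) hK hc h0 hδ (hle.trans (min_le_left _ _)) hdist) hsmall).mono hc
      (interior_subset h0) (by positivity) ?_
    have := hmain 4 (by norm_num)
    have : 0 ≤ (√C * δ ^ ((1 : ℝ) / 6)) * M := by positivity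
    linarith
  · refine dBMlt_closedBall_of_two_mul_sq_le hK hc h0 hfin (by lia) ?_
    have h5 := hmain 6 (by norm_num)
    have h6 : (n : ℝ) ^ 2 * (1 / 4) ≤ (n : ℝ) ^ 2 * (10 ^ 15 * (n : ℝ) ^ 4 * e) :=
      mul_le_mul_of_nonneg_left hlarge.le (by positivity)
    linarith
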